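/- Let q be a prime power and G = Sp(4,q), the symplectic group of 4×4 matrices over the field with q elements preserving a nondegenerate alternating form. Then for every field F and every finite-dimensional FG-module M, dim H^2(G,M) ≤ 3·dim M. -/

import Mathlib

/-- A family of `2`-cocycles of `G` with values in the representation `ρ` on `M`, depending
linearly on a parameter in `V`. -/
structure Fam {F G M : Type} [Field F] [Group G] [AddCommGroup M] [Module F M]
    (ρ : Representation F G M) (V : Type) [AddCommGroup V] [Module F V] where
  toFun : G → G → V →ₗ[F] M
  cond : ∀ g h k, ρ g ∘ₗ toFun h k + toFun g (h * k) = toFun g h + toFun (g * h) k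

section Extension

variable {F G M : Type} [Field F] [Group G] [AddCommGroup M] [Module F M]
  {ρ : Representation F G M} {V : Type} [AddCommGroup V] [Module F V]

namespace Fam

theorem one_left (c : Fam ρ V) (k : G) : c.toFun 1 k = c.toFun 1 1 := by
  have h := c.cond 1 1 k
  simp only [map_one, one_mul, mul_one, Module.End.one_eq_id, LinearMap.id_comp] at h
  exact add_right_cancel h

theorem one_right (c : Fam ρ V) (g : G) : c.toFun g 1 = ρ g ∘ₗ c.toFun 1 1 := by
  have h := c.cond g 1 1
  simp only [mul_one] at h
  exact (add_right_cancel h).symm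

end Fam

/-- The extension of `G` by `V →ₗ[F] M` defined by a family of cocycles. -/
@[ext] structure FamExt (c : Fam ρ V) where
  fst : V →ₗ[F] M
  snd : G

namespace FamExt

variable {c : Fam ρ V}

instance : Mul (FamExt c) := ⟨fun x y => ⟨x.fst + ρ x.snd ∘ₗ y.fst + c.toFun x.snd y.snd,
  x.snd * y.snd⟩⟩
instance : One (FamExt c) := ⟨⟨-c.toFun 1 1, 1⟩⟩
instance : Inv (FamExt c) := ⟨fun x => ⟨-(ρ x.snd⁻¹ ∘ₗ x.fst) - c.toFun x.snd⁻¹ x.snd - c.toFun 1 1,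
  x.snd⁻¹⟩⟩

theorem mul_fst (x y : FamExt c) : (x * y).fst =
    x.fst + ρ x.snd ∘ₗ y.fst + c.toFun x.snd y.snd := rfl
@[simp] theorem mul_snd (x y : FamExt c) : (x * y).snd = x.snd * y.snd := rfl
theorem one_fst : (1 : FamExt c).fst = -c.toFun 1 1 := rfl
@[simp] theorem one_snd : (1 : FamExt c).snd = 1 := rfl
theorem inv_fst (x : FamExt c) :
    (x⁻¹).fst = -(ρ x.snd⁻¹ ∘ₗ x.fst) - c.toFun x.snd⁻¹ x.snd - c.toFun 1 1 := rfl

instance : Group (FamExt c) := Group.ofLeftAxioms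
  (fun x y z => by
    ext1
    · have h := c.cond x.snd y.snd z.snd
      simp only [mul_fst, mul_snd, map_mul, LinearMap.comp_add, Module.End.mul_eq_comp,
        LinearMap.comp_assoc]
      have h' := sub_eq_zero.2 h
      rw [← sub_eq_zero, ← neg_eq_zero, ← h']; abel
    · simp [mul_assoc])
  (fun x => by
    ext1
    · rw [mul_fst, one_snd, c.one_left, one_fst, map_one, Module.End.one_eq_id,
        LinearMap.id_comp]; abel
    · simp)
  (fun x => by
    have hs : (x⁻¹).snd = x.snd⁻¹ := rfl
    ext1
    · rw [mul_fst, hs, inv_fst, one_fst]; abel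
    · rw [mul_snd, hs, one_snd, inv_mul_cancel])

@[simp] theorem inv_snd (x : FamExt c) : (x⁻¹).snd = x.snd⁻¹ := rfl

/-- Projection to `G`. -/
def proj (c : Fam ρ V) : FamExt c →* G where
  toFun := snd
  map_one' := rfl
  map_mul' _ _ := rfl

@[simp] theorem proj_apply (x : FamExt c) : proj c x = x.snd := rfl

@[simp] theorem pow_snd (x : FamExt c) (n : ℕ) : (x ^ n).snd = x.snd ^ n := map_pow (proj c) x n
@[simp] theorem zpow_snd (x : FamExt c) (n : ℤ) : (x ^ n).snd = x.snd ^ n := map_zpow (proj c) x n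

/-- Inclusion of the kernel. -/
def ι (c : Fam ρ V) (n : V →ₗ[F] M) : FamExt c := ⟨n - c.toFun 1 1, 1⟩

@[simp] theorem ι_snd (n : V →ₗ[F] M) : (ι c n).snd = 1 := rfl

theorem ι_mul_fst (n : V →ₗ[F] M) (x : FamExt c) : (ι c n * x).fst = n + x.fst := by
  rw [mul_fst, ι_snd, c.one_left, map_one, Module.End.one_eq_id, LinearMap.id_comp]
  simp only [ι]; abel

theorem ι_inj {m n : V →ₗ[F] M} (h : ι c m = ι c n) : m = n := by
  have := congrArg fst h
  simpa [ι] using this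

theorem eq_ι_mul {x y : FamExt c} (h : x.snd = y.snd) : x = ι c (x.fst - y.fst) * y := by
  ext1
  · rw [ι_mul_fst]; abel
  · simpa using h

theorem exists_ι {x y : FamExt c} (h : x.snd = y.snd) : ∃ n, x = ι c n * y := ⟨_, eq_ι_mul h⟩

@[simp] theorem ι_zero : ι c 0 = 1 := by ext1 <;> simp [ι, one_fst]

theorem ι_add (m n : V →ₗ[F] M) : ι c (m + n) = ι c m * ι c n := by
  ext1
  · rw [ι_mul_fst]; simp only [ι]; abel
  · simp

theorem ι_nsmul (k : ℕ) (m : V →ₗ[F] M) : ι c (k • m) = ι c m ^ k := by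
  induction k with
  | zero => simp
  | succ k ih => rw [succ_nsmul, ι_add, ih, pow_succ]

theorem ι_eq_one {m : V →ₗ[F] M} : ι c m = 1 ↔ m = 0 := by
  rw [← ι_zero]; exact ⟨ι_inj, fun h => by rw [h]⟩

theorem ι_comm (m n : V →ₗ[F] M) : ι c m * ι c n = ι c n * ι c m := by
  rw [← ι_add, add_comm, ι_add]

theorem mul_ι (x : FamExt c) (n : V →ₗ[F] M) : x * ι c n = ι c (ρ x.snd ∘ₗ n) * x := by
  ext1
  · rw [ι_mul_fst, mul_fst]
    simp only [ι, LinearMap.comp_sub, ← c.one_right]; abel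
  · simp

theorem conj_ι (x : FamExt c) (n : V →ₗ[F] M) : x * ι c n * x⁻¹ = ι c (ρ x.snd ∘ₗ n) := by
  rw [mul_ι, mul_inv_cancel_right]

theorem exists_eq_ι {x : FamExt c} (h : x.snd = 1) : ∃ n, x = ι c n := by
  obtain ⟨n, hn⟩ := exists_ι (x := x) (y := 1) (by simpa using h)
  exact ⟨n, by simpa using hn⟩

theorem exists_lift (g : G) : ∃ x : FamExt c, x.snd = g := ⟨⟨0, g⟩, rfl⟩

end FamExt

variable {V' V'' : Type} [AddCommGroup V'] [Module F V'] [AddCommGroup V''] [Module F V'']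

/-- Restriction of a family along a linear map of parameter spaces. -/
def Fam.comap (c : Fam ρ V) (j : V' →ₗ[F] V) : Fam ρ V' where
  toFun g h := c.toFun g h ∘ₗ j
  cond g h k := by
    have := congrArg (· ∘ₗ j) (c.cond g h k)
    simpa only [LinearMap.add_comp, LinearMap.comp_assoc] using this

@[simp] theorem Fam.comap_toFun (c : Fam ρ V) (j : V' →ₗ[F] V) (g h : G) :
    (c.comap j).toFun g h = c.toFun g h ∘ₗ j := rfl

/-- The map of extensions induced by a linear map of parameter spaces. -/
def FamExt.map (c : Fam ρ V) (j : V' →ₗ[F] V) : FamExt c →* FamExt (c.comap j) where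
  toFun x := ⟨x.fst ∘ₗ j, x.snd⟩
  map_one' := by ext1 <;> simp [FamExt.one_fst, LinearMap.neg_comp]
  map_mul' x y := by
    ext1
    · rw [FamExt.mul_fst, FamExt.mul_fst]
      simp [LinearMap.add_comp, LinearMap.comp_assoc]
    · rfl

@[simp] theorem FamExt.map_snd (c : Fam ρ V) (j : V' →ₗ[F] V) (x : FamExt c) :
    (FamExt.map c j x).snd = x.snd := rfl

@[simp] theorem FamExt.map_ι (c : Fam ρ V) (j : V' →ₗ[F] V) (n : V →ₗ[F] M) :
    FamExt.map c j (FamExt.ι c n) = FamExt.ι (c.comap j) (n ∘ₗ j) := by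
  ext1
  · exact LinearMap.sub_comp _ _ _
  · rfl

/-- The extension attached to the family splits. -/
def Splits (c : Fam ρ V) : Prop := ∃ s : G →* FamExt c, ∀ g, (s g).snd = g

/-- The family splits on a subspace of parameters of codimension at most `k`. -/
def Red (c : Fam ρ V) (k : ℕ) : Prop :=
  ∃ (V' : Type) (_ : AddCommGroup V') (_ : Module F V') (_ : FiniteDimensional F V')
    (j : V' →ₗ[F] V), Function.Injective j ∧ Module.finrank F V ≤ Module.finrank F V' + k ∧
      Splits (c.comap j)

/-- Every family with finite-dimensional parameter space splits in codimension `k`. -/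
def Codim (ρ : Representation F G M) (k : ℕ) : Prop :=
  ∀ (V : Type) [AddCommGroup V] [Module F V] [FiniteDimensional F V] (c : Fam ρ V), Red c k

theorem Red.of_splits [FiniteDimensional F V] {c : Fam ρ V} (h : Splits c) (k : ℕ) : Red c k :=
  ⟨V, _, _, inferInstance, LinearMap.id, Function.injective_id, by simp, h⟩

theorem Red.mono {c : Fam ρ V} {k l : ℕ} (h : Red c k) (hkl : k ≤ l) : Red c l := by
  obtain ⟨V', _, _, _, j, hj, hf, hs⟩ := h
  exact ⟨V', _, _, inferInstance, j, hj, by omega, hs⟩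

theorem Codim.mono {k l : ℕ} (h : Codim ρ k) (hkl : k ≤ l) : Codim ρ l :=
  fun V _ _ _ c => (h V c).mono hkl

theorem Red.of_comap {c : Fam ρ V} {k l : ℕ} (j : V' →ₗ[F] V) (hj : Function.Injective j)
    (hk : Module.finrank F V ≤ Module.finrank F V' + k) (h : Red (c.comap j) l) :
    Red c (k + l) := by
  obtain ⟨V', _, _, _, j', hj', hf, hs⟩ := h
  exact ⟨V', _, _, inferInstance, j ∘ₗ j', hj.comp hj', by omega, hs⟩

/-- Killing a linear map on the parameter space costs at most the dimension of its target. -/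
theorem Red.kill [FiniteDimensional F V] {c : Fam ρ V} {A : Type} [AddCommGroup A] [Module F A]
    [FiniteDimensional F A] (φ : V →ₗ[F] A) {k l : ℕ} (hk : Module.finrank F A ≤ k)
    (h : ∀ (V' : Type) [AddCommGroup V'] [Module F V'] [FiniteDimensional F V'] (j : V' →ₗ[F] V),
      φ ∘ₗ j = 0 → Red (c.comap j) l) : Red c (k + l) := by
  refine Red.of_comap (LinearMap.ker φ).subtype Subtype.val_injective ?_ (h _ _ ?_)
  · have h1 := φ.finrank_range_add_finrank_ker
    have h2 := (LinearMap.range φ).finrank_le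
    omega
  · ext ⟨v, hv⟩; simpa using hv

/-- Killing a linear map with values in a submodule. -/
theorem Red.killIn [FiniteDimensional F V] {c : Fam ρ V} {A : Type} [AddCommGroup A] [Module F A]
    [FiniteDimensional F A] (φ : V →ₗ[F] A) (W : Submodule F A) (hW : ∀ v, φ v ∈ W) {k l : ℕ}
    (hk : Module.finrank F W ≤ k)
    (h : ∀ (V' : Type) [AddCommGroup V'] [Module F V'] [FiniteDimensional F V'] (j : V' →ₗ[F] V),
      φ ∘ₗ j = 0 → Red (c.comap j) l) : Red c (k + l) := by
  refine Red.kill (φ.codRestrict W hW) hk fun V' _ _ _ j hj => h V' j ?_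
  ext v
  simpa using congrArg (fun f => ((f v : W) : A)) hj

/-- Restriction of a family along a group homomorphism. -/
def Fam.res {D : Type} [Group D] (d : D →* G) (c : Fam ρ V) :
    Fam (ρ.comp d : Representation F D M) V where
  toFun g h := c.toFun (d g) (d h)
  cond g h k := by simpa using c.cond (d g) (d h) (d k)

@[simp] theorem Fam.res_toFun {D : Type} [Group D] (d : D →* G) (c : Fam ρ V) (g h : D) :
    (c.res d).toFun g h = c.toFun (d g) (d h) := rfl

/-- The map of extensions attached to a group homomorphism. -/
def FamExt.res {D : Type} [Group D] (d : D →* G) (c : Fam ρ V) : FamExt (c.res d) →* FamExt c where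
  toFun x := ⟨x.fst, d x.snd⟩
  map_one' := by ext1 <;> simp [FamExt.one_fst]
  map_mul' x y := by
    ext1
    · rfl
    · exact map_mul d _ _

@[simp] theorem FamExt.res_snd {D : Type} [Group D] (d : D →* G) (c : Fam ρ V)
    (x : FamExt (c.res d)) :
    (FamExt.res d c x).snd = d x.snd := rfl

end Extension

section Averaging

variable {F G M : Type} [Field F] [Group G] [AddCommGroup M] [Module F M]
  {ρ : Representation F G M} {V : Type} [AddCommGroup V] [Module F V] {c : Fam ρ V}

namespace FamExt

/-- The average of a finite family of elements lying over `g`. -/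
def avg {I : Type} [Fintype I] (x : I → FamExt c) (g : G) : FamExt c :=
  ⟨(Fintype.card I : F)⁻¹ • ∑ i, (x i).fst, g⟩

@[simp] theorem avg_snd {I : Type} [Fintype I] (x : I → FamExt c) (g : G) :
    (avg x g).snd = g := rfl

theorem avg_mul {I : Type} [Fintype I] (hI : (Fintype.card I : F) ≠ 0) (x y : I → FamExt c)
    (g h : G) (hx : ∀ i, (x i).snd = g) (hy : ∀ i, (y i).snd = h) :
    avg (fun i => x i * y i) (g * h) = avg x g * avg y h := by
  ext1
  · simp only [avg, mul_fst, hx, hy, Finset.sum_add_distrib, smul_add, Finset.sum_const,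
      Finset.card_univ]
    rw [← Nat.cast_smul_eq_nsmul F, smul_smul, inv_mul_cancel₀ hI, one_smul, LinearMap.comp_smul]
    congr 3
    ext v
    simp
  · rfl

theorem avg_const {I : Type} [Fintype I] (hI : (Fintype.card I : F) ≠ 0) (x : FamExt c) :
    avg (fun _ : I => x) x.snd = x := by
  ext1
  · simp only [avg, Finset.sum_const, Finset.card_univ]
    rw [← Nat.cast_smul_eq_nsmul F, smul_smul, inv_mul_cancel₀ hI, one_smul]
  · rfl

theorem avg_equiv {I : Type} [Fintype I] (e : I ≃ I) (x : I → FamExt c) (g : G) :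
    avg (fun i => x (e i)) g = avg x g := by
  simp only [avg]
  rw [Equiv.sum_comp e (fun i => (x i).fst)]

/-- Two lifts of a finite group of invertible order that are conjugate downstairs are conjugate
upstairs, by an element over the given one. -/
theorem exists_conj {K : Type} [Group K] [Finite K] (hK : (Nat.card K : F) ≠ 0)
    (σ τ : K →* FamExt c) (g : G) (h : ∀ k, (σ k).snd * g = g * (τ k).snd) :
    ∃ e : FamExt c, e.snd = g ∧ ∀ k, σ k * e = e * τ k := by
  have := Fintype.ofFinite K
  rw [Nat.card_eq_fintype_card] at hK
  obtain ⟨e0, he0⟩ := exists_lift (c := c) g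
  have hover : ∀ k, (σ k * e0 * (τ k)⁻¹).snd = g := fun k => by
    simp [he0, h]
  refine ⟨avg (fun k => σ k * e0 * (τ k)⁻¹) g, rfl, fun l => ?_⟩
  have h1 : avg (fun k => σ l * (σ k * e0 * (τ k)⁻¹)) ((σ l).snd * g) =
      σ l * avg (fun k => σ k * e0 * (τ k)⁻¹) g := by
    conv_rhs => rw [← avg_const (I := K) hK (σ l)]
    exact avg_mul hK _ _ _ _ (fun _ => rfl) hover
  have h2 : avg (fun k => (σ k * e0 * (τ k)⁻¹) * τ l) (g * (τ l).snd) =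
      avg (fun k => σ k * e0 * (τ k)⁻¹) g * τ l := by
    conv_rhs => rw [← avg_const (I := K) hK (τ l)]
    exact avg_mul hK _ _ _ _ hover (fun _ => rfl)
  rw [← h1, ← h2, h l, ← avg_equiv (Equiv.mulLeft l) (fun k => σ k * e0 * (τ k)⁻¹ * τ l)]
  congr 1
  ext1 k
  simp [mul_assoc]

/-- A lift on a subgroup of invertible index gives a lift on the whole group. -/
theorem exists_transfer {H D : Type} [Group H] [Group D] (j : H →* G) (d : D →* H)
    (hd : Function.Injective d) (hi : (d.range.index : F) ≠ 0) (σ : D →* FamExt c)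
    (hσ : ∀ x, (σ x).snd = j (d x)) : ∃ τ : H →* FamExt c, ∀ h, (τ h).snd = j h := by
  classical
  have hfin : d.range.index ≠ 0 := fun h => hi (by simp [h])
  have : d.range.FiniteIndex := ⟨hfin⟩
  have : Finite (H ⧸ d.range) := inferInstance
  have := Fintype.ofFinite (H ⧸ d.range)
  rw [Subgroup.index, Nat.card_eq_fintype_card] at hi
  obtain ⟨s, hs, hsσ⟩ : ∃ s : H → FamExt c, (∀ h, (s h).snd = j h) ∧
      ∀ h x, s (h * d x) = s h * σ x := by
    have key : ∀ h : H, ∃ x, h = (h : H ⧸ d.range).out * d x := fun h => by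
      obtain ⟨⟨_, x, rfl⟩, hx⟩ := QuotientGroup.mk_out_eq_mul d.range h
      exact ⟨x⁻¹, by rw [hx]; simp⟩
    choose x hx using key
    refine ⟨fun h => ⟨0, j (h : H ⧸ d.range).out⟩ * σ (x h), fun h => ?_, fun h y => ?_⟩
    · rw [mul_snd, hσ, ← map_mul, ← hx]
    · have hq : ((h * d y : H) : H ⧸ d.range) = h := by
        rw [QuotientGroup.eq]; simp
      have : x (h * d y) = x h * y := by
        apply hd
        have h1 := hx (h * d y)
        have h2 := hx h
        rw [hq] at h1
        rw [map_mul]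
        nth_rewrite 1 [h2] at h1
        rw [mul_assoc] at h1
        exact (mul_left_cancel h1).symm
      dsimp only
      rw [this, map_mul, hq, mul_assoc]
  let a (g h : H) : FamExt c := s (g * h) * (s h)⁻¹
  have ha : ∀ g h, (a g h).snd = j g := fun g h => by simp [a, hs]
  have ha2 : ∀ g h h' : H, (h : H ⧸ d.range) = h' → a g h = a g h' := fun g h h' e => by
    rw [QuotientGroup.eq] at e
    obtain ⟨x, hx⟩ := e
    obtain rfl : h' = h * d x := by rw [hx]; simp
    simp only [a]
    rw [← mul_assoc, hsσ, hsσ]; group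
  have hmul : ∀ g g', avg (fun x : H ⧸ d.range => a (g * g') x.out) (j (g * g')) =
      avg (fun x : H ⧸ d.range => a g x.out) (j g) *
        avg (fun x : H ⧸ d.range => a g' x.out) (j g') := fun g g' => by
    rw [← avg_equiv (MulAction.toPerm g') (fun x : H ⧸ d.range => a g x.out),
      ← avg_mul hi _ _ _ _ (fun _ => ha _ _) (fun _ => ha _ _), map_mul]
    congr 1
    ext1 x
    have : a g ((MulAction.toPerm g' x : H ⧸ d.range)).out = a g (g' * x.out) := by
      apply ha2
      rw [QuotientGroup.out_eq', MulAction.toPerm_apply]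
      conv_lhs => rw [← QuotientGroup.out_eq' x]
      rfl
    rw [this]
    simp [a, mul_assoc]
  exact ⟨MonoidHom.mk' (fun g => avg (fun x : H ⧸ d.range => a g x.out) (j g)) hmul,
    fun h => rfl⟩

/-- A homomorphism from a finite group of invertible order lifts. -/
theorem exists_lift_of_coprime {H : Type} [Group H] (hH : (Nat.card H : F) ≠ 0) (j : H →* G) :
    ∃ τ : H →* FamExt c, ∀ h, (τ h).snd = j h := by
  refine exists_transfer j (1 : PUnit →* H) (fun _ _ _ => rfl) ?_ 1 (by simp)
  have : (1 : PUnit →* H).range = ⊥ := by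
    rw [eq_bot_iff]; rintro _ ⟨x, rfl⟩; simp
  rwa [this, Subgroup.index_bot]

theorem splits_of_transfer {D : Type} [Group D] (d : D →* G)
    (hd : Function.Injective d) (hi : (d.range.index : F) ≠ 0) (σ : D →* FamExt c)
    (hσ : ∀ x, (σ x).snd = d x) : Splits c :=
  exists_transfer (MonoidHom.id G) d hd hi σ hσ

end FamExt

theorem splits_of_cochain (b : G → V →ₗ[F] M)
    (hb : ∀ g h, b (g * h) = b g + ρ g ∘ₗ b h + c.toFun g h) : Splits c :=
  ⟨MonoidHom.mk' (fun g => ⟨b g, g⟩) fun g h => FamExt.ext (hb g h) rfl, fun _ => rfl⟩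

theorem Splits.exists_cochain (h : Splits c) : ∃ b : G → V →ₗ[F] M,
    ∀ g h, b (g * h) = b g + ρ g ∘ₗ b h + c.toFun g h := by
  obtain ⟨s, hs⟩ := h
  refine ⟨fun g => (s g).fst, fun g h => ?_⟩
  simp only [map_mul, FamExt.mul_fst, hs]

theorem Codim.of_res {D : Type} [Group D] (d : D →* G)
    (hd : Function.Injective d) (hi : (d.range.index : F) ≠ 0) {k : ℕ}
    (h : Codim (ρ.comp d : Representation F D M) k) : Codim ρ k := by
  intro V _ _ _ c
  obtain ⟨V', _, _, _, j, hj, hf, s, hs⟩ := h V (c.res d)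
  refine ⟨V', _, _, inferInstance, j, hj, hf, ?_⟩
  exact FamExt.splits_of_transfer d hd hi ((FamExt.res d (c.comap j)).comp s)
    fun x => by
      change d (s x).snd = d x
      rw [hs]

/-- Subadditivity of the codimension along an extension of representations. -/
theorem Codim.of_exact {L Q : Type} [AddCommGroup L] [Module F L] [AddCommGroup Q] [Module F Q]
    {ρ' : Representation F G L} {ρ'' : Representation F G Q} (i : L →ₗ[F] M) (π : M →ₗ[F] Q)
    (hi : Function.Injective i) (hπ : Function.Surjective π)
    (hex : LinearMap.ker π = LinearMap.range i)
    (hie : ∀ g, i ∘ₗ ρ' g = ρ g ∘ₗ i) (hπe : ∀ g, π ∘ₗ ρ g = ρ'' g ∘ₗ π) {k l : ℕ}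
    (hk : Codim ρ' k) (hl : Codim ρ'' l) : Codim ρ (k + l) := by
  intro V _ _ _ c
  obtain ⟨sec, hsec⟩ := π.exists_rightInverse_of_surjective (LinearMap.range_eq_top.2 hπ)
  obtain ⟨r, hr⟩ := i.exists_leftInverse_of_injective (LinearMap.ker_eq_bot.2 hi)
  have hir : ∀ (W : Type) [AddCommGroup W] [Module F W] (f : W →ₗ[F] M), π ∘ₗ f = 0 →
      i ∘ₗ r ∘ₗ f = f := fun W _ _ f hf => by
    ext w
    have : f w ∈ LinearMap.ker π := by simpa using congrArg (fun t => t w) hf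
    rw [hex] at this
    obtain ⟨y, hy⟩ := this
    have hry : r (i y) = y := by simpa using congrArg (fun t => t y) hr
    simp [← hy, hry]
  have hie' : ∀ (W : Type) [AddCommGroup W] [Module F W] (f : W →ₗ[F] L) (g : G),
      i ∘ₗ ρ' g ∘ₗ f = ρ g ∘ₗ i ∘ₗ f := fun W _ _ f g => by
    rw [← LinearMap.comp_assoc, hie, LinearMap.comp_assoc]
  let c'' : Fam ρ'' V := ⟨fun g h => π ∘ₗ c.toFun g h, fun g h k => by
    rw [← LinearMap.comp_assoc, ← hπe, LinearMap.comp_assoc, ← LinearMap.comp_add,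
      c.cond, LinearMap.comp_add]⟩
  obtain ⟨V', _, _, _, j, hj, hf, hs⟩ := hl V c''
  obtain ⟨b'', hb''⟩ := hs.exists_cochain
  let b (g : G) : V' →ₗ[F] M := sec ∘ₗ b'' g
  have hb : ∀ g, π ∘ₗ b g = b'' g := fun g => by
    simp only [b]; rw [← LinearMap.comp_assoc, hsec, LinearMap.id_comp]
  let f (g h : G) : V' →ₗ[F] M := (c.comap j).toFun g h + b g + ρ g ∘ₗ b h - b (g * h)
  have hf0 : ∀ g h, π ∘ₗ f g h = 0 := fun g h => by
    have h1 := hb'' g h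
    simp only [f, LinearMap.comp_sub, LinearMap.comp_add, hb]
    rw [← LinearMap.comp_assoc, hπe, LinearMap.comp_assoc, hb, h1]
    simp only [c'', Fam.comap_toFun, LinearMap.comp_assoc]
    abel
  have hfi : ∀ g h, i ∘ₗ r ∘ₗ f g h = f g h := fun g h => hir _ _ (hf0 g h)
  let c' : Fam ρ' V' := ⟨fun g h => r ∘ₗ f g h, fun g h k => by
    rw [← LinearMap.cancel_left hi]
    simp only [LinearMap.comp_add]
    rw [hie', hfi, hfi, hfi, hfi]
    have h1 := (c.comap j).cond g h k
    simp only [f, LinearMap.comp_add, LinearMap.comp_sub, map_mul, Module.End.mul_eq_comp,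
      LinearMap.comp_assoc, mul_assoc]
    rw [← sub_eq_zero] at h1 ⊢
    rw [← h1]
    abel⟩
  obtain ⟨V'', _, _, _, j', hj', hf', hs'⟩ := hk V' c'
  obtain ⟨t, ht⟩ := hs'.exists_cochain
  refine ⟨V'', _, _, inferInstance, j ∘ₗ j', hj.comp hj', by omega,
    splits_of_cochain (fun g => b g ∘ₗ j' + i ∘ₗ t g) fun g h => ?_⟩
  rw [ht g h]
  have h1 : i ∘ₗ (c'.comap j').toFun g h = f g h ∘ₗ j' := by
    simp only [c', Fam.comap_toFun]
    rw [← LinearMap.comp_assoc, hfi]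
  rw [LinearMap.comp_add, LinearMap.comp_add, h1, hie']
  simp only [f, LinearMap.comp_add, LinearMap.sub_comp, LinearMap.add_comp, Fam.comap_toFun,
    LinearMap.comp_assoc]
  abel

theorem finrank_H2_le [Finite G] [FiniteDimensional F M] {k : ℕ} (h : Codim ρ k) :
    Module.finrank F (groupCohomology (Rep.of ρ) 2) ≤ k := by
  let Z := groupCohomology.cocycles₂ (Rep.of ρ)
  have : FiniteDimensional F M := inferInstance
  have : FiniteDimensional F (G × G → M) := inferInstance
  have hfd : FiniteDimensional F Z :=
    FiniteDimensional.finiteDimensional_submodule (V := G × G → M) Z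
  let ev (g h : G) : Z →ₗ[F] M := (LinearMap.proj (φ := fun _ : G × G => M) (g, h)) ∘ₗ Z.subtype
  let c : Fam ρ Z := ⟨ev, fun g h k => by
    ext ⟨z, hz⟩
    have h1 := (groupCohomology.mem_cocycles₂_iff (A := Rep.of ρ) z).1 hz g h k
    exact (h1.symm.trans (add_comm _ _) : ρ g (z (h, k)) + z (g, h * k) = _)⟩
  obtain ⟨V', _, _, _, j, hj, hf, hs⟩ := h Z c
  obtain ⟨b, hb⟩ := hs.exists_cochain
  let φ : Z →ₗ[F] groupCohomology (Rep.of ρ) 2 := (groupCohomology.H2π (Rep.of ρ)).hom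
  have hφ : Function.Surjective φ := fun x =>
    groupCohomology.H2_induction_on x fun z => ⟨z, rfl⟩
  have hφj : ∀ v, j v ∈ LinearMap.ker φ := fun v => by
    rw [LinearMap.mem_ker]
    refine (groupCohomology.H2π_eq_zero_iff (A := Rep.of ρ) (j v)).2 ⟨fun g => -(b g v), ?_⟩
    ext ⟨g, h⟩
    have h1 : b (g * h) v = b g v + ρ g (b h v) + (j v : G × G → M) (g, h) :=
      congrArg (fun t => t v) (hb g h)
    change ρ g (-(b h v)) - -(b (g * h) v) + -(b g v) = (j v : G × G → M) (g, h)
    rw [h1, map_neg]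
    abel
  have h1 := φ.finrank_range_add_finrank_ker
  rw [LinearMap.range_eq_top.2 hφ, finrank_top] at h1
  have h2 := LinearMap.finrank_le_finrank_of_injective (f := j.codRestrict (LinearMap.ker φ) hφj)
    fun x y hxy => hj (congrArg Subtype.val hxy)
  omega

end Averaging

section Order

theorem natCard_fibered {A B : Type} [Finite A] [Finite B] (S : A → Prop) (P : A → B → Prop) (n : ℕ)
    (h : ∀ a, S a → Nat.card {b // P a b} = n) :
    Nat.card {x : A × B // S x.1 ∧ P x.1 x.2} = Nat.card {a // S a} * n := by
  have e : {x : A × B // S x.1 ∧ P x.1 x.2} ≃ Σ a : {a // S a}, {b // P a.1 b} :=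
    { toFun := fun x => ⟨⟨x.1.1, x.2.1⟩, ⟨x.1.2, x.2.2⟩⟩
      invFun := fun y => ⟨(y.1.1, y.2.1), y.1.2, y.2.2⟩
      left_inv := fun _ => rfl
      right_inv := fun _ => rfl }
  have := Fintype.ofFinite {a // S a}
  rw [Nat.card_congr e, Nat.card_sigma, Finset.sum_congr rfl fun a _ => h a.1 a.2]
  simp

variable {K : Type} [Field K]

theorem natCard_fiber {W A : Type} [AddCommGroup W] [Module K W] [Finite W] [AddCommGroup A]
    [Module K A] [FiniteDimensional K W] [FiniteDimensional K A] (f : W →ₗ[K] A)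
    (hf : Function.Surjective f) (y : A) (m : ℕ)
    (hm : Module.finrank K W = m + Module.finrank K A) :
    Nat.card {w // f w = y} = Nat.card K ^ m := by
  obtain ⟨w0, hw0⟩ := hf y
  have e : {w // f w = y} ≃ LinearMap.ker f :=
    { toFun := fun w => ⟨w.1 - w0, by simp [w.2, hw0]⟩
      invFun := fun v => ⟨v.1 + w0, by simp [hw0]⟩
      left_inv := fun _ => by simp
      right_inv := fun _ => by simp }
  have h1 := f.finrank_range_add_finrank_ker
  rw [LinearMap.range_eq_top.2 hf, finrank_top] at h1
  rw [Nat.card_congr e, Module.natCard_eq_pow_finrank (K := K)]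
  congr 1
  omega

theorem natCard_ne {A : Type} [Finite A] (a : A) : Nat.card {x // x ≠ a} = Nat.card A - 1 := by
  classical
  have := Fintype.ofFinite A
  simp [Nat.card_eq_fintype_card, Fintype.card_subtype_compl]

open Matrix

theorem natCard_SL2 [Fintype K] : Nat.card (SpecialLinearGroup (Fin 2) K) =
    (Nat.card K ^ 2 - 1) * Nat.card K := by
  let P (a b : K × K) : Prop := a.1 * b.2 - a.2 * b.1 = 1
  have e : SpecialLinearGroup (Fin 2) K ≃ {x : (K × K) × (K × K) // x.1 ≠ 0 ∧ P x.1 x.2} :=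
    { toFun := fun A => ⟨((A 0 0, A 0 1), (A 1 0, A 1 1)), by
        have h := A.2
        rw [det_fin_two] at h
        refine ⟨fun h0 => ?_, h⟩
        simp only [Prod.mk_eq_zero] at h0
        rw [h0.1, h0.2] at h
        simp at h⟩
      invFun := fun x => ⟨!![x.1.1.1, x.1.1.2; x.1.2.1, x.1.2.2], by
        rw [det_fin_two_of]; exact x.2.2⟩
      left_inv := fun A => by ext i j; fin_cases i <;> fin_cases j <;> rfl
      right_inv := fun x => rfl }
  rw [Nat.card_congr e, natCard_fibered (fun a : K × K => a ≠ 0) P (Nat.card K), natCard_ne]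
  · simp [sq]
  · intro a ha
    let f : K × K →ₗ[K] K := a.1 • LinearMap.snd K K K - a.2 • LinearMap.fst K K K
    have hf : Function.Surjective f := fun y => by
      by_cases h : a.1 = 0
      · have h2 : a.2 ≠ 0 := fun h2 => ha (Prod.ext h h2)
        exact ⟨(-(y / a.2), 0), by simp [f]; field_simp⟩
      · exact ⟨(0, y / a.1), by simp [f]; field_simp⟩
    have := natCard_fiber f hf 1 1 (by simp)
    simpa [f, P] using this

/-- The symplectic form on row vectors. -/
def sympForm (x : Fin 2 ⊕ Fin 2 → K) : (Fin 2 ⊕ Fin 2 → K) →ₗ[K] K where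
  toFun y := x (.inr 0) * y (.inl 0) + x (.inr 1) * y (.inl 1) - x (.inl 0) * y (.inr 0)
    - x (.inl 1) * y (.inr 1)
  map_add' y z := by simp only [Pi.add_apply]; ring
  map_smul' y z := by simp only [Pi.smul_apply, smul_eq_mul, RingHom.id_apply]; ring

theorem sympForm_apply (x y : Fin 2 ⊕ Fin 2 → K) : sympForm x y =
    x (.inr 0) * y (.inl 0) + x (.inr 1) * y (.inl 1) - x (.inl 0) * y (.inr 0)
    - x (.inl 1) * y (.inr 1) := rfl

theorem sympForm_self (x : Fin 2 ⊕ Fin 2 → K) : sympForm x x = 0 := by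
  rw [sympForm_apply]; ring

theorem sympForm_swap (x y : Fin 2 ⊕ Fin 2 → K) : sympForm x y = - sympForm y x := by
  rw [sympForm_apply, sympForm_apply]; ring

theorem sympForm_zero_left (y : Fin 2 ⊕ Fin 2 → K) : sympForm 0 y = 0 := by
  rw [sympForm_swap, map_zero, neg_zero]

theorem sympForm_exists {x : Fin 2 ⊕ Fin 2 → K} (hx : x ≠ 0) : ∃ y, sympForm x y = 1 := by
  obtain ⟨i, hi⟩ := Function.ne_iff.1 hx
  simp only [Pi.zero_apply] at hi
  rcases i with i | i
  · refine ⟨Pi.single (.inr i) (-(x (.inl i))⁻¹), ?_⟩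
    fin_cases i <;> simp [sympForm_apply] <;> exact mul_inv_cancel₀ hi
  · refine ⟨Pi.single (.inl i) ((x (.inr i))⁻¹), ?_⟩
    fin_cases i <;> simp [sympForm_apply] <;> exact mul_inv_cancel₀ hi

theorem mem_symplecticGroup_iff_rows (A : Matrix (Fin 2 ⊕ Fin 2) (Fin 2 ⊕ Fin 2) K) :
    A ∈ symplecticGroup (Fin 2) K ↔ ((sympForm (A (.inl 0)) (A (.inr 0)) = -1) ∧
      (sympForm (A (.inl 0)) (A (.inl 1)) = 0 ∧ sympForm (A (.inr 0)) (A (.inl 1)) = 0)) ∧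
      (sympForm (A (.inl 0)) (A (.inr 1)) = 0 ∧ sympForm (A (.inr 0)) (A (.inr 1)) = 0 ∧
        sympForm (A (.inl 1)) (A (.inr 1)) = -1) := by
  have hentry : ∀ i j, (A * J (Fin 2) K * Aᵀ) i j = sympForm (A i) (A j) := fun i j => by
    simp [Matrix.mul_apply, J, Fintype.sum_sum_type, Fin.sum_univ_two, sympForm_apply]
    ring
  rw [SymplecticGroup.mem_iff]
  constructor
  · intro h
    have h2 : ∀ i j, sympForm (A i) (A j) = J (Fin 2) K i j := fun i j => by rw [← hentry, h]
    simp [h2, J]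
  · rintro ⟨⟨h1, h2, h3⟩, h4, h5, h6⟩
    ext i j
    rw [hentry]
    have h1' := sympForm_swap (A (.inl 0)) (A (.inr 0))
    have h2' := sympForm_swap (A (.inl 0)) (A (.inl 1))
    have h3' := sympForm_swap (A (.inr 0)) (A (.inl 1))
    have h4' := sympForm_swap (A (.inl 0)) (A (.inr 1))
    have h5' := sympForm_swap (A (.inr 0)) (A (.inr 1))
    have h6' := sympForm_swap (A (.inl 1)) (A (.inr 1))
    rw [h1, eq_comm, neg_inj] at h1'
    rw [h6, eq_comm, neg_inj] at h6'
    rw [h2, eq_comm, neg_eq_zero] at h2'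
    rw [h3, eq_comm, neg_eq_zero] at h3'
    rw [h4, eq_comm, neg_eq_zero] at h4'
    rw [h5, eq_comm, neg_eq_zero] at h5'
    rcases i with i | i <;> rcases j with j | j <;> fin_cases i <;> fin_cases j <;>
      simp [J, h1, h2, h3, h4, h5, h6, h1', h2', h3', h4', h5', h6', sympForm_self]

variable [Fintype K]

theorem natCard_Sp4 : Nat.card (symplecticGroup (Fin 2) K) =
    (Nat.card K ^ 4 - 1) * Nat.card K ^ 3 * (Nat.card K ^ 2 - 1) * Nat.card K := by
  let W := Fin 2 ⊕ Fin 2 → K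
  have hW : Module.finrank K W = 4 := by simp [W]
  let S1 (a : W) : Prop := a ≠ 0
  let P2 (a c : W) : Prop := sympForm a c = -1
  let S2 (x : W × W) : Prop := S1 x.1 ∧ P2 x.1 x.2
  let P3 (x : W × W) (b : W) : Prop := (sympForm x.1 b = 0 ∧ sympForm x.2 b = 0) ∧ b ≠ 0
  let S3 (x : (W × W) × W) : Prop := S2 x.1 ∧ P3 x.1 x.2
  let P4 (x : (W × W) × W) (d : W) : Prop :=
    sympForm x.1.1 d = 0 ∧ sympForm x.1.2 d = 0 ∧ sympForm x.2 d = -1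
  have e : symplecticGroup (Fin 2) K ≃ {x : ((W × W) × W) × W // S3 x.1 ∧ P4 x.1 x.2} :=
    { toFun := fun A => ⟨(((A.1 (.inl 0), A.1 (.inr 0)), A.1 (.inl 1)), A.1 (.inr 1)), by
        obtain ⟨⟨h1, h2⟩, h3⟩ := (mem_symplecticGroup_iff_rows A.1).1 A.2
        refine ⟨⟨⟨fun h0 => ?_, h1⟩, h2, fun h0 => ?_⟩, h3⟩
        · rw [show A.1 (.inl 0) = 0 from h0, sympForm_zero_left] at h1
          simp at h1
        · have := h3.2.2
          rw [show A.1 (.inl 1) = 0 from h0, sympForm_zero_left] at this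
          simp at this⟩
      invFun := fun x => ⟨of (Sum.elim ![x.1.1.1.1, x.1.1.2] ![x.1.1.1.2, x.1.2]),
        (mem_symplecticGroup_iff_rows _).2 ⟨⟨x.2.1.1.2, x.2.1.2.1⟩, x.2.2⟩⟩
      left_inv := fun A => by
        apply Subtype.ext
        funext i
        rcases i with i | i <;> fin_cases i <;> rfl
      right_inv := fun x => rfl }
  have hpair : ∀ a c : W, sympForm a c = -1 →
      Function.Surjective ((sympForm a).prod (sympForm c)) := fun a c h y => by
    refine ⟨-y.1 • c + y.2 • a, ?_⟩
    have h' : sympForm c a = 1 := by rw [sympForm_swap, h, neg_neg]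
    simp [h, h', sympForm_self]
  rw [Nat.card_congr e, natCard_fibered S3 P4 (Nat.card K),
    natCard_fibered S2 P3 (Nat.card K ^ 2 - 1), natCard_fibered S1 P2 (Nat.card K ^ 3)]
  · rw [natCard_ne]
    simp [W]
  · intro a ha
    obtain ⟨y, hy⟩ := sympForm_exists ha
    exact natCard_fiber (sympForm a) (fun t => ⟨t • y, by simp [hy]⟩) (-1) 3 (by simp)
  · intro ⟨a, c⟩ ⟨_, h⟩
    have h1 := natCard_fiber _ (hpair a c h) 0 2 (by simp)
    rw [← h1, ← natCard_ne (⟨0, by simp⟩ : {w // (sympForm a).prod (sympForm c) w = 0})]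
    refine Nat.card_congr
      { toFun := fun b => ⟨⟨b.1, Prod.ext b.2.1.1 b.2.1.2⟩, fun h => b.2.2 (congrArg Subtype.val h)⟩
        invFun := fun b => ⟨b.1.1, ⟨congrArg Prod.fst b.1.2, congrArg Prod.snd b.1.2⟩,
          fun h => b.2 (Subtype.ext h)⟩
        left_inv := fun _ => rfl
        right_inv := fun _ => rfl }
  · rintro ⟨⟨a, c⟩, b⟩ ⟨⟨_, h⟩, ⟨h2, h3⟩, h4⟩
    dsimp only [P2] at h h2 h3 h4
    have hsurj : Function.Surjective ((sympForm a).prod ((sympForm c).prod (sympForm b))) := by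
      rintro ⟨y1, y2, y3⟩
      obtain ⟨z, hz⟩ := sympForm_exists h4
      have h' : sympForm c a = 1 := by rw [sympForm_swap, h, neg_neg]
      have h2' : sympForm b a = 0 := by rw [sympForm_swap, h2, neg_zero]
      have h3' : sympForm b c = 0 := by rw [sympForm_swap, h3, neg_zero]
      refine ⟨y3 • z - (y1 - y3 * sympForm a z) • c + (y2 - y3 * sympForm c z) • a, ?_⟩
      simp [h, h', h2', h3', sympForm_self, hz]
    have h1 := natCard_fiber _ hsurj (0, 0, -1) 1 (by simp)
    rw [pow_one] at h1
    rw [← h1]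
    refine Nat.card_congr (Equiv.subtypeEquivRight fun d => ?_)
    simp [P4]

end Order

section Index

variable {F : Type} [Field F]

theorem index_cast_ne_zero {G D : Type} [Group G] [Group D] [Finite G] (d : D →* G)
    (hd : Function.Injective d) (m m' : ℕ) (hm : m ∣ Nat.card D) (hG : Nat.card G = m * m')
    (hm' : (m' : F) ≠ 0) : (d.range.index : F) ≠ 0 := by
  intro h
  obtain ⟨t, ht⟩ := hm
  have h1 := d.range.card_mul_index
  rw [Nat.card_congr (MonoidHom.ofInjective hd).toEquiv.symm, ht, hG, mul_assoc] at h1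
  have hmpos : 0 < m := Nat.pos_of_ne_zero fun h0 => by
    rw [h0, zero_mul] at hG
    exact Nat.card_pos.ne' hG
  have h2 := Nat.eq_of_mul_eq_mul_left hmpos h1
  apply hm'
  rw [← h2, Nat.cast_mul, h, mul_zero]

end Index

section Cyclic

/-- The homomorphism from a cyclic group of order `n` given by an element killed by `n`. -/
def cyclicHom {E : Type} [Group E] (x : E) (n : ℕ) (h : x ^ n = 1) :
    Multiplicative (ZMod n) →* E :=
  AddMonoidHom.toMultiplicativeLeft (ZMod.lift n ⟨zmultiplesHom (Additive E) (Additive.ofMul x), by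
    rw [zmultiplesHom_apply, natCast_zsmul, ← ofMul_pow, h]; rfl⟩)

theorem cyclicHom_intCast {E : Type} [Group E] (x : E) (n : ℕ) (h : x ^ n = 1) (k : ℤ) :
    cyclicHom x n h (Multiplicative.ofAdd (k : ZMod n)) = x ^ k := by
  simp [cyclicHom]

theorem cyclicHom_exists {n : ℕ} (a : Multiplicative (ZMod n)) :
    ∃ k : ℤ, a = Multiplicative.ofAdd (k : ZMod n) := by
  obtain ⟨k, hk⟩ := ZMod.intCast_surjective a.toAdd
  exact ⟨k, by rw [hk]; rfl⟩

theorem cyclicHom_injective {E : Type} [Group E] (x : E) (h : x ^ orderOf x = 1) :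
    Function.Injective (cyclicHom x (orderOf x) h) := by
  rw [injective_iff_map_eq_one]
  intro a ha
  obtain ⟨k, rfl⟩ := cyclicHom_exists a
  rw [cyclicHom_intCast, ← orderOf_dvd_iff_zpow_eq_one] at ha
  rw [(ZMod.intCast_zmod_eq_zero_iff_dvd k _).2 ha]; rfl

theorem map_cyclicHom {E E' : Type} [Group E] [Group E'] (f : E →* E') (x : E) (n : ℕ)
    (h : x ^ n = 1) (h' : f x ^ n = 1) (a : Multiplicative (ZMod n)) :
    f (cyclicHom x n h a) = cyclicHom (f x) n h' a := by
  obtain ⟨k, rfl⟩ := cyclicHom_exists a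
  rw [cyclicHom_intCast, cyclicHom_intCast, map_zpow]

variable {F G M : Type} [Field F] [Group G] [AddCommGroup M] [Module F M]
  [FiniteDimensional F M] {ρ : Representation F G M}

theorem Codim.of_cyclic (x : G)
    (hi : ((cyclicHom x (orderOf x) (pow_orderOf_eq_one x)).range.index : F) ≠ 0) :
    Codim ρ (Module.finrank F M) := by
  intro V _ _ _ c
  obtain ⟨x', hx'⟩ := FamExt.exists_lift (c := c) x
  obtain ⟨n, hn⟩ := FamExt.exists_eq_ι (x := x' ^ orderOf x) (by
    rw [FamExt.pow_snd, hx', pow_orderOf_eq_one])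
  refine Red.kill n le_rfl (l := 0) fun V' _ _ _ j hj => Red.of_splits ?_ _
  have h1 : FamExt.map c j x' ^ orderOf x = 1 := by
    rw [← map_pow, hn, FamExt.map_ι, hj, FamExt.ι_zero]
  refine FamExt.splits_of_transfer _ (cyclicHom_injective x (pow_orderOf_eq_one x)) hi
    (cyclicHom _ _ h1) fun a => ?_
  have h2 := map_cyclicHom (FamExt.proj (c.comap j)) _ _ h1
    (by rw [← map_pow, h1, map_one]) a
  rw [FamExt.proj_apply] at h2
  rw [h2]
  congr 2

/-- A product of two cyclic groups. -/
theorem Codim.of_cyclic_prod {S : Type} [Group S] (i : S × S →* G) (hi : Function.Injective i)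
    (x : S)
    (hind : ∀ d : Multiplicative (ZMod (orderOf x)) × Multiplicative (ZMod (orderOf x)) →* G,
      Function.Injective d → (d.range.index : F) ≠ 0) : Codim ρ (3 * Module.finrank F M) := by
  intro V _ _ _ c
  set m := orderOf x with hm
  have hxm : x ^ m = 1 := pow_orderOf_eq_one x
  obtain ⟨x', hx'⟩ := FamExt.exists_lift (c := c) (i (x, 1))
  obtain ⟨y', hy'⟩ := FamExt.exists_lift (c := c) (i (1, x))
  obtain ⟨n1, hn1⟩ := FamExt.exists_eq_ι (x := x' ^ m) (by
    rw [FamExt.pow_snd, hx', ← map_pow]; simp [hxm, ← Prod.one_eq_mk])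
  obtain ⟨n2, hn2⟩ := FamExt.exists_eq_ι (x := y' ^ m) (by
    rw [FamExt.pow_snd, hy', ← map_pow]; simp [hxm, ← Prod.one_eq_mk])
  obtain ⟨n3, hn3⟩ := FamExt.exists_eq_ι (x := x' * y' * x'⁻¹ * y'⁻¹) (by
    simp only [FamExt.mul_snd, FamExt.inv_snd, hx', hy', ← map_mul, ← map_inv]
    simp [← Prod.one_eq_mk])
  refine (Red.kill (k := 3 * Module.finrank F M) (l := 0) (n1.prod (n2.prod n3)) (by
    simp only [Module.finrank_prod]; omega) fun V' _ _ _ j hj => Red.of_splits ?_ _)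
  have hj1 : n1 ∘ₗ j = 0 := by ext v; simpa using congrArg (fun t => (t v).1) hj
  have hj2 : n2 ∘ₗ j = 0 := by ext v; simpa using congrArg (fun t => (t v).2.1) hj
  have hj3 : n3 ∘ₗ j = 0 := by ext v; simpa using congrArg (fun t => (t v).2.2) hj
  have h1 : FamExt.map c j x' ^ m = 1 := by
    rw [← map_pow, hn1, FamExt.map_ι, hj1, FamExt.ι_zero]
  have h2 : FamExt.map c j y' ^ m = 1 := by
    rw [← map_pow, hn2, FamExt.map_ι, hj2, FamExt.ι_zero]
  have h3 : Commute (FamExt.map c j x') (FamExt.map c j y') := by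
    have := congrArg (FamExt.map c j) hn3
    rw [FamExt.map_ι, hj3, FamExt.ι_zero] at this
    simp only [map_mul, map_inv] at this
    rw [mul_inv_eq_one, mul_inv_eq_iff_eq_mul] at this
    exact this
  let σ := MonoidHom.noncommCoprod (cyclicHom _ _ h1) (cyclicHom _ _ h2) fun a b => by
    obtain ⟨k, rfl⟩ := cyclicHom_exists a
    obtain ⟨l, rfl⟩ := cyclicHom_exists b
    rw [cyclicHom_intCast, cyclicHom_intCast]
    exact h3.zpow_zpow k l
  have hinj := cyclicHom_injective x (pow_orderOf_eq_one x)
  let d := i.comp (MonoidHom.prodMap (cyclicHom x m hxm) (cyclicHom x m hxm))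
  have hd : Function.Injective d := hi.comp (Function.Injective.prodMap hinj hinj)
  refine FamExt.splits_of_transfer d hd (hind d hd) σ ?_
  rintro ⟨a, b⟩
  obtain ⟨k, rfl⟩ := cyclicHom_exists a
  obtain ⟨l, rfl⟩ := cyclicHom_exists b
  simp only [σ, d, MonoidHom.noncommCoprod_apply, cyclicHom_intCast, FamExt.mul_snd,
    FamExt.zpow_snd, FamExt.map_snd, hx', hy', MonoidHom.comp_apply, MonoidHom.coe_prodMap,
    Prod.map_apply, ← map_zpow, ← map_mul]
  simp

end Cyclic

section SemisimpleElements

open Matrix Polynomial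

theorem pow_mulVec_of_eigen {R n : Type} [CommRing R] [Fintype n] [DecidableEq n]
    (A : Matrix n n R) (v : n → R) (ζ : R) (h : A *ᵥ v = ζ • v) (k : ℕ) :
    (A ^ k) *ᵥ v = ζ ^ k • v := by
  induction k with
  | zero => simp
  | succ k ih => rw [pow_succ, ← mulVec_mulVec, h, mulVec_smul, ih, smul_smul, pow_succ, mul_comm]

theorem pow_eq_one_of_eigen {K L n : Type} [Field K] [Field L] [Algebra K L] [Fintype n]
    [DecidableEq n] (A : Matrix n n K) (v : n → L) (hv : v ≠ 0) (ζ : L)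
    (h : A.map (algebraMap K L) *ᵥ v = ζ • v) (k : ℕ) (hk : A ^ k = 1) : ζ ^ k = 1 := by
  have h1 := pow_mulVec_of_eigen _ v ζ h k
  rw [← Matrix.map_pow, hk, Matrix.map_one _ (map_zero _) (map_one _), one_mulVec] at h1
  obtain ⟨i, hi⟩ := Function.ne_iff.1 hv
  have h2 := congrFun h1 i
  simp only [Pi.smul_apply, smul_eq_mul] at h2
  simp only [Pi.zero_apply] at hi
  exact (mul_right_cancel₀ hi ((one_mul _).trans h2)).symm

variable {K : Type} [Field K]

theorem exists_primitive_root (N : ℕ) (hN : (N : K) ≠ 0) :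
    ∃ ζ : AlgebraicClosure K, IsPrimitiveRoot ζ N := by
  have : NeZero (N : AlgebraicClosure K) := ⟨by
    rw [← map_natCast (algebraMap K (AlgebraicClosure K))]
    exact (_root_.map_ne_zero _).2 hN⟩
  exact HasEnoughRootsOfUnity.exists_primitiveRoot _ N

theorem coe_pow_eq_one (c : SpecialLinearGroup (Fin 2) K) (k : ℕ) (h : c ^ k = 1) :
    (c : Matrix (Fin 2) (Fin 2) K) ^ k = 1 :=
  (Matrix.SpecialLinearGroup.coe_pow c k).symm.trans
    ((congrArg (fun x : SpecialLinearGroup (Fin 2) K => (x : Matrix (Fin 2) (Fin 2) K)) h).trans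
      Matrix.SpecialLinearGroup.coe_one)

variable [Fintype K]

theorem mem_range_of_pow_card {L : Type} [Field L] [Algebra K L] (x : L)
    (hx : x ^ Fintype.card K = x) : ∃ y : K, algebraMap K L y = x := by
  have hm : (X ^ Fintype.card K - X : K[X]).Monic :=
    monic_X_pow_sub (by rw [degree_X]; exact_mod_cast Fintype.one_lt_card)
  have h1 := prod_multiset_X_sub_C_of_monic_of_roots_card_eq hm (by
    rw [FiniteField.roots_X_pow_card_sub_X,
      FiniteField.X_pow_card_sub_X_natDegree_eq K Fintype.one_lt_card]; rfl)
  rw [FiniteField.roots_X_pow_card_sub_X] at h1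
  have h2 := congrArg (aeval x) h1
  simp only [map_sub, map_pow, aeval_X, hx, sub_self] at h2
  have h3 : (∏ a : K, (x - algebraMap K L a)) = 0 := by
    rw [← h2]
    change _ = aeval x (∏ a : K, (X - C a))
    simp
  obtain ⟨a, -, ha⟩ := Finset.prod_eq_zero_iff.1 h3
  exact ⟨a, (sub_eq_zero.1 ha).symm⟩

theorem exists_SL2_trace {L : Type} [Field L] [Algebra K L] (ζ : L) (hζ : ζ ≠ 0)
    (h : (ζ + ζ⁻¹) ^ Fintype.card K = ζ + ζ⁻¹) :
    ∃ τ : K, algebraMap K L τ = ζ + ζ⁻¹ ∧ ∃ c : SpecialLinearGroup (Fin 2) K,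
      c.1 = !![0, -1; 1, τ] ∧ ∀ k, c ^ k = 1 → ζ ^ k = 1 := by
  obtain ⟨τ, hτ⟩ := mem_range_of_pow_card (K := K) _ h
  refine ⟨τ, hτ, ⟨!![0, -1; 1, τ], by simp⟩, rfl, fun k hk => ?_⟩
  refine pow_eq_one_of_eigen (K := K) !![0, -1; 1, τ] ![1, -ζ]
    (fun h0 => by simpa using congrFun h0 0) ζ ?_ k (by
      exact coe_pow_eq_one _ k hk)
  ext i
  fin_cases i
  · simp [mulVec, dotProduct, Fin.sum_univ_two]
  · simp [mulVec, dotProduct, Fin.sum_univ_two, hτ]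
    field_simp
    ring

theorem exists_SL2_orderOf (N : ℕ) (hN : N + 1 = Fintype.card K ∨ N = Fintype.card K + 1) :
    ∃ (τ : K) (c : Matrix.SpecialLinearGroup (Fin 2) K), c.1 = !![0, -1; 1, τ] ∧ N ∣ orderOf c ∧
      (2 < N → τ ^ 2 ≠ 4) := by
  have hN0 : (N : K) ≠ 0 := by
    rcases hN with h | h
    · have : (N : K) + 1 = 0 := by
        exact_mod_cast (congrArg (Nat.cast (R := K)) h).trans (FiniteField.cast_card_eq_zero K)
      intro h0; simp [h0] at this
    · rw [h]; simp
  obtain ⟨ζ, hζ⟩ := exists_primitive_root (K := K) N hN0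
  have hζ0 : ζ ≠ 0 := hζ.ne_zero fun h => hN0 (by simp [h])
  have hq := congrArg (fun f => f (ζ + ζ⁻¹))
    (FiniteField.coe_frobeniusAlgHom K (AlgebraicClosure K))
  dsimp only at hq
  rw [map_add, map_inv₀, FiniteField.frobeniusAlgHom_apply] at hq
  obtain ⟨τ, hτ, c, hc0, hc⟩ := exists_SL2_trace (K := K) ζ hζ0 (by
    rw [← hq]
    rcases hN with h | h
    · rw [← h, pow_succ, hζ.pow_eq_one, one_mul]
    · have h1 : ζ ^ Fintype.card K * ζ = 1 := by rw [← pow_succ, ← h, hζ.pow_eq_one]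
      rw [eq_inv_of_mul_eq_one_left h1, inv_inv, add_comm])
  refine ⟨τ, c, hc0, hζ.dvd_of_pow_eq_one _ (hc _ (pow_orderOf_eq_one c)), fun h2 h4 => ?_⟩
  have h5 := congrArg (algebraMap K (AlgebraicClosure K)) h4
  rw [map_pow, hτ, map_ofNat] at h5
  have h6 : (ζ ^ 2 - 1) ^ 2 = 0 := by
    have h7 : ζ * ζ⁻¹ = 1 := mul_inv_cancel₀ hζ0
    linear_combination ζ ^ 2 * h5 - (2 * ζ ^ 2 + ζ * ζ⁻¹ + 1) * h7
  have h7 := Nat.le_of_dvd (by norm_num)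
    (hζ.dvd_of_pow_eq_one 2 (sub_eq_zero.1 (pow_eq_zero_iff (by norm_num) |>.1 h6)))
  omega

theorem exists_sym_quadratic (a b : K) : ∃ x y : K, x * (a - x) - y ^ 2 = b := by
  by_cases h2 : ringChar K = 2
  · obtain ⟨y, hy⟩ := FiniteField.isSquare_of_char_two h2 (-b)
    exact ⟨0, y, by rw [sq, ← hy]; ring⟩
  · have hodd := FiniteField.odd_card_of_char_ne_two h2
    obtain ⟨x, y, hxy⟩ := FiniteField.exists_root_sum_quadratic (R := K)
      (f := C 1 * X ^ 2 + C (-a) * X + C b) (g := C 1 * X ^ 2 + C 0 * X + C 0)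
      (degree_quadratic one_ne_zero) (degree_quadratic one_ne_zero) hodd
    refine ⟨x, y, ?_⟩
    simp only [eval_add, eval_mul, eval_C, eval_X, eval_pow] at hxy
    linear_combination -hxy

theorem exists_Sp4_orderOf : ∃ g : symplecticGroup (Fin 2) K,
    Fintype.card K ^ 2 + 1 ∣ orderOf g := by
  set q := Fintype.card K with hqdef
  obtain ⟨ζ, hζ⟩ := exists_primitive_root (K := K) (q ^ 2 + 1) (by simp [hqdef])
  have hζ0 : ζ ≠ 0 := hζ.ne_zero (by omega)
  let Φ := FiniteField.frobeniusAlgHom K (AlgebraicClosure K)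
  have hΦ : ∀ x, Φ x = x ^ q := fun x => rfl
  let τ := ζ + ζ⁻¹
  have hΦΦ : Φ (Φ τ) = τ := by
    have h1 : Φ (Φ ζ) = ζ⁻¹ := by
      rw [hΦ, hΦ, ← pow_mul, ← sq]
      exact eq_inv_of_mul_eq_one_left (by rw [← pow_succ, hζ.pow_eq_one])
    simp only [τ, map_add, map_inv₀, h1, inv_inv]
    exact add_comm _ _
  obtain ⟨a, ha⟩ := mem_range_of_pow_card (K := K) (τ + Φ τ) (by
    rw [← hqdef, ← hΦ, map_add, hΦΦ, add_comm])
  obtain ⟨b, hb⟩ := mem_range_of_pow_card (K := K) (τ * Φ τ) (by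
    rw [← hqdef, ← hΦ, map_mul, hΦΦ, mul_comm])
  obtain ⟨x, y, hxy⟩ := exists_sym_quadratic a b
  let S : Matrix (Fin 2) (Fin 2) K := !![x, y; y, a - x]
  have hS : Sᵀ = S := by ext i j; fin_cases i <;> fin_cases j <;> rfl
  let g : symplecticGroup (Fin 2) K := ⟨fromBlocks 0 (-1) 1 S, by
    rw [SymplecticGroup.fromBlocks_mem_iff]
    simp [hS]⟩
  refine ⟨g, hζ.dvd_of_pow_eq_one _ ?_⟩
  have hdet : (S.map (algebraMap K (AlgebraicClosure K)) - τ • (1 : Matrix (Fin 2) (Fin 2) _)).det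
      = 0 := by
    have hxy' := congrArg (algebraMap K (AlgebraicClosure K)) hxy
    rw [hb] at hxy'
    simp only [map_sub, map_mul, map_pow, ha] at hxy'
    have h1 : S.map (algebraMap K (AlgebraicClosure K)) - τ • (1 : Matrix (Fin 2) (Fin 2) _) =
        !![algebraMap K _ x - τ, algebraMap K _ y; algebraMap K _ y, Φ τ - algebraMap K _ x] := by
      ext i j; fin_cases i <;> fin_cases j <;> simp [S, ha]
      ring
    rw [h1, det_fin_two_of]
    linear_combination hxy'
  obtain ⟨u, hu, hSu⟩ := exists_mulVec_eq_zero_iff.2 hdet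
  rw [sub_mulVec, smul_mulVec, one_mulVec, sub_eq_zero] at hSu
  refine pow_eq_one_of_eigen g.1 (Sum.elim u (-(ζ • u))) (fun h0 => hu ?_) ζ ?_ _
    (by
      rw [← SubmonoidClass.coe_pow, pow_orderOf_eq_one]; rfl)
  · ext i; exact congrFun h0 (.inl i)
  · have h1 : g.1.map (algebraMap K (AlgebraicClosure K)) =
        fromBlocks 0 (-1) 1 (S.map (algebraMap K (AlgebraicClosure K))) := by
      simp only [g, fromBlocks_map]
      congr 1
      · ext; simp
      · ext i j; simp [one_apply]
      · ext i j; simp [one_apply]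
    rw [h1, fromBlocks_mulVec]
    ext i
    rcases i with i | i
    · simp [neg_mulVec]
    · simp only [Sum.elim_comp_inl, one_mulVec, Sum.elim_comp_inr, mulVec_neg, mulVec_smul, hSu,
        Sum.elim_inr, Pi.add_apply, Pi.neg_apply, Pi.smul_apply, smul_eq_mul, τ]
      field_simp
      ring

end SemisimpleElements

section BlockEmbedding

open Matrix

variable {K : Type} [Field K]

/-- The block matrix with two interleaved two-by-two blocks. -/
def interleave (A B : Matrix (Fin 2) (Fin 2) K) : Matrix (Fin 2 ⊕ Fin 2) (Fin 2 ⊕ Fin 2) K :=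
  fromBlocks (diagonal ![A 0 0, B 0 0]) (diagonal ![A 0 1, B 0 1])
    (diagonal ![A 1 0, B 1 0]) (diagonal ![A 1 1, B 1 1])

theorem interleave_mul (A B A' B' : Matrix (Fin 2) (Fin 2) K) :
    interleave (A * A') (B * B') = interleave A B * interleave A' B' := by
  simp only [interleave, fromBlocks_multiply, diagonal_mul_diagonal, diagonal_add]
  congr 2 <;> (ext i; fin_cases i <;> simp [Matrix.mul_apply, Fin.sum_univ_two])

theorem interleave_one : interleave (1 : Matrix (Fin 2) (Fin 2) K) 1 = 1 := by
  rw [← fromBlocks_one, interleave]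
  congr 1 <;> (ext i j; fin_cases i <;> fin_cases j <;> simp)

theorem interleave_mem (A B : Matrix (Fin 2) (Fin 2) K) (hA : A.det = 1) (hB : B.det = 1) :
    interleave A B ∈ symplecticGroup (Fin 2) K := by
  rw [det_fin_two] at hA hB
  rw [interleave, SymplecticGroup.fromBlocks_mem_iff]
  simp only [diagonal_transpose, diagonal_mul_diagonal, diagonal_sub, mul_comm, true_and]
  rw [← diagonal_one]
  congr 1
  ext i
  fin_cases i
  · simpa [mul_comm] using hA
  · simpa [mul_comm] using hB

/-- The embedding of `SL(2) × SL(2)` in `Sp(4)`. -/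
def SL2Prod : Matrix.SpecialLinearGroup (Fin 2) K × Matrix.SpecialLinearGroup (Fin 2) K →*
    symplecticGroup (Fin 2) K where
  toFun x := ⟨interleave x.1 x.2, interleave_mem _ _ x.1.2 x.2.2⟩
  map_one' := Subtype.ext interleave_one
  map_mul' _ _ := Subtype.ext (interleave_mul _ _ _ _)

theorem SL2Prod_injective : Function.Injective (SL2Prod (K := K)) := by
  rintro ⟨A, B⟩ ⟨A', B'⟩ h
  have h1 : interleave (A : Matrix (Fin 2) (Fin 2) K) B = interleave A' B' := congrArg Subtype.val h
  simp only [interleave, fromBlocks_inj, diagonal_eq_diagonal_iff, Fin.forall_fin_two,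
    cons_val_zero,
    cons_val_one, cons_val_fin_one] at h1
  obtain ⟨⟨h1, h2⟩, ⟨h3, h4⟩, ⟨h5, h6⟩, h7, h8⟩ := h1
  refine Prod.ext (Matrix.SpecialLinearGroup.ext _ _ fun i j => ?_)
    (Matrix.SpecialLinearGroup.ext _ _ fun i j => ?_) <;>
  fin_cases i <;> fin_cases j <;> assumption

end BlockEmbedding

section OddCases

open Matrix

theorem codim_of_natCard_ne_zero {F G M : Type} [Field F] [Group G] [AddCommGroup M] [Module F M]
    (ρ : Representation F G M)
    (h : (Nat.card G : F) ≠ 0) (k : ℕ) : Codim ρ k := by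
  intro V _ _ _ c
  obtain ⟨τ, hτ⟩ := FamExt.exists_lift_of_coprime (c := c) h (MonoidHom.id G)
  exact Red.of_splits ⟨τ, hτ⟩ k

variable {K : Type} [Field K] [Fintype K] {F M : Type} [Field F] [AddCommGroup M] [Module F M]
  [FiniteDimensional F M] (ρ : Representation F (symplecticGroup (Fin 2) K) M)

theorem codim_of_card_sq_eq_one (h2 : (2 : F) ≠ 0)
    (hq : (Fintype.card K : F) = 1 ∨ (Fintype.card K : F) = -1) :
    Codim ρ (3 * Module.finrank F M) := by
  obtain ⟨q, hqdef⟩ : ∃ q, q = Fintype.card K := ⟨_, rfl⟩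
  rw [← hqdef] at hq
  have hq1 : 1 < q := hqdef ▸ Fintype.one_lt_card
  obtain ⟨N, N', hN, hNN, hN'⟩ : ∃ N N' : ℕ, (N + 1 = q ∨ N = q + 1) ∧ q ^ 2 - 1 = N * N' ∧
      (N' : F) ≠ 0 := by
    obtain ⟨n, rfl⟩ : ∃ n, q = n + 1 := ⟨q - 1, by omega⟩
    have h3 : (n + 1) ^ 2 - 1 = n * (n + 2) := by
      rw [Nat.sub_eq_iff_eq_add (Nat.one_le_pow _ _ (by omega))]; ring
    rcases hq with h | h
    · refine ⟨n, n + 2, .inl rfl, h3, ?_⟩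
      push_cast at h ⊢
      rwa [show (n : F) + 2 = 2 by linear_combination h]
    · refine ⟨n + 2, n, .inr rfl, by rw [h3, mul_comm], ?_⟩
      push_cast at h
      rwa [show (n : F) = -2 by linear_combination h, neg_ne_zero]
  obtain ⟨-, x, -, hx, -⟩ := exists_SL2_orderOf (K := K) N (hqdef ▸ hN)
  refine Codim.of_cyclic_prod SL2Prod SL2Prod_injective x fun d hd => ?_
  refine index_cast_ne_zero d hd (N * N) ((q ^ 2 + 1) * q ^ 4 * N' ^ 2) ?_ ?_ ?_
  · rw [Nat.card_prod, Nat.card_congr Multiplicative.toAdd, Nat.card_zmod]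
    exact mul_dvd_mul hx hx
  · rw [natCard_Sp4, Nat.card_eq_fintype_card, ← hqdef]
    have h4 : q ^ 4 - 1 = (q ^ 2 + 1) * (q ^ 2 - 1) := by
      rw [← Nat.sq_sub_sq (q ^ 2) 1]; ring_nf
    rw [h4, hNN]
    ring
  · have hq2 : (q : F) ^ 2 = 1 := by rcases hq with h | h <;> simp [h]
    push_cast
    rw [hq2, show (q : F) ^ 4 = 1 by rw [show (4 : ℕ) = 2 * 2 from rfl, pow_mul, hq2, one_pow]]
    refine mul_ne_zero ?_ (pow_ne_zero _ hN')
    rw [mul_one, one_add_one_eq_two]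
    exact h2

theorem codim_of_card_sq_eq_neg_one (h2 : (2 : F) ≠ 0) (hq : (Fintype.card K : F) ^ 2 = -1) :
    Codim ρ (Module.finrank F M) := by
  set q := Fintype.card K with hqdef
  have hq1 : 1 < q := Fintype.one_lt_card
  obtain ⟨g, hg⟩ := exists_Sp4_orderOf (K := K)
  refine Codim.of_cyclic g ?_
  refine index_cast_ne_zero _ (cyclicHom_injective g _) (q ^ 2 + 1)
    ((q ^ 2 - 1) ^ 2 * q ^ 4) ?_ ?_ ?_
  · rwa [Nat.card_congr Multiplicative.toAdd, Nat.card_zmod]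
  · rw [natCard_Sp4, Nat.card_eq_fintype_card, ← hqdef]
    have h4 : q ^ 4 - 1 = (q ^ 2 + 1) * (q ^ 2 - 1) := by
      rw [← Nat.sq_sub_sq (q ^ 2) 1]; ring_nf
    rw [h4]
    ring
  · have h1 : 1 ≤ q ^ 2 := Nat.one_le_pow _ _ (by omega)
    push_cast [h1]
    rw [hq, show (q : F) ^ 4 = 1 by rw [show (4 : ℕ) = 2 * 2 from rfl, pow_mul, hq]; ring]
    rw [show (-1 - 1 : F) ^ 2 * 1 = 2 * 2 by ring]
    exact mul_ne_zero h2 h2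

end OddCases

section Commuting

variable {F G M : Type} [Field F] [Group G] [AddCommGroup M] [Module F M]
  {ρ : Representation F G M} {V : Type} [AddCommGroup V] [Module F V] {c : Fam ρ V}

namespace FamExt

theorem comp_eq_of_commute {x : FamExt c} {n : V →ₗ[F] M} (h : Commute x (ι c n)) :
    ρ x.snd ∘ₗ n = n :=
  ι_inj (mul_right_cancel ((mul_ι x n).symm.trans h))

theorem commute_ι {x : FamExt c} {n : V →ₗ[F] M} (h : ρ x.snd ∘ₗ n = n) : Commute x (ι c n) := by
  rw [Commute, SemiconjBy, mul_ι, h]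

/-- If every element of a family commutes with an element over `1`, the values of the latter are
invariant. -/
theorem exists_ι_of_commute {L : Type} [Group L] (χ : L →* FamExt c) (f : L →* G)
    (hf : ∀ l, (χ l).snd = f l) {x : FamExt c} (hx : x.snd = 1) (h : ∀ l, Commute (χ l) x) :
    ∃ n, x = ι c n ∧ ∀ v, n v ∈ Representation.invariants (ρ.comp f : Representation F L M) := by
  obtain ⟨n, rfl⟩ := exists_eq_ι hx
  refine ⟨n, rfl, fun v l => ?_⟩
  have := comp_eq_of_commute (h l)
  rw [hf] at this
  exact congrArg (· v) this

end FamExt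

theorem Red.kill_commute [FiniteDimensional F M] [FiniteDimensional F V] {L : Type} [Group L]
    (χ : L →* FamExt c) (f : L →* G)
    (hf : ∀ l, (χ l).snd = f l) {x : FamExt c} (hx : x.snd = 1) (h : ∀ l, Commute (χ l) x) {k l : ℕ}
    (hk : Module.finrank F (Representation.invariants (ρ.comp f : Representation F L M)) ≤ k)
    (H : ∀ (V' : Type) [AddCommGroup V'] [Module F V'] [FiniteDimensional F V'] (j : V' →ₗ[F] V),
      FamExt.map c j x = 1 → Red (c.comap j) l) : Red c (k + l) := by
  obtain ⟨n, rfl, hn⟩ := FamExt.exists_ι_of_commute χ f hf hx h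
  refine Red.killIn n _ hn hk fun V' _ _ _ j hj => H V' j ?_
  rw [FamExt.map_ι, hj, FamExt.ι_zero]

end Commuting

section Quaternion

variable {E E' : Type} [Group E] [Group E'] {x y : E} {n : ℕ}

theorem zpow_mul_of_inv (hy : y * x * y⁻¹ = x⁻¹) (k : ℤ) : x ^ k * y = y * x ^ (-k) := by
  have h := conj_zpow (i := -k) (a := y) (b := x)
  rw [hy, inv_zpow', neg_neg] at h
  rw [h, inv_mul_cancel_right]

theorem pow_two_mul_eq_one (h : x ^ n = y ^ 2) (hy : y * x * y⁻¹ = x⁻¹) : x ^ (2 * n) = 1 := by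
  have h1 := conj_pow (i := n) (a := y) (b := x)
  rw [hy, inv_pow, h, show y * y ^ 2 * y⁻¹ = y ^ 2 by group] at h1
  rw [two_mul, pow_add, h]
  nth_rw 1 [← h1]
  exact inv_mul_cancel _

/-- The universal property of the dicyclic group. -/
def quaternionHom (x y : E) (n : ℕ) (h : x ^ n = y ^ 2) (hy : y * x * y⁻¹ = x⁻¹) :
    QuaternionGroup n →* E :=
  let C (i : ZMod (2 * n)) := cyclicHom x (2 * n) (pow_two_mul_eq_one h hy) (Multiplicative.ofAdd i)
  MonoidHom.mk' (fun
    | .a i => C i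
    | .xa i => y * C i) (by
    have hadd : ∀ i j, C (i + j) = C i * C j := fun i j => map_mul _ _ _
    have hcomm : ∀ i, C i * y = y * C (-i) := fun i => by
      obtain ⟨k, rfl⟩ := ZMod.intCast_surjective i
      rw [← Int.cast_neg]
      simp only [C, cyclicHom_intCast]
      exact zpow_mul_of_inv hy k
    have hn : C n = y ^ 2 := by
      have := cyclicHom_intCast x (2 * n) (pow_two_mul_eq_one h hy) n
      rw [Int.cast_natCast, zpow_natCast, h] at this
      exact this
    rintro (i | i) (j | j)
    · exact hadd i j
    · simp only [QuaternionGroup.a_mul_xa]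
      rw [← mul_assoc, hcomm, sub_eq_neg_add, hadd, mul_assoc]
    · simp only [QuaternionGroup.xa_mul_a, hadd, mul_assoc]
    · simp only [QuaternionGroup.xa_mul_xa]
      rw [mul_assoc, ← mul_assoc (C i), hcomm, mul_assoc y, ← mul_assoc, ← sq, ← hn, ← hadd,
        ← hadd]
      congr 1; ring)

theorem quaternionHom_xa (h : x ^ n = y ^ 2) (hy : y * x * y⁻¹ = x⁻¹) (i : ZMod (2 * n)) :
    quaternionHom x y n h hy (.xa i) = y * quaternionHom x y n h hy (.a i) := rfl

theorem quaternionHom_a (h : x ^ n = y ^ 2) (hy : y * x * y⁻¹ = x⁻¹) (k : ℤ) :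
    quaternionHom x y n h hy (.a k) = x ^ k :=
  cyclicHom_intCast _ _ (pow_two_mul_eq_one h hy) _

theorem map_quaternionHom (f : E →* E') {x' y' : E'} (hx : f x = x') (hy0 : f y = y')
    (h : x ^ n = y ^ 2) (hy : y * x * y⁻¹ = x⁻¹)
    (h' : x' ^ n = y' ^ 2) (hy' : y' * x' * y'⁻¹ = x'⁻¹) (a : QuaternionGroup n) :
    f (quaternionHom x y n h hy a) = quaternionHom x' y' n h' hy' a := by
  subst hx hy0
  have ha : ∀ i, f (quaternionHom x y n h hy (.a i)) =
      quaternionHom (f x) (f y) n h' hy' (.a i) := by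
    intro i
    obtain ⟨k, rfl⟩ := ZMod.intCast_surjective i
    rw [quaternionHom_a, quaternionHom_a, map_zpow]
  rcases a with i | i
  · exact ha i
  · rw [quaternionHom_xa, quaternionHom_xa, map_mul, ha]

theorem quaternionHom_injective (h : x ^ n = y ^ 2) (hy : y * x * y⁻¹ = x⁻¹)
    (hx : orderOf x = 2 * n) (hn : 1 < n) : Function.Injective (quaternionHom x y n h hy) := by
  rw [injective_iff_map_eq_one]
  have key : ∀ k : ℤ, y ≠ x ^ k := by
    rintro k rfl
    rw [(((Commute.refl x).zpow_left k)).eq, mul_inv_cancel_right,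
      eq_inv_iff_mul_eq_one, ← sq] at hy
    have := Nat.le_of_dvd (by norm_num) (orderOf_dvd_of_pow_eq_one hy)
    omega
  rintro (i | i) hi
  · obtain ⟨k, rfl⟩ := ZMod.intCast_surjective i
    rw [quaternionHom_a, ← orderOf_dvd_iff_zpow_eq_one, hx] at hi
    rw [(ZMod.intCast_zmod_eq_zero_iff_dvd k _).2 hi, QuaternionGroup.a_zero]
  · obtain ⟨k, rfl⟩ := ZMod.intCast_surjective i
    rw [quaternionHom_xa, quaternionHom_a, ← eq_inv_iff_mul_eq_one, ← zpow_neg] at hi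
    exact absurd hi (key _)

end Quaternion

section Wreath

variable {S H H' : Type} [Group S] [Group H] [Group H']

/-- The action of the cyclic group of order two on `S × S` by the swap. -/
def swapAut (S : Type) [Group S] : Multiplicative (ZMod 2) →* MulAut (S × S) :=
  cyclicHom MulEquiv.prodComm 2 (by ext <;> rfl)

theorem multiplicative_zmod_two (a : Multiplicative (ZMod 2)) :
    a = 1 ∨ a = Multiplicative.ofAdd ((1 : ℤ) : ZMod 2) := by
  revert a; decide

/-- The universal property of the wreath product of `S` with a group of order two. -/
def swapHom (f : S × S →* H) (u : H) (hu : u ^ 2 = 1) (h : ∀ a b, u * f (a, b) = f (b, a) * u) :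
    (S × S) ⋊[swapAut S] Multiplicative (ZMod 2) →* H :=
  SemidirectProduct.lift f (cyclicHom u 2 hu) fun g => by
    rcases multiplicative_zmod_two g with rfl | rfl
    · ext1 x
      rw [map_one, map_one]
      exact (by simp : f x = 1 * f x * 1⁻¹)
    · ext1 ⟨a, b⟩
      simp only [swapAut, MonoidHom.comp_apply, cyclicHom_intCast, zpow_one]
      exact (eq_mul_inv_iff_mul_eq.2 (h a b).symm)

theorem swapHom_apply (f : S × S →* H) (u : H) (hu : u ^ 2 = 1)
    (h : ∀ a b, u * f (a, b) = f (b, a) * u) (x) :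
    swapHom f u hu h x = f x.left * cyclicHom u 2 hu x.right := rfl

theorem swapHom_injective (f : S × S →* H) (u : H) (hu : u ^ 2 = 1)
    (h : ∀ a b, u * f (a, b) = f (b, a) * u) (hf : Function.Injective f) (hn : ∀ x, f x ≠ u) :
    Function.Injective (swapHom f u hu h) := by
  rw [injective_iff_map_eq_one]
  rintro ⟨x, k⟩ hx
  rw [swapHom_apply] at hx
  rcases multiplicative_zmod_two k with rfl | rfl
  · simp only [map_one, mul_one] at hx
    rw [(injective_iff_map_eq_one f).1 hf x hx]
    rfl
  · simp only [cyclicHom_intCast, zpow_one] at hx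
    refine absurd ?_ (hn x⁻¹)
    rw [map_inv, inv_eq_iff_mul_eq_one, hx]

end Wreath

/-- A group containing, with invertible index, the wreath product of `S` with a group of order two,
where `S` is generated by two conjugate subgroups of invertible order. -/
structure SwapData (F : Type) [Field F] (G S L : Type) [Group G] [Group S] [Group L] where
  i : S × S →* G
  inj : Function.Injective i
  t : G
  t_sq : t * t = 1
  t_mul : ∀ a b, t * i (a, b) = i (b, a) * t
  t_notMem : ∀ x, i x ≠ t
  index : ∃ m : ℕ, Nat.card G = Nat.card S * Nat.card S * 2 * m ∧ (m : F) ≠ 0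
  X : L →* S
  w : S
  gen : X.range ⊔ ((MulAut.conj w).toMonoidHom.comp X).range = ⊤
  card_ne : (Nat.card L : F) ≠ 0

namespace SwapData

variable {F G S L : Type} [Field F] [Group G] [Group S] [Group L]
  (D : SwapData F G S L)

def X₂ : L →* G := D.i.comp ((MonoidHom.inr S S).comp D.X)

def Y : L →* S := (MulAut.conj D.w).toMonoidHom.comp D.X

theorem t_conj (a b : S) : D.t * D.i (a, b) * D.t⁻¹ = D.i (b, a) := by
  rw [D.t_mul, mul_inv_cancel_right]

variable {M : Type} [AddCommGroup M] [Module F M] {ρ : Representation F G M} {V : Type}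
  [AddCommGroup V] [Module F V] {c : Fam ρ V}

theorem splits [Finite G] (σ : S →* FamExt c) (hσ : ∀ s, (σ s).snd = D.i (s, 1)) (u : FamExt c)
    (hu : u.snd = D.t) (hu2 : u * u = 1)
    (hX : ∀ s l, Commute (σ s) (u * σ (D.X l) * u⁻¹))
    (hY : ∀ l l', Commute (σ (D.Y l)) (u * σ (D.Y l') * u⁻¹)) : Splits c := by
  have hui : u⁻¹ = u := inv_eq_of_mul_eq_one_left hu2
  let σ' : S →* FamExt c := (MulAut.conj u).toMonoidHom.comp σ
  have hσ' : ∀ s, σ' s = u * σ s * u⁻¹ := fun s => rfl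
  have hσσ : ∀ s, u * σ' s * u⁻¹ = σ s := fun s => by
    rw [hσ', hui]
    simp only [← mul_assoc, hu2, one_mul]
    rw [mul_assoc, hu2, mul_one]
  have hgen : ∀ (x : FamExt c) (τ : S →* FamExt c), (∀ l, Commute x (τ (D.X l))) →
      (∀ l, Commute x (τ (D.Y l))) → ∀ s, Commute x (τ s) := by
    intro x τ h1 h2 s
    have : D.X.range ⊔ D.Y.range ≤ (Subgroup.centralizer {x}).comap τ := by
      rw [sup_le_iff]
      constructor <;> rintro _ ⟨l, rfl⟩ <;>
        rw [Subgroup.mem_comap, Subgroup.mem_centralizer_singleton_iff]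
      · exact (h1 l).symm.eq
      · exact (h2 l).symm.eq
    rw [show D.X.range ⊔ D.Y.range = ⊤ from D.gen] at this
    have := this (Subgroup.mem_top s)
    rw [Subgroup.mem_comap, Subgroup.mem_centralizer_singleton_iff] at this
    exact Commute.symm this
  have hXs : ∀ s l, Commute (σ' s) (σ (D.X l)) := fun s l => by
    have := Commute.conj (hX s l) u
    rw [← hσ', ← hσ', hσσ] at this
    exact this
  have hall : ∀ s s', Commute (σ s) (σ' s') := fun s s' => by
    refine hgen _ σ' (hX s) (fun l => ?_) s'
    exact (hgen _ σ (hXs _) (fun l' => (hY l' l).symm) s).symm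
  let f : S × S →* FamExt c := MonoidHom.noncommCoprod σ σ' hall
  have hf : ∀ x, (f x).snd = D.i x := fun ⟨a, b⟩ => by
    have h1 : (σ' b).snd = D.i (1, b) := by
      rw [hσ', FamExt.mul_snd, FamExt.mul_snd, FamExt.inv_snd, hσ, hu, t_conj]
    rw [MonoidHom.noncommCoprod_apply, FamExt.mul_snd, hσ, h1, ← map_mul]
    simp
  have hus : ∀ a b, u * f (a, b) = f (b, a) * u := fun a b => by
    rw [← mul_inv_eq_iff_eq_mul, MonoidHom.noncommCoprod_apply, MonoidHom.noncommCoprod_apply]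
    have : u * (σ a * σ' b) * u⁻¹ = (u * σ a * u⁻¹) * (u * σ' b * u⁻¹) := by group
    rw [this, hσσ, ← hσ', (hall b a).eq]
  have hd := swapHom_injective D.i D.t (by rw [sq, D.t_sq]) D.t_mul D.inj D.t_notMem
  obtain ⟨m, hm, hm'⟩ := D.index
  refine FamExt.splits_of_transfer (swapHom D.i D.t (by rw [sq, D.t_sq]) D.t_mul) hd
    (index_cast_ne_zero _ hd _ _ ?_ hm hm') (swapHom f u (by rw [sq, hu2]) hus) ?_
  · rw [SemidirectProduct.card, Nat.card_prod, Nat.card_congr Multiplicative.toAdd, Nat.card_zmod]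
  · intro x
    rw [swapHom_apply, swapHom_apply, FamExt.mul_snd, hf]
    congr 1
    rcases multiplicative_zmod_two x.right with h | h
    · simp [h]
    · rw [h, cyclicHom_intCast, cyclicHom_intCast, zpow_one, zpow_one, hu]

/-- The dimension of the invariants of a generating subgroup of the second factor. -/
noncomputable def dim (ρ : Representation F G M) : ℕ :=
  Module.finrank F (Representation.invariants (ρ.comp D.X₂ : Representation F L M))

theorem red_of_involution [Finite G] [Finite L] [FiniteDimensional F M] [FiniteDimensional F V]
    (σ : S →* FamExt c)
    (hσ : ∀ s, (σ s).snd = D.i (s, 1)) (u : FamExt c)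
    (hu : u.snd = D.t) (hu2 : u * u = 1)
    (hX : ∀ s l, Commute (σ s) (u * σ (D.X l) * u⁻¹)) :
    Red c (Module.finrank F M - D.dim ρ) := by
  let i₂ : S →* G := D.i.comp (MonoidHom.inr S S)
  let W := Representation.invariants (ρ.comp (i₂.comp D.Y) : Representation F L M)
  have hW : Module.finrank F (M ⧸ W) ≤ Module.finrank F M - D.dim ρ := by
    have h1 := W.finrank_quotient_add_finrank
    have h2 : D.dim ρ ≤ Module.finrank F W := by
      have hinv : ∀ m, ρ (i₂ D.w)⁻¹ (ρ (i₂ D.w) m) = m := fun m => by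
        rw [← Module.End.mul_apply, ← map_mul, inv_mul_cancel, map_one, Module.End.one_apply]
      refine LinearMap.finrank_le_finrank_of_injective (f := LinearMap.restrict (ρ (i₂ D.w)) ?_) ?_
      · intro m hm l
        have := hm l
        change ρ (i₂ (D.X l)) m = m at this
        change ρ (i₂ (D.w * D.X l * D.w⁻¹)) (ρ (i₂ D.w) m) = _
        rw [map_mul, map_mul, map_mul, map_mul, map_inv, Module.End.mul_apply, Module.End.mul_apply,
          hinv, this]
      · intro a b hab
        apply Subtype.ext
        have := congrArg (fun x => ρ (i₂ D.w)⁻¹ x.1) hab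
        exact ((hinv a.1).symm.trans this).trans (hinv b.1)
    omega
  obtain ⟨C₀, hC₀⟩ := FamExt.exists_lift_of_coprime (c := c) (H := L × L) (by
    rw [Nat.card_prod, Nat.cast_mul]; exact mul_ne_zero D.card_ne D.card_ne)
    (D.i.comp (D.Y.prodMap D.Y))
  obtain ⟨e, he, hec⟩ := FamExt.exists_conj D.card_ne (σ.comp D.Y)
    (C₀.comp (MonoidHom.inl L L)) 1 (fun k => by simp [hC₀, hσ])
  let C : L × L →* FamExt c := (MulAut.conj e).toMonoidHom.comp C₀
  have hC : ∀ x, (C x).snd = D.i (D.Y x.1, D.Y x.2) := fun x => by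
    change (e * C₀ x * e⁻¹).snd = _
    simp [he, hC₀]
    rfl
  have hC1 : ∀ l, C (l, 1) = σ (D.Y l) := fun l => by
    change e * C₀ (l, 1) * e⁻¹ = _
    rw [mul_inv_eq_iff_eq_mul]
    exact (hec l).symm
  let Y' : L →* FamExt c := ((MulAut.conj u).toMonoidHom.comp σ).comp D.Y
  have hY' : ∀ l, Y' l = u * σ (D.Y l) * u⁻¹ := fun l => rfl
  have hY'2 : ∀ l, (Y' l).snd = D.i (1, D.Y l) := fun l => by
    rw [hY', FamExt.mul_snd, FamExt.mul_snd, FamExt.inv_snd, hσ, hu, t_conj]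
  obtain ⟨e', he', hec'⟩ := FamExt.exists_conj D.card_ne Y' (C.comp (MonoidHom.inr L L)) 1
    (fun k => by simp [hC, hY'2])
  obtain ⟨m, rfl⟩ := FamExt.exists_eq_ι he'
  refine Red.kill (l := 0) (W.mkQ ∘ₗ m) hW fun V' _ _ _ j hj => Red.of_splits ?_ _
  have hm : ∀ v l, ρ (D.i (1, D.Y l)) (m (j v)) = m (j v) := fun v l => by
    have h1 : m (j v) ∈ W := by
      rw [← Submodule.Quotient.mk_eq_zero]
      exact congrArg (· v) hj
    exact h1 l
  let μ := FamExt.map c j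
  have hY'C : ∀ l, μ (Y' l) = μ (C (1, l)) := fun l => by
    have h1 := congrArg μ (hec' l)
    rw [map_mul, map_mul] at h1
    have h2 : Commute (μ (C (1, l))) (μ (FamExt.ι c m)) := by
      rw [FamExt.map_ι]
      refine FamExt.commute_ι ?_
      ext v
      simpa [μ, FamExt.map_snd, hC] using hm v l
    change μ (Y' l) * _ = _ * μ (C (1, l)) at h1
    rw [← h2.eq] at h1
    exact mul_right_cancel h1
  refine D.splits (μ.comp σ) (fun s => by simp [μ, FamExt.map_snd, hσ]) (μ u)
    (by simp [μ, FamExt.map_snd, hu]) (by rw [← map_mul, hu2, map_one]) (fun s l => ?_)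
    (fun l l' => ?_)
  · have := (hX s l).map μ
    simpa using this
  · have h1 : Commute (C (l, 1)) (C (1, l')) := by
      rw [Commute, SemiconjBy, ← map_mul, ← map_mul]; simp
    have h2 := h1.map μ
    rw [← hY'C, hC1, hY'] at h2
    simpa using h2

theorem red_of_lift [Finite G] [Finite L] [FiniteDimensional F M] [FiniteDimensional F V]
    (σ : S →* FamExt c)
    (hσ : ∀ s, (σ s).snd = D.i (s, 1)) (ξ : L →* FamExt c) (hξ : ∀ l, (ξ l).snd = D.X₂ l)
    (hc : ∀ s l, Commute (σ s) (ξ l)) :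
    Red c (D.dim ρ + (Module.finrank F M - D.dim ρ)) := by
  let κ : L × L →* FamExt c := MonoidHom.noncommCoprod (σ.comp D.X) ξ fun _ _ => hc _ _
  have hκ : ∀ x, κ x = σ (D.X x.1) * ξ x.2 := fun x => rfl
  have hκ2 : ∀ x, (κ x).snd = D.i (D.X x.1, D.X x.2) := fun x => by
    rw [hκ, FamExt.mul_snd, hσ, hξ, X₂, MonoidHom.comp_apply, ← map_mul]
    simp
  obtain ⟨u, hu, huc⟩ := FamExt.exists_conj (K := L × L) (by
    rw [Nat.card_prod, Nat.cast_mul]; exact mul_ne_zero D.card_ne D.card_ne)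
    (κ.comp (MulEquiv.prodComm : L × L ≃* L × L).toMonoidHom) κ D.t (fun k => by
      simp [hκ2, D.t_mul])
  have huc' : ∀ a b, κ (b, a) * u = u * κ (a, b) := fun a b => huc (a, b)
  refine Red.kill_commute ξ D.X₂ hξ (x := u * u) (by simp [hu, D.t_sq]) (fun l => ?_) le_rfl
    fun V' _ _ _ j hj => ?_
  · have h1 : ξ l = κ (1, l) := by simp [hκ]
    rw [h1, Commute, SemiconjBy, ← mul_assoc, huc', mul_assoc, huc', mul_assoc]
  · let μ := FamExt.map c j
    refine D.red_of_involution (μ.comp σ) (fun s => by simp [μ, FamExt.map_snd, hσ]) (μ u)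
      (by simp [μ, FamExt.map_snd, hu]) (by rw [← map_mul]; exact hj) fun s l => ?_
    have h1 : u * σ (D.X l) * u⁻¹ = ξ l := by
      rw [mul_inv_eq_iff_eq_mul]
      have := huc' l 1
      simp only [hκ, map_one, mul_one, one_mul] at this
      exact this.symm
    have h2 := (hc s l).map μ
    rw [← h1] at h2
    simpa using h2

theorem codim (D : SwapData F G S L) [Finite G] [Finite L] [Finite S] [FiniteDimensional F M]
    {n : ℕ} (x y : S) (h : x ^ n = y ^ 2) (hy : y * x * y⁻¹ = x⁻¹) (hx : orderOf x = 2 * n)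
    (hn : 1 < n) (hS : ∃ k m : ℕ, Nat.card S = k * m ∧ k ∣ 4 * n ∧ (m : F) ≠ 0) :
    Codim ρ (3 * Module.finrank F M) := by
  intro V _ _ _ c
  have hd : D.dim ρ ≤ Module.finrank F M := Submodule.finrank_le _
  refine Red.mono (k := D.dim ρ + (D.dim ρ + (D.dim ρ + (Module.finrank F M - D.dim ρ)))) ?_
    (by omega)
  obtain ⟨χ, hχ⟩ := FamExt.exists_lift_of_coprime (c := c) D.card_ne D.X₂
  have hlift : ∀ s, ∃ e : FamExt c, e.snd = D.i (s, 1) ∧ ∀ l, Commute (χ l) e := fun s =>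
    FamExt.exists_conj D.card_ne χ χ _ fun l => by simp [hχ, X₂, ← map_mul]
  obtain ⟨x', hx', hxc⟩ := hlift x
  obtain ⟨y', hy', hyc⟩ := hlift y
  refine Red.kill_commute χ D.X₂ hχ (x := x' ^ n * (y' ^ 2)⁻¹) ?_ (fun l => ?_) le_rfl
    fun V₁ _ _ _ j₁ hj₁ => ?_
  · simp only [FamExt.mul_snd, FamExt.pow_snd, FamExt.inv_snd, hx', hy', ← map_pow, ← map_inv,
      ← map_mul]
    simp [h, ← Prod.one_eq_mk]
  · exact ((hxc l).pow_right n).mul_right ((hyc l).pow_right 2).inv_right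
  · let μ₁ := FamExt.map c j₁
    refine Red.kill_commute (μ₁.comp χ) D.X₂ (fun l => by simp [μ₁, FamExt.map_snd, hχ])
      (x := μ₁ (y' * x' * y'⁻¹ * x')) ?_ (fun l => ?_) le_rfl fun V₂ _ _ _ j₂ hj₂ => ?_
    · simp only [μ₁, FamExt.map_snd, FamExt.mul_snd, FamExt.inv_snd, hx', hy', ← map_inv,
        ← map_mul]
      simp [hy, ← Prod.one_eq_mk]
    · exact Commute.map ((((hyc l).mul_right (hxc l)).mul_right (hyc l).inv_right).mul_right
        (hxc l)) μ₁
    · let μ := (FamExt.map (c.comap j₁) j₂).comp μ₁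
      have hμ : ∀ e, (μ e).snd = e.snd := fun e => by simp [μ, μ₁, FamExt.map_snd]
      have h1 : μ x' ^ n = μ y' ^ 2 := by
        rw [← mul_inv_eq_one, ← map_pow, ← map_pow, ← map_inv, ← map_mul]
        exact (congrArg (FamExt.map (c.comap j₁) j₂) hj₁).trans (map_one _)
      have h2 : μ y' * μ x' * (μ y')⁻¹ = (μ x')⁻¹ := by
        rw [eq_inv_iff_mul_eq_one, ← map_inv, ← map_mul, ← map_mul, ← map_mul]
        exact hj₂
      let d₀ := quaternionHom x y n h hy
      have hd₀ := quaternionHom_injective h hy hx hn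
      let d : QuaternionGroup n × L →* S × L := d₀.prodMap (MonoidHom.id L)
      have hcomm : ∀ a l, Commute (quaternionHom _ _ n h1 h2 a) (μ (χ l)) := by
        have hX : ∀ l, Commute (μ (χ l)) (μ x') := fun l => (hxc l).map μ
        have hY : ∀ l, Commute (μ (χ l)) (μ y') := fun l => (hyc l).map μ
        have hA : ∀ i l, Commute (quaternionHom _ _ n h1 h2 (.a i)) (μ (χ l)) := fun i l => by
          obtain ⟨k, rfl⟩ := ZMod.intCast_surjective i
          rw [quaternionHom_a]
          exact ((hX l).zpow_right k).symm
        rintro (i | i) l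
        · exact hA i l
        · rw [quaternionHom_xa]
          exact (hY l).symm.mul_left (hA i l)
      obtain ⟨k, m, hkm, hk, hm⟩ := hS
      obtain ⟨τ, hτ⟩ := FamExt.exists_transfer (D.i.comp (MonoidHom.prodMap (MonoidHom.id S) D.X)) d
        (Prod.map_injective.2 ⟨hd₀, Function.injective_id⟩) (index_cast_ne_zero _
          (Prod.map_injective.2 ⟨hd₀, Function.injective_id⟩) (k * Nat.card L) m (by
            have : NeZero n := ⟨by omega⟩
            rw [Nat.card_prod, Nat.card_eq_fintype_card (α := QuaternionGroup n),
              QuaternionGroup.card]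
            exact mul_dvd_mul_right hk _) (by rw [Nat.card_prod, hkm]; ring) hm)
        (MonoidHom.noncommCoprod (quaternionHom _ _ n h1 h2) (μ.comp χ) hcomm) (by
          rintro ⟨a, l⟩
          rw [MonoidHom.noncommCoprod_apply, FamExt.mul_snd]
          change _ * (μ (χ l)).snd = _
          rw [hμ (χ l), hχ]
          have h3 := map_quaternionHom (FamExt.proj ((c.comap j₁).comap j₂)) (x := μ x')
            (y := μ y') (x' := D.i (x, 1)) (y' := D.i (y, 1)) ((hμ _).trans hx') ((hμ _).trans hy')
            h1 h2 (by simp [← map_pow, h]) (by simp only [← map_mul, ← map_inv]; simp [hy]) a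
          have h4 := map_quaternionHom (D.i.comp (MonoidHom.inl S S)) (x := x)
            (y := y) (x' := D.i (x, 1)) (y' := D.i (y, 1)) rfl rfl
            h hy (by simp [← map_pow, h]) (by simp only [← map_mul, ← map_inv]; simp [hy]) a
          rw [FamExt.proj_apply] at h3
          rw [h3, ← h4, X₂, MonoidHom.comp_apply, MonoidHom.comp_apply, ← map_mul]
          simp [d, d₀])
      refine D.red_of_lift (τ.comp (MonoidHom.inl S L)) (fun s => by simp [hτ])
        (τ.comp (MonoidHom.inr S L)) (fun l => by simp [hτ, X₂]) fun s l => ?_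
      simp only [MonoidHom.comp_apply, MonoidHom.inl_apply, MonoidHom.inr_apply, Commute,
        SemiconjBy,
        ← map_mul]
      simp

end SwapData

section CharacteristicTwo

open Matrix

variable {K : Type} [Field K]

/-- The upper unipotent subgroup of `SL(2)`. -/
def upperUnipotent : Multiplicative K →* Matrix.SpecialLinearGroup (Fin 2) K :=
  MonoidHom.mk' (fun x => ⟨!![1, x.toAdd; 0, 1], by simp⟩) fun x y => by
    apply Subtype.ext
    change _ = !![1, x.toAdd; 0, 1] * !![1, y.toAdd; 0, 1]
    simp [add_comm]

/-- The Weyl element of `SL(2)`. -/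
def weylSL2 : Matrix.SpecialLinearGroup (Fin 2) K := ⟨!![0, 1; -1, 0], by simp⟩

theorem lower_eq (x : K) : (((MulAut.conj weylSL2).toMonoidHom.comp upperUnipotent)
    (Multiplicative.ofAdd (-x)) : Matrix.SpecialLinearGroup (Fin 2) K) =
      ⟨!![1, 0; x, 1], by simp⟩ := by
  change weylSL2 * upperUnipotent (Multiplicative.ofAdd (-x)) * weylSL2⁻¹ = _
  refine mul_inv_eq_iff_eq_mul.2 (Subtype.ext ?_)
  change !![0, 1; -1, 0] * !![1, -x; 0, 1] = !![1, 0; x, 1] * !![0, 1; -1, 0]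
  simp

theorem SL2_generated : (upperUnipotent (K := K)).range ⊔
    ((MulAut.conj weylSL2).toMonoidHom.comp upperUnipotent).range = ⊤ := by
  set H := (upperUnipotent (K := K)).range ⊔
    ((MulAut.conj weylSL2).toMonoidHom.comp upperUnipotent).range
  have hu : ∀ x : K, (⟨!![1, x; 0, 1], by simp⟩ : Matrix.SpecialLinearGroup (Fin 2) K) ∈ H :=
    fun x => (le_sup_left : _ ≤ H) ⟨Multiplicative.ofAdd x, rfl⟩
  have hl : ∀ x : K, (⟨!![1, 0; x, 1], by simp⟩ : Matrix.SpecialLinearGroup (Fin 2) K) ∈ H :=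
    fun x => (le_sup_right : _ ≤ H) ⟨Multiplicative.ofAdd (-x), lower_eq x⟩
  have key : ∀ A : Matrix.SpecialLinearGroup (Fin 2) K, A 1 0 ≠ 0 → A ∈ H := fun A hA => by
    have hdet := A.2
    rw [det_fin_two] at hdet
    have : A = ⟨!![1, (A 0 0 - 1) / A 1 0; 0, 1], by simp⟩ * ⟨!![1, 0; A 1 0, 1], by simp⟩ *
        ⟨!![1, (A 1 1 - 1) / A 1 0; 0, 1], by simp⟩ := by
      apply Subtype.ext
      change A.1 = !![1, (A 0 0 - 1) / A 1 0; 0, 1] * !![1, 0; A 1 0, 1] *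
        !![1, (A 1 1 - 1) / A 1 0; 0, 1]
      ext i j
      fin_cases i <;> fin_cases j
      · simp [div_mul_cancel₀ _ hA]
      · simp [div_mul_cancel₀ _ hA]
        field_simp
        linear_combination -hdet
      · simp
      · simp [mul_div_cancel₀ _ hA]
    rw [this]
    exact H.mul_mem (H.mul_mem (hu _) (hl _)) (hu _)
  rw [eq_top_iff]
  intro A _
  by_cases hA : A 1 0 = 0
  · have hdet := A.2
    rw [det_fin_two] at hdet
    change A 0 0 * A 1 1 - A 0 1 * A 1 0 = 1 at hdet
    have h00 : A 0 0 ≠ 0 := fun h => by rw [h, hA] at hdet; simp at hdet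
    have := key (⟨!![1, 0; 1, 1], by simp⟩ * A) (by
      change (!![1, 0; 1, 1] * A.1 : Matrix (Fin 2) (Fin 2) K) 1 0 ≠ 0
      have : A.1 1 0 = 0 := hA
      rw [Matrix.mul_apply, Fin.sum_univ_two, this]
      simpa using h00)
    exact (H.mul_mem_cancel_left (hl 1)).1 this
  · exact key A hA

theorem exists_inverting (h2 : (2 : K) ≠ 0) [Fintype K] (τ : K) (hτ : τ ^ 2 ≠ 4)
    (c : Matrix.SpecialLinearGroup (Fin 2) K) (hc : c.1 = !![0, -1; 1, τ]) (n : ℕ)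
    (hn : orderOf c = 2 * n) (hn0 : n ≠ 0) :
    ∃ w : Matrix.SpecialLinearGroup (Fin 2) K, c ^ n = w ^ 2 ∧ w * c * w⁻¹ = c⁻¹ := by
  have hodd := FiniteField.odd_card_of_char_ne_two (F := K) (fun h => h2 (by
    have := ringChar.Nat.cast_ringChar (R := K)
    rwa [h] at this))
  have h4 : (4 : K) ≠ 0 := by
    rw [show (4 : K) = 2 * 2 by norm_num]; exact mul_ne_zero h2 h2
  obtain ⟨a, z, haz⟩ := FiniteField.exists_root_sum_quadratic (R := K)
      (f := Polynomial.C 1 * Polynomial.X ^ 2 + Polynomial.C 0 * Polynomial.X + Polynomial.C 1)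
      (g := Polynomial.C (1 - τ ^ 2 / 4) * Polynomial.X ^ 2 + Polynomial.C 0 * Polynomial.X +
        Polynomial.C 0)
      (Polynomial.degree_quadratic one_ne_zero) (Polynomial.degree_quadratic (fun h => hτ (by
        rw [sub_eq_zero, eq_div_iff h4, one_mul] at h; exact h.symm))) hodd
  simp only [Polynomial.eval_add, Polynomial.eval_mul, Polynomial.eval_C, Polynomial.eval_X,
    Polynomial.eval_pow] at haz
  obtain ⟨x, hx⟩ : ∃ x, a = x + τ * z / 2 := ⟨a - τ * z / 2, by ring⟩
  have hdet : -x ^ 2 - (z + x * τ) * z = 1 := by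
    rw [hx] at haz
    have h42 : (4 : K) = 2 ^ 2 := by norm_num
    rw [h42] at haz
    field_simp at haz
    refine mul_left_cancel₀ h4 ?_
    linear_combination -haz
  let w : Matrix.SpecialLinearGroup (Fin 2) K := ⟨!![x, z + x * τ; z, -x], by
    rw [det_fin_two_of]; linear_combination hdet⟩
  have hneg : ∀ g : Matrix.SpecialLinearGroup (Fin 2) K, g * g = 1 → g ≠ 1 →
      g.1 = !![-1, 0; 0, -1] := by
    intro g hg hg1
    have h1 : g = g⁻¹ := eq_inv_of_mul_eq_one_left hg
    have h3 : g.1 = adjugate g.1 := congrArg Subtype.val h1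
    rw [adjugate_fin_two] at h3
    have e00 : g.1 0 0 = g.1 1 1 := congrFun (congrFun h3 0) 0
    have e01 : g.1 0 1 = -g.1 0 1 := congrFun (congrFun h3 0) 1
    have e10 : g.1 1 0 = -g.1 1 0 := congrFun (congrFun h3 1) 0
    have z01 : g.1 0 1 = 0 :=
      (mul_eq_zero.1 (by linear_combination e01 : 2 * g.1 0 1 = 0)).resolve_left h2
    have z10 : g.1 1 0 = 0 :=
      (mul_eq_zero.1 (by linear_combination e10 : 2 * g.1 1 0 = 0)).resolve_left h2
    have hd := g.2
    rw [det_fin_two, z01, ← e00, zero_mul, sub_zero, mul_self_eq_one_iff] at hd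
    have hm1 : g.1 0 0 = -1 := hd.resolve_left fun h => hg1 (by
      apply Subtype.ext
      change g.1 = 1
      ext i j
      fin_cases i <;> fin_cases j
      · simpa using h
      · simpa using z01
      · simpa using z10
      · simpa [← e00] using h)
    ext i j
    fin_cases i <;> fin_cases j
    · simpa using hm1
    · simpa using z01
    · simpa using z10
    · simpa [← e00] using hm1
  refine ⟨w, Subtype.ext ?_, ?_⟩
  · rw [hneg (c ^ n) (by rw [← pow_add, ← two_mul, ← hn, pow_orderOf_eq_one]) (fun h => by
      have := Nat.le_of_dvd (by omega) (orderOf_dvd_of_pow_eq_one h)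
      omega), sq]
    change _ = !![x, z + x * τ; z, -x] * !![x, z + x * τ; z, -x]
    ext i j
    fin_cases i <;> fin_cases j
    · simp; linear_combination hdet
    · simp; ring
    · simp; ring
    · simp; linear_combination hdet
  · rw [mul_inv_eq_iff_eq_mul, eq_inv_mul_iff_mul_eq]
    apply Subtype.ext
    change c.1 * (!![x, z + x * τ; z, -x] * c.1) = !![x, z + x * τ; z, -x]
    rw [hc]
    ext i j
    fin_cases i <;> fin_cases j
    · simp
    · simp; ring
    · simp; ring
    · simp; ring

/-- The element exchanging the two factors of `SL(2) × SL(2)`. -/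
def swapSp4 : symplecticGroup (Fin 2) K := ⟨fromBlocks !![0, 1; 1, 0] 0 0 !![0, 1; 1, 0], by
  rw [SymplecticGroup.fromBlocks_mem_iff]
  refine ⟨by simp, by simp, ?_⟩
  ext i j
  fin_cases i <;> fin_cases j <;> simp [Matrix.mul_apply]⟩

theorem swapSp4_mul (a b : Matrix.SpecialLinearGroup (Fin 2) K) :
    swapSp4 * SL2Prod (a, b) = SL2Prod (b, a) * swapSp4 := by
  apply Subtype.ext
  change fromBlocks !![0, 1; 1, 0] 0 0 !![0, 1; 1, 0] * interleave a.1 b.1 =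
    interleave b.1 a.1 * fromBlocks !![0, 1; 1, 0] 0 0 !![0, 1; 1, 0]
  rw [interleave, interleave, fromBlocks_multiply, fromBlocks_multiply]
  congr 1 <;> (ext i j; fin_cases i <;> fin_cases j <;>
    simp [Matrix.mul_apply, diagonal, vecHead, vecTail])

theorem swapSp4_sq : (swapSp4 * swapSp4 : symplecticGroup (Fin 2) K) = 1 := by
  apply Subtype.ext
  change fromBlocks !![0, 1; 1, 0] 0 0 !![0, 1; 1, 0] *
    fromBlocks !![0, 1; 1, 0] 0 0 !![0, 1; 1, 0] = (1 : Matrix (Fin 2 ⊕ Fin 2) (Fin 2 ⊕ Fin 2) K)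
  rw [fromBlocks_multiply, ← fromBlocks_one]
  congr 1 <;> (ext i j; fin_cases i <;> fin_cases j <;> simp)

variable [Fintype K] {F M : Type} [Field F] [AddCommGroup M] [Module F M]
  [FiniteDimensional F M] (ρ : Representation F (symplecticGroup (Fin 2) K) M)

theorem codim_of_two_eq_zero (h2 : (2 : F) = 0) (hq : (Fintype.card K : F) = 1) :
    Codim ρ (3 * Module.finrank F M) := by
  obtain ⟨q, hqdef⟩ : ∃ q, q = Fintype.card K := ⟨_, rfl⟩
  rw [← hqdef] at hq
  have hq1 : 1 < q := hqdef ▸ Fintype.one_lt_card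
  have hodd : q % 2 = 1 := by
    by_contra h
    obtain ⟨k, hk⟩ : ∃ k, q = 2 * k := ⟨q / 2, by omega⟩
    rw [hk, Nat.cast_mul, Nat.cast_ofNat, h2, zero_mul] at hq
    exact zero_ne_one hq
  have hcast : ∀ k : ℕ, ((2 * k + 1 : ℕ) : F) ≠ 0 := fun k => by
    push_cast; rw [h2, zero_mul, zero_add]; exact one_ne_zero
  have hK2 : (2 : K) ≠ 0 := fun h => by
    have h1 := FiniteField.cast_card_eq_zero K
    rw [← hqdef, ← Nat.div_add_mod q 2, hodd] at h1
    push_cast at h1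
    rw [h, zero_mul, zero_add] at h1
    exact one_ne_zero h1
  let D : SwapData F (symplecticGroup (Fin 2) K) (Matrix.SpecialLinearGroup (Fin 2) K)
      (Multiplicative K) :=
    { i := SL2Prod
      inj := SL2Prod_injective
      t := swapSp4
      t_sq := swapSp4_sq
      t_mul := swapSp4_mul
      t_notMem := fun x hx => by
        have h1 := congrArg (fun g : symplecticGroup (Fin 2) K => g.1 (.inl 0) (.inl 1)) hx
        change (0 : K) = 1 at h1
        exact zero_ne_one h1
      index := by
        obtain ⟨k, hk⟩ : ∃ k, q = 2 * k + 1 := ⟨q / 2, by omega⟩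
        refine ⟨q ^ 2 * (2 * (k ^ 2 + k) + 1), ?_, ?_⟩
        · have h4 : q ^ 4 - 1 = (q ^ 2 + 1) * (q ^ 2 - 1) := by
            rw [← Nat.sq_sub_sq (q ^ 2) 1]; ring_nf
          have h5 : q ^ 2 + 1 = 2 * (2 * (k ^ 2 + k) + 1) := by rw [hk]; ring
          rw [natCard_Sp4, natCard_SL2, Nat.card_eq_fintype_card, ← hqdef, h4, h5]
          ring
        · rw [Nat.cast_mul, Nat.cast_pow, hq, one_pow, one_mul]
          exact hcast _
      X := upperUnipotent
      w := weylSL2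
      gen := SL2_generated
      card_ne := by
        rw [Nat.card_congr Multiplicative.toAdd, Nat.card_eq_fintype_card, ← hqdef, hq]
        exact one_ne_zero }
  obtain ⟨N, k, hN, hN4, hNk⟩ : ∃ N k : ℕ, (N + 1 = q ∨ N = q + 1) ∧ 4 ∣ N ∧
      q ^ 2 - 1 = 2 * N * (2 * k + 1) := by
    rcases (by omega : q % 4 = 1 ∨ q % 4 = 3) with h | h
    · obtain ⟨k, hk⟩ : ∃ k, q = 4 * k + 1 := ⟨q / 4, by omega⟩
      refine ⟨4 * k, k, .inl hk.symm, Dvd.intro _ rfl, ?_⟩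
      rw [hk, Nat.sub_eq_iff_eq_add (Nat.one_le_pow _ _ (by omega))]; ring
    · obtain ⟨k, hk⟩ : ∃ k, q = 4 * k + 3 := ⟨q / 4, by omega⟩
      refine ⟨4 * k + 4, k, .inr (by omega), ⟨k + 1, by ring⟩, ?_⟩
      rw [hk, Nat.sub_eq_iff_eq_add (Nat.one_le_pow _ _ (by omega))]; ring
  have hN2 : 2 < N := by
    have := Nat.le_of_dvd (by omega) hN4
    omega
  obtain ⟨τ, c, hc, hNc, hτ⟩ := exists_SL2_orderOf (K := K) N (hqdef ▸ hN)
  obtain ⟨n, hn⟩ : ∃ n, orderOf c = 2 * n := by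
    obtain ⟨a, ha⟩ := hN4
    obtain ⟨b, hb⟩ := hNc
    exact ⟨2 * a * b, by rw [hb, ha]; ring⟩
  have hn1 : 1 < n := by
    have := Nat.le_of_dvd (orderOf_pos c) hNc
    omega
  obtain ⟨w, hw1, hw2⟩ := exists_inverting hK2 τ (hτ hN2) c hc n hn (by omega)
  refine D.codim c w hw1 hw2 hn hn1 ⟨2 * N, (2 * k + 1) * q, ?_, ?_, ?_⟩
  · rw [natCard_SL2, Nat.card_eq_fintype_card, ← hqdef, hNk, mul_assoc]
  · rw [show 4 * n = 2 * (2 * n) by ring, ← hn]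
    exact mul_dvd_mul_left 2 hNc
  · rw [Nat.cast_mul, hq, mul_one]
    exact hcast k

end CharacteristicTwo

section SmallField

theorem Commute.cyclicHom_left {E : Type} [Group E] {x y : E} (h : Commute x y) (n : ℕ)
    (hx : x ^ n = 1) (a : Multiplicative (ZMod n)) : Commute (cyclicHom x n hx a) y := by
  obtain ⟨k, rfl⟩ := cyclicHom_exists a
  rw [cyclicHom_intCast]
  exact h.zpow_left k

/-- The homomorphism from `(C₂ ≀ C₂) × C₂` given by involutions `x`, `w x w⁻¹`, `w`, `s`. -/
def wreathProdHom {E : Type} [Group E] (x y w s : E) (hx : x ^ 2 = 1) (hy : y ^ 2 = 1)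
    (hw : w ^ 2 = 1) (hs : s ^ 2 = 1) (hxy : Commute x y) (hwx : w * x = y * w)
    (hxs : Commute x s) (hys : Commute y s) (hws : Commute w s) :
    ((Multiplicative (ZMod 2) × Multiplicative (ZMod 2)) ⋊[swapAut (Multiplicative (ZMod 2))]
      Multiplicative (ZMod 2)) × Multiplicative (ZMod 2) →* E :=
  MonoidHom.noncommCoprod
    (swapHom (MonoidHom.noncommCoprod (cyclicHom x 2 hx) (cyclicHom y 2 hy) fun a b =>
      ((hxy.cyclicHom_left 2 hx a).symm.cyclicHom_left 2 hy b).symm) w hw fun a b => by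
        have hwy : w * y = x * w := by
          have hi : w⁻¹ = w := inv_eq_of_mul_eq_one_left (by rw [← sq, hw])
          calc w * y = w * (w * x * w⁻¹) := by rw [hwx, mul_inv_cancel_right]
            _ = x * w := by rw [hi, ← mul_assoc, ← mul_assoc, ← sq, hw, one_mul]
        have hc : ∀ a, w * cyclicHom x 2 hx a = cyclicHom y 2 hy a * w := fun a => by
          obtain ⟨k, rfl⟩ := cyclicHom_exists a
          rw [cyclicHom_intCast, cyclicHom_intCast]
          exact SemiconjBy.zpow_right hwx k
        have hc' : ∀ a, w * cyclicHom y 2 hy a = cyclicHom x 2 hx a * w := fun a => by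
          obtain ⟨k, rfl⟩ := cyclicHom_exists a
          rw [cyclicHom_intCast, cyclicHom_intCast]
          exact SemiconjBy.zpow_right hwy k
        simp only [MonoidHom.noncommCoprod_apply]
        rw [← mul_assoc, hc, mul_assoc, hc', ← mul_assoc]
        congr 1
        exact ((hxy.cyclicHom_left 2 hx b).symm.cyclicHom_left 2 hy a).eq)
    (cyclicHom s 2 hs) fun a b => by
      rw [swapHom_apply, MonoidHom.noncommCoprod_apply]
      refine ((Commute.mul_left ?_ ?_).mul_left ?_)
      · exact ((hxs.cyclicHom_left 2 hx _).symm.cyclicHom_left 2 hs b).symm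
      · exact ((hys.cyclicHom_left 2 hy _).symm.cyclicHom_left 2 hs b).symm
      · exact ((hws.cyclicHom_left 2 hw _).symm.cyclicHom_left 2 hs b).symm

theorem wreathProdHom_apply {E : Type} [Group E] (x y w s : E) (hx : x ^ 2 = 1) (hy : y ^ 2 = 1)
    (hw : w ^ 2 = 1) (hs : s ^ 2 = 1) (hxy : Commute x y) (hwx : w * x = y * w)
    (hxs : Commute x s) (hys : Commute y s) (hws : Commute w s) (a) :
    wreathProdHom x y w s hx hy hw hs hxy hwx hxs hys hws a =
      cyclicHom x 2 hx a.1.left.1 * cyclicHom y 2 hy a.1.left.2 * cyclicHom w 2 hw a.1.right *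
        cyclicHom s 2 hs a.2 := rfl

/-- Elements and relations in the symmetric group on six letters, modelled on `s = (5 6)`,
`g = (1 3 5)(2 4 6)`, `w = (1 3)(2 4)`, `t = (1 2 3)`. -/
structure SixData (G : Type) [Group G] where
  s : G
  g : G
  w : G
  t : G
  h : G
  g_pow : g ^ 3 = 1
  t_pow : t ^ 3 = 1
  s_pow : s ^ 2 = 1
  w_pow : w ^ 2 = 1
  t_s : t * s = s * t
  w_s : Commute w s
  w_g : w * g = g⁻¹ * w
  h_w : h * (g * s * g⁻¹ * s) = w * h
  s_s : Commute (g * s * g⁻¹) (g⁻¹ * s * g)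
  w_eq : w = g * t * g * t * g⁻¹ * t * g * t⁻¹

theorem conj_relations {E : Type} [Group E] {g s : E} (hg : g ^ 3 = 1)
    (h : Commute (g * s * g⁻¹) (g⁻¹ * s * g)) :
    Commute (g * s * g⁻¹) s ∧ Commute (g⁻¹ * s * g) s := by
  have hg2 : g * g = g⁻¹ := by rw [eq_inv_iff_mul_eq_one, ← hg, pow_succ, sq]
  have hg2' : g⁻¹ * g⁻¹ = g := by rw [← mul_inv_rev, hg2, inv_inv]
  have h1 := h.conj g
  have h2 := h.conj g⁻¹
  have e1 : g * (g⁻¹ * s * g) * g⁻¹ = s := by group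
  have e2 : g * (g * s * g⁻¹) * g⁻¹ = g⁻¹ * s * g := by
    calc _ = (g * g) * s * (g * g)⁻¹ := by group
      _ = _ := by rw [hg2, inv_inv]
  have e3 : g⁻¹ * (g * s * g⁻¹) * g⁻¹⁻¹ = s := by group
  have e4 : g⁻¹ * (g⁻¹ * s * g) * g⁻¹⁻¹ = g * s * g⁻¹ := by
    calc _ = (g⁻¹ * g⁻¹) * s * (g⁻¹ * g⁻¹)⁻¹ := by simp only [mul_inv_rev, mul_assoc, inv_inv]
      _ = _ := by rw [hg2']
  rw [e1, e2] at h1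
  rw [e3, e4] at h2
  exact ⟨h2.symm, h1⟩

theorem inv_conj_sq {E : Type} [Group E] {g s : E} (hs : s ^ 2 = 1) : (g⁻¹ * s * g) ^ 2 = 1 := by
  have h := conj_pow (i := 2) (a := g⁻¹) (b := s)
  rw [inv_inv, hs, mul_one, inv_mul_cancel] at h
  exact h

namespace SixData

variable {F G M : Type} [Field F] [Group G] [AddCommGroup M] [Module F M]
  {ρ : Representation F G M} {V : Type} [AddCommGroup V] [Module F V] {c : Fam ρ V}

theorem conj_w {E : Type} [Group E] {g s w : E} (hwg : w * g = g⁻¹ * w)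
    (hws : Commute w s) : w * (g * s * g⁻¹) = (g⁻¹ * s * g) * w := by
  have h1 : w * g⁻¹ = g * w := by
    rw [mul_inv_eq_iff_eq_mul, mul_assoc, hwg, mul_inv_cancel_left]
  calc w * (g * s * g⁻¹) = (w * g) * s * g⁻¹ := by group
    _ = g⁻¹ * (w * s) * g⁻¹ := by rw [hwg]; group
    _ = g⁻¹ * s * (w * g⁻¹) := by rw [hws.eq]; group
    _ = _ := by rw [h1]; group

/-- A Sylow `2`-subgroup of the symmetric group on six letters. -/
def sylowHom (D : SixData G) : ((Multiplicative (ZMod 2) × Multiplicative (ZMod 2))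
    ⋊[swapAut (Multiplicative (ZMod 2))] Multiplicative (ZMod 2)) × Multiplicative (ZMod 2) →* G :=
  wreathProdHom (D.g * D.s * D.g⁻¹) (D.g⁻¹ * D.s * D.g) D.w D.s
    (by rw [conj_pow, D.s_pow]; group)
    (inv_conj_sq D.s_pow) D.w_pow D.s_pow D.s_s (conj_w D.w_g D.w_s)
    (conj_relations D.g_pow D.s_s).1 (conj_relations D.g_pow D.s_s).2 D.w_s

theorem splits [Finite G] (D : SixData G) (hd : Function.Injective D.sylowHom)
    (hi : (D.sylowHom.range.index : F) ≠ 0) {g s w : FamExt c} (hg : g.snd = D.g) (hs : s.snd = D.s)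
    (hw : w.snd = D.w) (hg3 : g ^ 3 = 1) (hs2 : s ^ 2 = 1) (hw2 : w ^ 2 = 1)
    (hss : Commute (g * s * g⁻¹) (g⁻¹ * s * g)) (hws : Commute w s) (hwg : w * g = g⁻¹ * w) :
    Splits c := by
  refine FamExt.splits_of_transfer D.sylowHom hd hi
    (wreathProdHom (g * s * g⁻¹) (g⁻¹ * s * g) w s
      (by rw [conj_pow, hs2]; group)
      (inv_conj_sq hs2)
      hw2 hs2 hss (conj_w hwg hws) (conj_relations hg3 hss).1 (conj_relations hg3 hss).2 hws)
    fun a => ?_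
  have key : ∀ (x : FamExt c) (y : G) (hx : x ^ 2 = 1) (hy : y ^ 2 = 1) (_ : x.snd = y) b,
      (cyclicHom x 2 hx b).snd = cyclicHom y 2 hy b := fun x y hx hy h b => by
    obtain ⟨k, rfl⟩ := cyclicHom_exists b
    rw [cyclicHom_intCast, cyclicHom_intCast, FamExt.zpow_snd, h]
  rw [sylowHom, wreathProdHom_apply, wreathProdHom_apply (E := G)]
  simp only [FamExt.mul_snd]
  rw [key _ (D.g * D.s * D.g⁻¹) _ _ (by simp [hg, hs]),
    key _ (D.g⁻¹ * D.s * D.g) _ _ (by simp [hg, hs]), key _ _ _ _ hw,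
    key _ _ _ _ hs]

/-- The dimension of the invariants of the element `t`. -/
noncomputable def dim (D : SixData G) (ρ : Representation F G M) : ℕ :=
  Module.finrank F (Representation.invariants
    (ρ.comp (cyclicHom D.t 3 D.t_pow) : Representation F (Multiplicative (ZMod 3)) M))

theorem red_of_commute [Finite G] [FiniteDimensional F M] [FiniteDimensional F V]
    (h2 : (2 : F) = 0) (D : SixData G) (hd : Function.Injective D.sylowHom)
    (hi : (D.sylowHom.range.index : F) ≠ 0) {g s w : FamExt c} (hg : g.snd = D.g) (hs : s.snd = D.s)
    (hw : w.snd = D.w) (hg3 : g ^ 3 = 1) (hs2 : s ^ 2 = 1)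
    (hss : Commute (g * s * g⁻¹) (g⁻¹ * s * g)) (hws : Commute w s) (hwg : w * g = g⁻¹ * w) :
    Red c (Module.finrank F M - D.dim ρ) := by
  obtain ⟨h, hh⟩ := FamExt.exists_lift (c := c) D.h
  let w' : FamExt c := h * (g * s * g⁻¹ * s) * h⁻¹
  have hw' : w'.snd = D.w := by simp [w', hh, hg, hs, D.h_w]
  have hw'2 : w' * w' = 1 := by
    have h1 := (conj_relations hg3 hss).1
    have h3 : (g * s * g⁻¹ * s) ^ 2 = 1 := by
      rw [h1.mul_pow, conj_pow, hs2, mul_one, mul_one, mul_inv_cancel]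
    rw [← sq, conj_pow, h3, mul_one, mul_inv_cancel]
  obtain ⟨m, hm⟩ := FamExt.exists_ι (hw.trans hw'.symm)
  have hadd : ∀ x : V →ₗ[F] M, x + x = 0 := fun x => by rw [← two_smul F, h2, zero_smul]
  have hww : w ^ 2 = FamExt.ι c (m + ρ D.w ∘ₗ m) := by
    rw [sq, hm, mul_assoc, ← mul_assoc w', FamExt.mul_ι, mul_assoc, hw'2, mul_one, hw',
      ← FamExt.ι_add]
  have hwg' : w * g⁻¹ = g * w := by
    rw [mul_inv_eq_iff_eq_mul, mul_assoc, hwg, mul_inv_cancel_left]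
  have hgfix : ρ D.g ∘ₗ (m + ρ D.w ∘ₗ m) = m + ρ D.w ∘ₗ m := by
    rw [← hg]
    apply FamExt.comp_eq_of_commute
    rw [← hww, Commute, SemiconjBy, sq, mul_assoc, hwg, ← mul_assoc, ← mul_assoc w, hwg',
      mul_assoc]
  let P : M →ₗ[F] M := 1 + ρ D.g + ρ D.g⁻¹
  have hgP : ρ D.g ∘ₗ P = P := by
    have e1 : D.g * D.g = D.g⁻¹ := by rw [eq_inv_iff_mul_eq_one, ← D.g_pow, pow_succ, sq]
    change ρ D.g * (1 + ρ D.g + ρ D.g⁻¹) = 1 + ρ D.g + ρ D.g⁻¹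
    rw [mul_add, mul_add, mul_one, ← map_mul, e1, ← map_mul, mul_inv_cancel, map_one]
    abel
  have hginv : ρ D.g⁻¹ ∘ₗ (m + ρ D.w ∘ₗ m) = m + ρ D.w ∘ₗ m := by
    nth_rw 1 [← hgfix]
    rw [← LinearMap.comp_assoc, ← Module.End.mul_eq_comp, ← map_mul, inv_mul_cancel, map_one]
    rfl
  have hwP : ρ D.w ∘ₗ P = P ∘ₗ ρ D.w := by
    have e1 : D.w * D.g⁻¹ = D.g * D.w := by
      rw [mul_inv_eq_iff_eq_mul, mul_assoc, D.w_g, mul_inv_cancel_left]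
    change ρ D.w * (1 + ρ D.g + ρ D.g⁻¹) = (1 + ρ D.g + ρ D.g⁻¹) * ρ D.w
    rw [mul_add, mul_add, add_mul, add_mul, mul_one, one_mul, ← map_mul, ← map_mul, ← map_mul,
      ← map_mul, D.w_g, e1]
    abel
  have hPm : m + ρ D.w ∘ₗ m = P ∘ₗ m + ρ D.w ∘ₗ (P ∘ₗ m) := by
    rw [← LinearMap.comp_assoc, hwP, LinearMap.comp_assoc, ← LinearMap.comp_add]
    change _ = (1 + ρ D.g + ρ D.g⁻¹) ∘ₗ (m + ρ D.w ∘ₗ m)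
    rw [LinearMap.add_comp, LinearMap.add_comp, hgfix, hginv, add_assoc, hadd, add_zero]
    rfl
  let W := Representation.invariants
    (ρ.comp (cyclicHom D.t 3 D.t_pow) : Representation F (Multiplicative (ZMod 3)) M)
  have hW : Module.finrank F (M ⧸ W) ≤ Module.finrank F M - D.dim ρ := by
    have h1 := W.finrank_quotient_add_finrank
    have h2 : D.dim ρ = Module.finrank F W := rfl
    omega
  refine Red.kill (l := 0) (W.mkQ ∘ₗ P ∘ₗ m) hW fun V' _ _ _ j hj => Red.of_splits ?_ _
  have htfix : ρ D.t ∘ₗ P ∘ₗ m ∘ₗ j = P ∘ₗ m ∘ₗ j := by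
    ext v
    have h1 : P (m (j v)) ∈ W := by
      rw [← Submodule.Quotient.mk_eq_zero]
      exact congrArg (· v) hj
    have h3 := h1 (Multiplicative.ofAdd ((1 : ℤ) : ZMod 3))
    rw [MonoidHom.comp_apply, cyclicHom_intCast, zpow_one] at h3
    exact h3
  have hwfix : ρ D.w ∘ₗ P ∘ₗ m ∘ₗ j = P ∘ₗ m ∘ₗ j := by
    have hgx : ρ D.g ∘ₗ P ∘ₗ m ∘ₗ j = P ∘ₗ m ∘ₗ j := by rw [← LinearMap.comp_assoc, hgP]
    generalize P ∘ₗ m ∘ₗ j = x at htfix hgx ⊢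
    have hinv : ∀ a : G, ρ a ∘ₗ x = x → ρ a⁻¹ ∘ₗ x = x := fun a ha => by
      nth_rw 1 [← ha]
      rw [← LinearMap.comp_assoc, ← Module.End.mul_eq_comp, ← map_mul, inv_mul_cancel, map_one]
      rfl
    rw [D.w_eq]
    simp only [map_mul, Module.End.mul_eq_comp, LinearMap.comp_assoc, hinv _ htfix, hinv _ hgx,
      htfix, hgx]
  let μ := FamExt.map c j
  refine D.splits hd hi (g := μ g) (s := μ s) (w := μ w) hg hs hw (by rw [← map_pow, hg3, map_one])
    (by rw [← map_pow, hs2, map_one]) ?_ ?_ (hws.map μ) ?_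
  · rw [← map_pow, hww, hPm, FamExt.map_ι, LinearMap.add_comp, LinearMap.comp_assoc,
      LinearMap.comp_assoc, LinearMap.comp_assoc, hwfix, FamExt.ι_eq_one]
    ext v
    rw [LinearMap.add_apply, ← two_smul F, h2, zero_smul]
    rfl
  · simpa using hss.map μ
  · rw [← map_mul, hwg, map_mul, map_inv]

theorem codim [Finite G] [FiniteDimensional F M]
    (h2 : (2 : F) = 0) (D : SixData G) (hd : Function.Injective D.sylowHom)
    (hi : (D.sylowHom.range.index : F) ≠ 0) : Codim ρ (3 * Module.finrank F M) := by
  intro V _ _ _ c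
  have hdim : D.dim ρ ≤ Module.finrank F M := Submodule.finrank_le _
  refine Red.mono (k := D.dim ρ + (Module.finrank F M + (Module.finrank F M +
    (Module.finrank F M - D.dim ρ)))) ?_ (by omega)
  have h3 : (Nat.card (Multiplicative (ZMod 3)) : F) ≠ 0 := by
    rw [Nat.card_congr Multiplicative.toAdd, Nat.card_zmod, Nat.cast_ofNat,
      show (3 : F) = 2 + 1 by norm_num, h2, zero_add]
    exact one_ne_zero
  let e : Multiplicative (ZMod 3) := Multiplicative.ofAdd ((1 : ℤ) : ZMod 3)
  have he : ∀ {H : Type} [Group H] (f : Multiplicative (ZMod 3) →* H), f e ^ 3 = 1 := fun f => by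
    rw [← map_pow, show e ^ 3 = 1 by decide, map_one]
  obtain ⟨γ, hγ⟩ := FamExt.exists_lift_of_coprime (c := c) h3 (cyclicHom D.g 3 D.g_pow)
  obtain ⟨τ, hτ⟩ := FamExt.exists_lift_of_coprime (c := c) h3 (cyclicHom D.t 3 D.t_pow)
  obtain ⟨s, hs, hsτ⟩ := FamExt.exists_conj h3 τ τ D.s fun k => by
    rw [hτ]
    exact (Commute.cyclicHom_left (show Commute D.t D.s from D.t_s) _ _ _).eq
  have hginv : ∀ k, D.g⁻¹ ^ (k : ℤ) * D.w = D.w * D.g ^ k := fun k =>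
    (SemiconjBy.zpow_right (show SemiconjBy D.w D.g D.g⁻¹ from D.w_g) k).symm
  obtain ⟨w, hw, hwγ⟩ := FamExt.exists_conj h3 (γ.comp (MulEquiv.inv _).toMonoidHom) γ D.w
    fun k => by
      obtain ⟨k, rfl⟩ := cyclicHom_exists k
      rw [hγ, cyclicHom_intCast, ← hginv, MonoidHom.comp_apply, hγ]
      change cyclicHom D.g 3 D.g_pow (_)⁻¹ * _ = _
      rw [map_inv, cyclicHom_intCast, inv_zpow]
  have hge : (γ e).snd = D.g := by rw [hγ, cyclicHom_intCast, zpow_one]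
  have hwg : w * γ e = (γ e)⁻¹ * w := by
    rw [← map_inv]; exact (hwγ e).symm
  refine Red.kill_commute τ _ hτ (x := s ^ 2) (by simp [hs, D.s_pow])
    (fun l => (show Commute (τ l) s from hsτ l).pow_right 2) le_rfl fun V₁ _ _ _ j₁ h₁ => ?_
  let μ₁ := FamExt.map c j₁
  let x := γ e * s * (γ e)⁻¹
  let y := (γ e)⁻¹ * s * γ e
  obtain ⟨n₁, hn₁⟩ := FamExt.exists_eq_ι (x := μ₁ (x * y * (y * x)⁻¹)) (by
    simp only [μ₁, x, y, FamExt.map_snd, FamExt.mul_snd, FamExt.inv_snd, hge, hs]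
    rw [mul_inv_eq_one]
    exact D.s_s)
  refine Red.kill n₁ le_rfl fun V₂ _ _ _ j₂ h₂ => ?_
  let μ₂ := (FamExt.map (c.comap j₁) j₂).comp μ₁
  obtain ⟨n₂, hn₂⟩ := FamExt.exists_eq_ι (x := μ₂ (w * s * (s * w)⁻¹)) (by
    simp only [μ₂, μ₁, MonoidHom.comp_apply, FamExt.map_snd, FamExt.mul_snd, FamExt.inv_snd, hw, hs]
    rw [mul_inv_eq_one]
    exact D.w_s)
  refine Red.kill n₂ le_rfl fun V₃ _ _ _ j₃ h₃ => ?_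
  let μ₃ := (FamExt.map ((c.comap j₁).comap j₂) j₃).comp μ₂
  refine D.red_of_commute h2 hd hi (g := μ₃ (γ e)) (s := μ₃ s) (w := μ₃ w) hge hs hw
    (by rw [← map_pow, he, map_one]) ?_ ?_ ?_ (by rw [← map_mul, hwg, map_mul, map_inv])
  · rw [← map_pow]
    change FamExt.map _ _ (FamExt.map _ _ (FamExt.map _ _ _)) = 1
    rw [h₁, map_one, map_one]
  · have : μ₃ (x * y * (y * x)⁻¹) = 1 := by
      change FamExt.map _ _ (FamExt.map _ _ (μ₁ _)) = 1
      rw [hn₁, FamExt.map_ι, h₂, FamExt.ι_zero, map_one]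
    rw [map_mul, map_inv, mul_inv_eq_one, map_mul, map_mul] at this
    simpa [x, y, Commute, SemiconjBy] using this
  · have : μ₃ (w * s * (s * w)⁻¹) = 1 := by
      change FamExt.map _ _ (μ₂ _) = 1
      rw [hn₂, FamExt.map_ι, h₃, FamExt.ι_zero]
    rw [map_mul, map_inv, mul_inv_eq_one, map_mul, map_mul] at this
    exact this

end SixData

end SmallField

section SixLetters

open Matrix

/-- The action of the generators of the symmetric group on six letters in dimension four. -/
def sixData : SixData (symplecticGroup (Fin 2) (ZMod 2)) where
  s := ⟨fromBlocks !![1, 0; 0, 1] !![1, 1; 1, 1] !![0, 0; 0, 0] !![1, 0; 0, 1], by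
    rw [SymplecticGroup.mem_iff]; decide⟩
  g := ⟨fromBlocks !![0, 1; 1, 1] !![1, 0; 0, 1] !![0, 0; 0, 0] !![1, 1; 1, 0], by
    rw [SymplecticGroup.mem_iff]; decide⟩
  w := ⟨fromBlocks !![0, 1; 1, 0] !![1, 0; 0, 1] !![0, 0; 0, 0] !![0, 1; 1, 0], by
    rw [SymplecticGroup.mem_iff]; decide⟩
  t := ⟨fromBlocks !![0, 1; 0, 1] !![1, 0; 0, 0] !![1, 1; 1, 1] !![1, 0; 0, 1], by
    rw [SymplecticGroup.mem_iff]; decide⟩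
  h := ⟨fromBlocks !![1, 1; 0, 1] !![1, 0; 0, 0] !![1, 0; 1, 0] !![0, 0; 0, 1], by
    rw [SymplecticGroup.mem_iff]; decide⟩
  g_pow := by decide
  t_pow := by decide
  s_pow := by decide
  w_pow := by decide
  t_s := by decide
  w_s := Subtype.ext (by decide)
  w_g := by decide
  h_w := by decide
  s_s := Subtype.ext (by decide)
  w_eq := by decide

theorem sixData_injective : Function.Injective sixData.sylowHom := by
  rw [injective_iff_map_eq_one]
  rintro ⟨⟨⟨a, b⟩, k⟩, l⟩ h
  have key : ∀ a b k l : Multiplicative (ZMod 2),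
      cyclicHom (sixData.g * sixData.s * sixData.g⁻¹) 2 (by decide) a *
        cyclicHom (sixData.g⁻¹ * sixData.s * sixData.g) 2 (by decide) b *
        cyclicHom sixData.w 2 (by decide) k * cyclicHom sixData.s 2 (by decide) l = 1 →
        a = 1 ∧ b = 1 ∧ k = 1 ∧ l = 1 := by
    decide
  obtain ⟨rfl, rfl, rfl, rfl⟩ := key a b k l h
  rfl

variable {K : Type} [Field K] [Fintype K] {F M : Type} [Field F] [AddCommGroup M] [Module F M]
  [FiniteDimensional F M] (ρ : Representation F (symplecticGroup (Fin 2) K) M)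

theorem codim_of_card_eq_two (h2 : (2 : F) = 0) (hq : Fintype.card K = 2) :
    Codim ρ (3 * Module.finrank F M) := by
  obtain ⟨f⟩ : Nonempty (ZMod 2 ≃+* K) := ⟨ZMod.ringEquivOfPrime K Nat.prime_two hq⟩
  let d : symplecticGroup (Fin 2) (ZMod 2) →* symplecticGroup (Fin 2) K :=
    MonoidHom.mk' (fun A => ⟨A.1.map f, SymplecticGroup.map_mem A.2 f⟩) fun A B => by
      apply Subtype.ext
      exact Matrix.map_mul
  have hd : Function.Injective d := fun A B h => by
    apply Subtype.ext
    exact Matrix.map_injective f.injective (congrArg Subtype.val h)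
  have hK : Nat.card K = 2 := by rw [Nat.card_eq_fintype_card, hq]
  refine Codim.of_res d hd ?_ (SixData.codim h2 sixData sixData_injective ?_)
  · refine index_cast_ne_zero d hd (Nat.card (symplecticGroup (Fin 2) (ZMod 2))) 1 dvd_rfl ?_
      (by simp)
    rw [natCard_Sp4, natCard_Sp4, hK, Nat.card_zmod, mul_one]
  · refine index_cast_ne_zero _ sixData_injective 16 45 ?_ ?_ ?_
    · rw [Nat.card_prod, SemidirectProduct.card, Nat.card_prod,
        Nat.card_congr Multiplicative.toAdd, Nat.card_zmod]
    · rw [natCard_Sp4, Nat.card_zmod]; norm_num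
    · rw [show ((45 : ℕ) : F) = 2 * 22 + 1 by norm_num, h2, zero_mul, zero_add]
      exact one_ne_zero

end SixLetters

section Forms

variable {F G M : Type} [Field F] [Group G] [AddCommGroup M] [Module F M]
  {ρ : Representation F G M} {V V' : Type} [AddCommGroup V] [Module F V] [AddCommGroup V']
  [Module F V']

namespace FamExt

/-- The coordinate of an element of the extension, normalised so that it inverts `ι`. -/
def val {c : Fam ρ V} (x : FamExt c) : V →ₗ[F] M := x.fst + c.toFun 1 1

variable {c : Fam ρ V}

@[simp] theorem val_ι (n : V →ₗ[F] M) : (ι c n).val = n := by simp [val, ι]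

theorem ι_val {x : FamExt c} (h : x.snd = 1) : ι c x.val = x := by
  obtain ⟨n, rfl⟩ := exists_eq_ι h
  rw [val_ι]

@[simp] theorem val_one : (1 : FamExt c).val = 0 := by rw [← ι_zero, val_ι]

theorem val_map (j : V' →ₗ[F] V) (x : FamExt c) : (map c j x).val = x.val ∘ₗ j := by
  simp [val, map, LinearMap.add_comp]

/-- The set-theoretic section of the extension. -/
def sec (c : Fam ρ V) (g : G) : FamExt c := ⟨0, g⟩

@[simp] theorem sec_snd (g : G) : (sec c g).snd = g := rfl

theorem map_sec (j : V' →ₗ[F] V) (g : G) : map c j (sec c g) = sec (c.comap j) g := by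
  ext1
  · exact LinearMap.zero_comp j
  · rfl

theorem commute_ι_of_eq_one {x : FamExt c} (h : ρ x.snd = 1) (n : V →ₗ[F] M) :
    Commute x (ι c n) :=
  commute_ι (by rw [h]; rfl)

theorem ι_mul_inj {n n' : V →ₗ[F] M} {x : FamExt c} (h : ι c n * x = ι c n' * x) : n = n' :=
  ι_inj (mul_right_cancel h)

variable {A : Type} [AddCommGroup A]

open Multiplicative (ofAdd)
open scoped commutatorElement

/-- The commutator form on a family of commuting elements acting trivially. -/
def comm (c : Fam ρ V) (j : Multiplicative A →* G) (a b : A) : V →ₗ[F] M :=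
  val ⁅sec c (j (ofAdd a)), sec c (j (ofAdd b))⁆

theorem comm_map (j : Multiplicative A →* G) (i : V' →ₗ[F] V) (a b : A) :
    comm (c.comap i) j a b = comm c j a b ∘ₗ i := by
  rw [comm, comm, ← map_sec, ← map_sec, ← map_commutatorElement, val_map]

variable {j : Multiplicative A →* G}

theorem sec_mul_sec (a b : A) : sec c (j (ofAdd a)) * sec c (j (ofAdd b)) =
    ι c (comm c j a b) * (sec c (j (ofAdd b)) * sec c (j (ofAdd a))) := by
  rw [comm, ι_val, commutatorElement_def]
  · group
  · rw [← proj_apply, map_commutatorElement, commutatorElement_eq_one_iff_commute]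
    exact (Commute.all (ofAdd a) (ofAdd b)).map j

theorem comm_spec (hj : ∀ a, ρ (j a) = 1) {x y : FamExt c} {a b : A} (hx : x.snd = j (ofAdd a))
    (hy : y.snd = j (ofAdd b)) : x * y = ι c (comm c j a b) * (y * x) := by
  obtain ⟨n, rfl⟩ := exists_ι (x := x) (y := sec c (j (ofAdd a))) hx
  obtain ⟨m, rfl⟩ := exists_ι (x := y) (y := sec c (j (ofAdd b))) hy
  have hc : ∀ (a : A) (n : V →ₗ[F] M), sec c (j (ofAdd a)) * ι c n = ι c n * sec c (j (ofAdd a)) :=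
    fun a n => commute_ι_of_eq_one (hj _) n
  have h := sec_mul_sec (c := c) (j := j) a b
  calc _ = ι c n * (sec c (j (ofAdd a)) * ι c m) * sec c (j (ofAdd b)) := by group
    _ = ι c n * ι c m * (sec c (j (ofAdd a)) * sec c (j (ofAdd b))) := by rw [hc]; group
    _ = ι c (n + m + comm c j a b) * (sec c (j (ofAdd b)) * sec c (j (ofAdd a))) := by
      rw [h, ι_add, ι_add]; group
    _ = ι c (comm c j a b + m + n) * (sec c (j (ofAdd b)) * sec c (j (ofAdd a))) := by
      congr 2; abel
    _ = ι c (comm c j a b) * ι c m * (ι c n * sec c (j (ofAdd b))) * sec c (j (ofAdd a)) := by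
      rw [ι_add, ι_add]; group
    _ = _ := by rw [← hc]; group

theorem comm_eq (hj : ∀ a, ρ (j a) = 1) {x y : FamExt c} {a b : A} (hx : x.snd = j (ofAdd a))
    (hy : y.snd = j (ofAdd b)) {n : V →ₗ[F] M} (h : x * y = ι c n * (y * x)) :
    comm c j a b = n :=
  ι_mul_inj ((comm_spec hj hx hy).symm.trans h)

theorem comm_self (a : A) : comm c j a a = 0 := by
  rw [comm, commutatorElement_self, val_one]

theorem comm_swap (a b : A) : comm c j a b = -comm c j b a := by
  have h := sec_mul_sec (c := c) (j := j) a b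
  rw [sec_mul_sec b a, ← mul_assoc, ← ι_add] at h
  rw [eq_neg_iff_add_eq_zero, ← ι_eq_one (c := c)]
  exact (mul_eq_right).1 h.symm

theorem comm_add_left (hj : ∀ a, ρ (j a) = 1) (a a' b : A) :
    comm c j (a + a') b = comm c j a b + comm c j a' b := by
  set x := sec c (j (ofAdd a)) with hx
  set x' := sec c (j (ofAdd a')) with hx'
  set y := sec c (j (ofAdd b)) with hy
  refine comm_eq hj (x := x * x') (y := y) (by simp [hx, hx']) rfl ?_
  rw [mul_assoc, comm_spec hj (x := x') (y := y) rfl rfl, ← mul_assoc,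
    (commute_ι_of_eq_one (x := x) (hj _) _).eq, mul_assoc, ← mul_assoc x,
    comm_spec hj (x := x) (y := y) rfl rfl, add_comm, ι_add]
  group

theorem comm_add_right (hj : ∀ a, ρ (j a) = 1) (a b b' : A) :
    comm c j a (b + b') = comm c j a b + comm c j a b' := by
  rw [comm_swap, comm_add_left hj, neg_add, ← comm_swap, ← comm_swap]

theorem comm_conj (hj : ∀ a, ρ (j a) = 1) {g : G} {a a' b b' : A}
    (ha : g * j (ofAdd a) = j (ofAdd a') * g) (hb : g * j (ofAdd b) = j (ofAdd b') * g) :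
    ρ g ∘ₗ comm c j a b = comm c j a' b' := by
  set z := sec c g with hz
  set x := sec c (j (ofAdd a)) with hx
  set y := sec c (j (ofAdd b)) with hy
  symm
  refine comm_eq hj (x := z * x * z⁻¹) (y := z * y * z⁻¹) ?_ ?_ ?_
  · simp [hz, hx, ha]
  · simp [hz, hy, hb]
  · have h : x * y = _ := comm_spec hj (x := x) (y := y) rfl rfl
    have h' := mul_ι z (comm c j a b)
    calc z * x * z⁻¹ * (z * y * z⁻¹) = z * (x * y) * z⁻¹ := by group
      _ = (z * ι c (comm c j a b)) * (y * x) * z⁻¹ := by rw [h]; group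
      _ = _ := by rw [h']; group; rfl

/-- The power form on a family of elements of order `p` acting trivially. -/
def pow (c : Fam ρ V) (j : Multiplicative A →* G) (p : ℕ) (a : A) : V →ₗ[F] M :=
  val (sec c (j (ofAdd a)) ^ p)

theorem pow_map (j : Multiplicative A →* G) (p : ℕ) (i : V' →ₗ[F] V) (a : A) :
    pow (c.comap i) j p a = pow c j p a ∘ₗ i := by
  rw [pow, pow, ← map_sec, ← map_pow, val_map]

variable {p : ℕ}

theorem pow_spec [CharP F p] (hj : ∀ a, ρ (j a) = 1) (hA : ∀ a : A, p • a = 0) {x : FamExt c}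
    {a : A} (hx : x.snd = j (ofAdd a)) : x ^ p = ι c (pow c j p a) := by
  obtain ⟨n, rfl⟩ := exists_ι (x := x) (y := sec c (j (ofAdd a))) hx
  have hp : p • n = 0 := by rw [← Nat.cast_smul_eq_nsmul F, CharP.cast_eq_zero, zero_smul]
  rw [((commute_ι_of_eq_one (x := sec c (j (ofAdd a))) (hj _) n).symm).mul_pow, ← ι_nsmul, hp,
    ι_zero, one_mul, pow, ι_val]
  rw [pow_snd, sec_snd, ← map_pow, ← ofAdd_nsmul, hA, ofAdd_zero, map_one]

theorem pow_eq [CharP F p] (hj : ∀ a, ρ (j a) = 1) (hA : ∀ a : A, p • a = 0) {x : FamExt c} {a : A}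
    (hx : x.snd = j (ofAdd a)) {n : V →ₗ[F] M} (h : x ^ p = ι c n) : pow c j p a = n :=
  ι_inj ((pow_spec hj hA hx).symm.trans h)

theorem commute_of_comm_eq_zero (hj : ∀ a, ρ (j a) = 1) {a b : A} (h : comm c j a b = 0)
    {x y : FamExt c} (hx : x.snd = j (ofAdd a)) (hy : y.snd = j (ofAdd b)) : Commute x y := by
  have := comm_spec hj hx hy
  rwa [h, ι_zero, one_mul] at this

theorem pow_add' [CharP F p] (hj : ∀ a, ρ (j a) = 1) (hA : ∀ a : A, p • a = 0) {a b : A}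
    (h : comm c j a b = 0) : pow c j p (a + b) = pow c j p a + pow c j p b := by
  set x := sec c (j (ofAdd a)) with hx
  set y := sec c (j (ofAdd b)) with hy
  refine pow_eq hj hA (x := x * y) (by simp [hx, hy]) ?_
  rw [(commute_of_comm_eq_zero hj h rfl rfl : Commute x y).mul_pow, pow_spec hj hA (x := x) rfl,
    pow_spec hj hA (x := y) rfl, ι_add]

theorem pow_conj [CharP F p] (hj : ∀ a, ρ (j a) = 1) (hA : ∀ a : A, p • a = 0) {g : G} {a a' : A}
    (ha : g * j (ofAdd a) = j (ofAdd a') * g) : ρ g ∘ₗ pow c j p a = pow c j p a' := by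
  set z := sec c g with hz
  set x := sec c (j (ofAdd a)) with hx
  symm
  refine pow_eq hj hA (x := z * x * z⁻¹) (by simp [hz, hx, ha]) ?_
  rw [conj_pow, pow_spec hj hA (x := x) rfl, conj_ι]
  rfl

theorem exists_hom_lift [Fact p.Prime] [CharP F p] (hj : ∀ a, ρ (j a) = 1) (hA : ∀ a : A, p • a = 0)
    (hc : ∀ a b, comm c j a b = 0) (hp : ∀ a, pow c j p a = 0) :
    ∃ σ : Multiplicative A →* FamExt c, ∀ a, (σ a).snd = j a := by
  let S : Subgroup (FamExt c × Multiplicative A) :=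
    ((proj c).comp (MonoidHom.fst _ _)).eqLocus (j.comp (MonoidHom.snd _ _))
  have hS : ∀ x : S, x.1.1.snd = j x.1.2 := fun x => x.2
  let : CommGroup S := { (inferInstance : Group S) with
    mul_comm := fun x y => Subtype.ext (Prod.ext
      (commute_of_comm_eq_zero hj (hc x.1.2.toAdd y.1.2.toAdd) (hS x) (hS y)).eq
      (mul_comm x.1.2 y.1.2)) }
  have : Module (ZMod p) A := AddCommGroup.zmodModule hA
  have : Module (ZMod p) (Additive S) := AddCommGroup.zmodModule (n := p) (fun x => by
    change x.toMul ^ p = 1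
    refine Subtype.ext (Prod.ext ?_ ?_)
    · change x.toMul.1.1 ^ p = 1
      rw [pow_spec hj hA (a := x.toMul.1.2.toAdd) (hS _), hp, ι_zero]
    · exact hA x.toMul.1.2.toAdd)
  let f : Additive S →+ A :=
    { toFun := fun x => x.toMul.1.2.toAdd
      map_zero' := rfl
      map_add' := fun _ _ => rfl }
  let f' : Additive S →ₗ[ZMod p] A := f.toZModLinearMap p
  obtain ⟨s, hs⟩ := LinearMap.exists_rightInverse_of_surjective f'
    (LinearMap.range_eq_top.2 fun a => ⟨Additive.ofMul ⟨(sec c (j (ofAdd a)), ofAdd a), rfl⟩, rfl⟩)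
  refine ⟨MonoidHom.mk' (fun a => (s a.toAdd).toMul.1.1) fun a b => ?_, fun a => ?_⟩
  · have := s.map_add a.toAdd b.toAdd
    exact congrArg (fun z : Additive S => z.toMul.1.1) this
  · refine (hS _).trans ?_
    have := congrArg (fun g => g a.toAdd) hs
    exact congrArg (fun a => j (ofAdd a)) this

end FamExt

theorem Red.kill_if [FiniteDimensional F V] [FiniteDimensional F M] {c : Fam ρ V} (C : Prop)
    [Decidable C] (n : V →ₗ[F] M) (h0 : ¬ C → n = 0) {l : ℕ}
    (h : ∀ (V' : Type) [AddCommGroup V'] [Module F V'] [FiniteDimensional F V'] (j : V' →ₗ[F] V),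
      n ∘ₗ j = 0 → Red (c.comap j) l) : Red c ((if C then Module.finrank F M else 0) + l) := by
  split_ifs with hC
  · exact Red.kill n le_rfl h
  · exact Red.of_comap LinearMap.id Function.injective_id (by simp) (h _ _ (by simp [h0 hC]))

end Forms

/-- Biadditive maps. -/
structure BiAdd {A B N : Type} [AddCommGroup A] [AddCommGroup B] [AddCommGroup N]
    (φ : A → B → N) : Prop where
  add_left : ∀ x x' y, φ (x + x') y = φ x y + φ x' y
  add_right : ∀ x y y', φ x (y + y') = φ x y + φ x y'

namespace BiAdd

variable {A B N : Type} [AddCommGroup A] [AddCommGroup B] [AddCommGroup N] {φ : A → B → N}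

theorem flip (h : BiAdd φ) : BiAdd fun y x => φ x y :=
  ⟨fun y y' x => h.add_right x y y', fun y x x' => h.add_left x x' y⟩

theorem zero_left (h : BiAdd φ) (y : B) : φ 0 y = 0 :=
  (AddMonoidHom.mk' (φ · y) fun a b => h.add_left a b y).map_zero
theorem zero_right (h : BiAdd φ) (x : A) : φ x 0 = 0 := h.flip.zero_left x
theorem neg_left (h : BiAdd φ) (x : A) (y : B) : φ (-x) y = -φ x y :=
  (AddMonoidHom.mk' (φ · y) fun a b => h.add_left a b y).map_neg x
theorem neg_right (h : BiAdd φ) (x : A) (y : B) : φ x (-y) = -φ x y := h.flip.neg_left y x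
theorem sub_right (h : BiAdd φ) (x : A) (y y' : B) : φ x (y - y') = φ x y - φ x y' := by
  rw [sub_eq_add_neg, h.add_right, h.neg_right, sub_eq_add_neg]

theorem comp {A' B' : Type} [AddCommGroup A'] [AddCommGroup B'] (h : BiAdd φ) (f : A' →+ A)
    (g : B' →+ B) : BiAdd fun x y => φ (f x) (g y) :=
  ⟨fun x x' y => by simp [h.add_left], fun x y y' => by simp [h.add_right]⟩

theorem swap {φ : A → A → N} (h : BiAdd φ) (ha : ∀ x, φ x x = 0) (x y : A) :
    φ x y = -φ y x := by
  have := ha (x + y)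
  rw [h.add_left, h.add_right, h.add_right, ha, ha, zero_add, add_zero] at this
  exact eq_neg_of_add_eq_zero_left this

end BiAdd

theorem exists_eq_sq_or {K : Type} [Field K] {ζ : Kˣ} (hζ : ∀ x, x ∈ Subgroup.zpowers ζ) (x : Kˣ) :
    ∃ u : Kˣ, x = u ^ 2 ∨ x = ζ * u ^ 2 := by
  obtain ⟨n, rfl⟩ := hζ x
  obtain ⟨k, rfl | rfl⟩ := Int.even_or_odd' n
  · exact ⟨ζ ^ k, Or.inl (by rw [← zpow_natCast, ← zpow_mul, mul_comm]; rfl)⟩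
  · exact ⟨ζ ^ k, Or.inr (by
      rw [← zpow_natCast, ← zpow_mul, mul_comm k, add_comm]; exact zpow_one_add _ _)⟩

section FieldLemmas

variable {K N : Type} [Field K] [Fintype K] [AddCommGroup N]

theorem exists_ne_ne (hq : Fintype.card K ≠ 2) (a b : K) : ∃ u : K, u ≠ a ∧ u ≠ b := by
  classical
  by_contra! h
  have h1 : (Finset.univ : Finset K) ⊆ {a, b} := fun u _ => by
    by_cases hu : u = a
    · simp [hu]
    · simp [h u hu]
  have h2 := (Finset.card_le_card h1).trans (Finset.card_le_two)
  have h3 := Fintype.one_lt_card (α := K)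
  rw [Finset.card_univ] at h2
  omega

theorem exists_add_ne_zero (hq : Fintype.card K ≠ 2) :
    ∃ u v : K, u ≠ 0 ∧ v ≠ 0 ∧ u + v ≠ 0 := by
  obtain ⟨u, h0, h1⟩ := exists_ne_ne hq (0 : K) (-1)
  exact ⟨u, 1, h0, one_ne_zero, fun h => h1 (eq_neg_of_add_eq_zero_left h)⟩

/-- An additive map which is constant on nonzero elements vanishes. -/
theorem eq_zero_of_const (hq : Fintype.card K ≠ 2) {g : K → N} (hg : ∀ x y, g (x + y) = g x + g y)
    (h : ∀ x, x ≠ 0 → ∀ u, u ≠ 0 → g (u * x) = g x) (x : K) : g x = 0 := by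
  have h0 : g 0 = 0 := (AddMonoidHom.mk' g hg).map_zero
  obtain rfl | hx := eq_or_ne x 0
  · exact h0
  obtain ⟨u, v, hu, hv, huv⟩ := exists_add_ne_zero hq
  have := hg (u * x) (v * x)
  rw [← add_mul, h x hx _ hu, h x hx _ hv, h x hx _ huv] at this
  exact left_eq_add.1 this

theorem eq_zero_of_mul_add_sq_mul (hq : Fintype.card K ≠ 2) {g g' : K → N}
    (hg' : ∀ x y, g' (x + y) = g' x + g' y)
    (h : ∀ s t, g (s * t) + g' (s ^ 2 * t) = 0) : (∀ x, g x = 0) ∧ ∀ x, g' x = 0 := by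
  have key : ∀ x s, s ≠ 0 → g' (s * x) = -g x := fun x s hs => by
    have := h s (s⁻¹ * x)
    rw [mul_inv_cancel_left₀ hs, sq, mul_assoc, mul_inv_cancel_left₀ hs] at this
    exact eq_neg_of_add_eq_zero_right this
  have h1 : ∀ x, g' x = 0 := eq_zero_of_const hq hg' fun x hx u hu => by
    rw [key x u hu, ← key x 1 one_ne_zero, one_mul]
  refine ⟨fun x => ?_, h1⟩
  have := key x 1 one_ne_zero
  rw [h1] at this
  exact neg_eq_zero.1 this.symm

/-- An additive map vanishing on nonzero squares vanishes. -/
theorem eq_zero_of_sq {g : K → N} (hg : ∀ x y, g (x + y) = g x + g y)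
    (h : ∀ u : Kˣ, g ((u : K) ^ 2) = 0) (x : K) : g x = 0 := by
  have h0 : g 0 = 0 := (AddMonoidHom.mk' g hg).map_zero
  have h' : ∀ x, g (x ^ 2) = 0 := fun x => by
    obtain rfl | hx := eq_or_ne x 0
    · simpa using h0
    · exact h (Units.mk0 x hx)
  by_cases h2 : (2 : K) = 0
  · have hK : CharP K 2 := CharTwo.of_one_ne_zero_of_two_eq_zero one_ne_zero h2
    obtain ⟨y, rfl⟩ := FiniteField.isSquare_of_char_two (ringChar.eq K 2) x
    rw [← sq]; exact h' y
  · have h3 : (4 : K) ≠ 0 := by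
      rw [show (4 : K) = 2 * 2 by norm_num]; exact mul_ne_zero h2 h2
    have e : ((x + 1) / 2) ^ 2 = x + ((x - 1) / 2) ^ 2 := by field_simp; ring
    have := h' ((x + 1) / 2)
    rwa [e, hg, h', add_zero] at this

/-- An alternating form which is additive on the graph of a generator vanishes. -/
theorem BiAdd.eq_zero_of_graph {ζ : Kˣ} (hζ : ∀ x, x ∈ Subgroup.zpowers ζ) {φ : K → K → N}
    (hφ : BiAdd φ) (ha : ∀ x, φ x x = 0)
    (h : ∀ x y, φ (x + y) (ζ * (x + y)) = φ x (ζ * x) + φ y (ζ * y)) (x y : K) : φ x y = 0 := by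
  have h1 : ∀ x y, φ x (ζ * y) = φ (ζ * x) y := fun x y => by
    have := h x y
    rw [mul_add, hφ.add_left, hφ.add_right, hφ.add_right] at this
    have h2 : φ x (ζ * y) + φ y (ζ * x) = 0 := by
      have h3 := sub_eq_zero.2 this
      rw [← h3]; abel
    rw [hφ.swap ha (ζ * x) y]
    exact eq_neg_of_add_eq_zero_left h2
  have h2 : ∀ w : Kˣ, ∀ x y, φ x (w * y) = φ (w * x) y := fun w => by
    obtain ⟨n, rfl⟩ := mem_powers_iff_mem_zpowers.2 (hζ w)
    induction n with
    | zero => simp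
    | succ n ih =>
      intro x y
      have := ih x (ζ * y)
      simp only [Units.val_pow_eq_pow_val] at this ih ⊢
      rw [pow_succ, mul_assoc, this, h1, mul_left_comm, mul_assoc, mul_left_comm]
  have h3 : ∀ x y, φ x y = φ 1 (x * y) := fun x y => by
    obtain rfl | hx := eq_or_ne x 0
    · rw [hφ.zero_left, zero_mul, hφ.zero_right]
    · simpa using (h2 (Units.mk0 x hx) 1 y).symm
  rw [h3]
  exact eq_zero_of_sq (g := φ 1) (hφ.add_right 1) (fun u => by rw [sq, ← h3]; exact ha _) _

/-- A biadditive map invariant under simultaneous dilations vanishes. -/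
theorem BiAdd.eq_zero_of_invariant (hq : 3 < Fintype.card K) (h2 : (2 : K) ≠ 0) {φ : K → K → N}
    (hφ : BiAdd φ) (h : ∀ (u : Kˣ) x y, φ (u * x) (u * y) = φ x y) (x y : K) : φ x y = 0 := by
  have h3 : ∀ (u : K) y, u ≠ 0 → φ u y = φ 1 (u⁻¹ * y) := fun u y hu => by
    have := h (Units.mk0 u hu) 1 (u⁻¹ * y)
    simpa [hu] using this
  obtain ⟨u, hu, hu1, hu2⟩ : ∃ u : K, u ≠ 0 ∧ u + 1 ≠ 0 ∧ u ^ 2 + u + 1 ≠ 0 := by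
    by_cases h3 : (3 : K) = 0
    · classical
      obtain ⟨u, hu⟩ : ∃ u : K, u ∉ ({0, 1, -1} : Finset K) := by
        by_contra! hc
        have := (Finset.card_le_card (fun u _ => hc u : (Finset.univ : Finset K) ⊆ _)).trans
          Finset.card_le_three
        rw [Finset.card_univ] at this; omega
      simp only [Finset.mem_insert, Finset.mem_singleton, not_or] at hu
      refine ⟨u, hu.1, fun h => hu.2.2 (eq_neg_of_add_eq_zero_left h), fun h => hu.2.1 ?_⟩
      have : (u - 1) ^ 2 = 0 := by linear_combination h - u * h3
      exact sub_eq_zero.1 (pow_eq_zero_iff two_ne_zero |>.1 this)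
    · exact ⟨1, one_ne_zero, by norm_num; exact h2, by norm_num; exact h3⟩
  have h4 : ∀ y, φ 1 y = 0 := fun y => by
    obtain ⟨r, hr⟩ : ∃ r, (u ^ 2 + u + 1) * r = 1 := ⟨_, mul_inv_cancel₀ hu2⟩
    have h5 := hφ.add_left u 1 (u * (u + 1) * r * y)
    rw [h3 _ _ hu1, h3 _ _ hu, ← sub_eq_zero, ← neg_eq_zero, neg_sub, ← hφ.add_right,
      ← hφ.sub_right] at h5
    rw [← h5]
    congr 1
    field_simp
    linear_combination (-y) * hr
  obtain rfl | hx := eq_or_ne x 0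
  · exact hφ.zero_left y
  · rw [h3 x y hx, h4]

theorem BiAdd.eq_zero_of_card_eq_three (hq : Fintype.card K = 3) {φ : K → K → N}
    (hφ : BiAdd φ) (ha : ∀ x, φ x x = 0) (x y : K) : φ x y = 0 := by
  obtain rfl | hx := eq_or_ne x 0
  · exact hφ.zero_left y
  obtain rfl | hy := eq_or_ne y 0
  · exact hφ.zero_right x
  have h1 := FiniteField.pow_card_sub_one_eq_one (y / x) (div_ne_zero hy hx)
  rw [hq] at h1
  rcases sq_eq_sq_iff_eq_or_eq_neg.1 (h1.trans (one_pow 2).symm) with h | h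
  · rw [div_eq_one_iff_eq hx] at h; rw [h, ha]
  · rw [div_eq_iff hx, neg_one_mul] at h; rw [h, hφ.neg_right, ha, neg_zero]

end FieldLemmas

section Coordinates

variable {K : Type} [Field K]

/-- The action of a root element on symmetric matrices, in coordinates. -/
def shear (s : K) (v : K × K × K) : K × K × K :=
  (v.1, v.2.1 + s * v.1, v.2.2 + 2 * s * v.2.1 + s ^ 2 * v.1)

/-- The action of a diagonal element on symmetric matrices, in coordinates. -/
def tor (u : Kˣ × Kˣ) (v : K × K × K) : K × K × K :=
  (u.2 ^ 2 * v.1, u.1 * u.2 * v.2.1, u.1 ^ 2 * v.2.2)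

/-- The action of a diagonal element on the short root. -/
def torRoot (u : Kˣ × Kˣ) (s : K) : K := u.1 * (u.2 : K)⁻¹ * s

variable (K) in
/-- First coordinate vector. -/
def vb : K →+ K × K × K := AddMonoidHom.inl K (K × K)
variable (K) in
/-- Second coordinate vector. -/
def vm : K →+ K × K × K := (AddMonoidHom.inr K (K × K)).comp (AddMonoidHom.inl K K)
variable (K) in
/-- Third coordinate vector. -/
def vd : K →+ K × K × K := (AddMonoidHom.inr K (K × K)).comp (AddMonoidHom.inr K K)

theorem eq_vb_add_vm_add_vd (v : K × K × K) : v = vb K v.1 + vm K v.2.1 + vd K v.2.2 := by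
  simp [vb, vm, vd]

theorem shear_vb (s t : K) : shear s (vb K t) = vb K t + vm K (s * t) + vd K (s ^ 2 * t) := by
  simp [vb, vm, vd, shear]
theorem shear_vm (s y : K) : shear s (vm K y) = vm K y + vd K (2 * s * y) := by
  simp [vm, vd, shear]
theorem shear_vd (s z : K) : shear s (vd K z) = vd K z := by simp [vd, shear]
theorem tor_vb (u : Kˣ × Kˣ) (t : K) : tor u (vb K t) = vb K (u.2 ^ 2 * t) := by simp [vb, tor]
theorem tor_vm (u : Kˣ × Kˣ) (y : K) : tor u (vm K y) = vm K (u.1 * u.2 * y) := by simp [vm, tor]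
theorem tor_vd (u : Kˣ × Kˣ) (z : K) : tor u (vd K z) = vd K (u.1 ^ 2 * z) := by simp [vd, tor]

theorem BiAdd.eq_zero_of_coord {N : Type} [AddCommGroup N] {B : K × K × K → K × K × K → N}
    (h : BiAdd B) (ha : ∀ v, B v v = 0)
    (hbb : ∀ x y, B (vb K x) (vb K y) = 0) (hbm : ∀ x y, B (vb K x) (vm K y) = 0)
    (hbd : ∀ x y, B (vb K x) (vd K y) = 0) (hmm : ∀ x y, B (vm K x) (vm K y) = 0)
    (hmd : ∀ x y, B (vm K x) (vd K y) = 0) (hdd : ∀ x y, B (vd K x) (vd K y) = 0)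
    (v w : K × K × K) : B v w = 0 := by
  rw [eq_vb_add_vm_add_vd v, eq_vb_add_vm_add_vd w]
  simp only [h.add_left, h.add_right]
  rw [h.swap ha (vm K _) (vb K _), h.swap ha (vd K _) (vb K _), h.swap ha (vd K _) (vm K _)]
  simp only [hbb, hbm, hbd, hmm, hmd, hdd, neg_zero, add_zero]

end Coordinates

section Equivariant

variable {K : Type} [Field K] {R N : Type} [CommRing R] [AddCommGroup N] [Module R N]

/-- Equivariant alternating forms on symmetric matrices. -/
structure QForm (χ : Kˣ × Kˣ →* R) (B : K × K × K → K × K × K → N) : Prop where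
  biAdd : BiAdd B
  alt : ∀ v, B v v = 0
  shear : ∀ s v w, B (shear s v) (shear s w) = B v w
  tor : ∀ u v w, B (tor u v) (tor u w) = χ u • B v w

/-- Equivariant additive maps on symmetric matrices. -/
structure QPow (χ : Kˣ × Kˣ →* R) (P : K × K × K → N) : Prop where
  add : ∀ v w, P (v + w) = P v + P w
  shear : ∀ s v, P (shear s v) = P v
  tor : ∀ u v, P (tor u v) = χ u • P v

/-- Equivariant alternating forms on the short root group. -/
structure LForm (χ : Kˣ × Kˣ →* R) (φ : K → K → N) : Prop where
  biAdd : BiAdd φ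
  alt : ∀ v, φ v v = 0
  tor : ∀ u x y, φ (torRoot u x) (torRoot u y) = χ u • φ x y

/-- Equivariant additive maps on the short root group. -/
structure LPow (χ : Kˣ × Kˣ →* R) (P : K → N) : Prop where
  add : ∀ v w, P (v + w) = P v + P w
  tor : ∀ u x, P (torRoot u x) = χ u • P x

/-- Equivariant cocycles of the short root group with values in additive maps. -/
structure Coc (χ : Kˣ × Kˣ →* R) (f : K → K × K × K → N) : Prop where
  add : ∀ s v w, f s (v + w) = f s v + f s w
  coc : ∀ s s' v, f (s + s') v = f s' v + f s (shear s' v)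
  tor : ∀ u s v, f (torRoot u s) (tor u v) = χ u • f s v

variable {χ : Kˣ × Kˣ →* R} {B : K × K × K → K × K × K → N} {P : K × K × K → N}
  {φ : K → K → N} {L : K → N} {f : K → K × K × K → N}

variable [Fintype K]

namespace QForm

theorem md_dd (h : QForm χ B) (hq : Fintype.card K ≠ 2) :
    (∀ x y, B (vm K x) (vd K y) = 0) ∧ ∀ x y, B (vd K x) (vd K y) = 0 := by
  have key := fun y => eq_zero_of_mul_add_sq_mul hq (g := fun x => B (vm K x) (vd K y))
    (g' := fun x => B (vd K x) (vd K y)) (fun a b => by simp [h.biAdd.add_left]) (fun s t => by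
      have := h.shear s (vb K t) (vd K y)
      rwa [shear_vb, shear_vd, h.biAdd.add_left, h.biAdd.add_left, add_assoc, add_eq_left] at this)
  exact ⟨fun x y => (key y).1 x, fun x y => (key y).2 x⟩

theorem mm_of_two_eq_zero (h : QForm χ B) (hq : Fintype.card K ≠ 2) (h2 : (2 : K) = 0) (x y : K) :
    B (vm K x) (vm K y) = 0 :=
  (eq_zero_of_mul_add_sq_mul hq (g := fun x => B (vm K x) (vm K y))
    (g' := fun x => B (vd K x) (vm K y)) (fun a b => by simp [h.biAdd.add_left]) (fun s t => by
      have := h.shear s (vb K t) (vm K y)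
      rwa [shear_vb, shear_vm, h2, zero_mul, zero_mul, map_zero, add_zero, h.biAdd.add_left,
        h.biAdd.add_left, add_assoc, add_eq_left] at this)).1 x

theorem eq_zero_even (h : QForm χ B) (hq : Fintype.card K ≠ 2) (h2 : (2 : K) = 0)
    {ζ : Kˣ} (hζ : ∀ x, x ∈ Subgroup.zpowers ζ)
    (k1 : B (vb K 1) (vb K ζ) = 0) (k2 : B (vb K 1) (vm K 1) = 0)
    (k3 : B (vb K 1) (vd K 1) = 0) (v w : K × K × K) : B v w = 0 := by
  have := CharTwo.of_one_ne_zero_of_two_eq_zero (one_ne_zero (α := K)) h2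
  have hsq : ∀ x : K, x ≠ 0 → ∃ u : Kˣ, (u : K) ^ 2 = x := fun x hx => by
    obtain ⟨y, rfl⟩ := FiniteField.isSquare_of_char_two (ringChar.eq K 2) x
    exact ⟨Units.mk0 y (fun hy => hx (by simp [hy])), sq y⟩
  refine h.biAdd.eq_zero_of_coord h.alt ?_ (fun x y => ?_) (fun x y => ?_)
    (h.mm_of_two_eq_zero hq h2) (h.md_dd hq).1 (h.md_dd hq).2 v w
  · have hz : ∀ x : K, B (vb K x) (vb K (ζ * x)) = 0 := fun x => by
      obtain rfl | hx := eq_or_ne x 0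
      · simpa using h.biAdd.zero_left _
      obtain ⟨u, rfl⟩ := hsq x hx
      have t1 := h.tor (1, u) (vb K 1) (vb K ζ)
      simp only [tor_vb, k1, smul_zero] at t1
      rw [← t1]
      congr 2 <;> ring
    exact BiAdd.eq_zero_of_graph hζ (h.biAdd.comp (vb K) (vb K)) (fun x => h.alt _)
      (fun x y => by simp only [hz, add_zero])
  · obtain rfl | hx := eq_or_ne x 0
    · simpa using h.biAdd.zero_left _
    obtain rfl | hy := eq_or_ne y 0
    · simpa using h.biAdd.zero_right _
    obtain ⟨u, rfl⟩ := hsq x hx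
    have t := h.tor (Units.mk0 (y / u) (div_ne_zero hy u.ne_zero), u) (vb K 1) (vm K 1)
    rw [k2, tor_vb, tor_vm] at t
    simpa using t
  · obtain rfl | hx := eq_or_ne x 0
    · simpa using h.biAdd.zero_left _
    obtain rfl | hy := eq_or_ne y 0
    · simpa using h.biAdd.zero_right _
    obtain ⟨u, rfl⟩ := hsq x hx
    obtain ⟨u', rfl⟩ := hsq y hy
    have t := h.tor (u', u) (vb K 1) (vd K 1)
    rw [k3, tor_vb, tor_vd] at t
    simpa using t

variable [IsDomain R] [Module.IsTorsionFree R N]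

theorem mm_bd (h : QForm χ B) (hq : Fintype.card K ≠ 2) (h2 : (2 : K) ≠ 0) (h2' : (2 : R) ≠ 0) :
    (∀ x y, B (vm K x) (vm K y) = 0) ∧ ∀ x y, B (vb K x) (vd K y) = 0 := by
  have h1 : ∀ s t y, B (vm K (s * t)) (vm K y) = -B (vb K t) (vd K (2 * s * y)) := fun s t y => by
    have := h.shear s (vb K t) (vm K y)
    simp only [shear_vb, shear_vm, h.biAdd.add_left, h.biAdd.add_right, (h.md_dd hq).1,
      (h.md_dd hq).2, h.biAdd.swap h.alt (vd K (s ^ 2 * t)) (vm K y)] at this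
    rw [eq_neg_iff_add_eq_zero]
    have h3 := sub_eq_zero.2 this
    rw [← h3]; abel
  have hs : ∀ t y, B (vm K t) (vm K y) = B (vm K 1) (vm K (t * y)) := fun t y => by
    have a := h1 t 1 y
    have b := h1 1 1 (t * y)
    rw [mul_one] at a b
    rw [a, b, show 2 * t * y = 2 * 1 * (t * y) by ring]
  have hmm : ∀ x y, B (vm K x) (vm K y) = 0 := fun x y => by
    have h3 := h.biAdd.swap h.alt (vm K x) (vm K y)
    rw [hs y x, mul_comm, ← hs x y, eq_neg_iff_add_eq_zero, ← two_smul R, smul_eq_zero] at h3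
    exact h3.resolve_left h2'
  refine ⟨hmm, fun x y => ?_⟩
  have h4 := h1 1 x (y / 2)
  rw [hmm, mul_one, mul_div_cancel₀ _ h2] at h4
  exact neg_eq_zero.1 h4.symm

/-- In odd characteristic, an equivariant form is determined by three values. -/
theorem eq_zero_odd (h : QForm χ B) (hq : Fintype.card K ≠ 2) (h2 : (2 : K) ≠ 0)
    (h2' : (2 : R) ≠ 0) {ζ : Kˣ} (hζ : ∀ x, x ∈ Subgroup.zpowers ζ)
    (k1 : B (vb K 1) (vb K ζ) = 0) (k2 : B (vb K ζ) (vb K (ζ * ζ)) = 0)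
    (k3 : B (vb K 1) (vm K 1) = 0) (v w : K × K × K) : B v w = 0 := by
  obtain ⟨hmm, hbd⟩ := h.mm_bd hq h2 h2'
  have hbb : ∀ x y, B (vb K x) (vb K y) = 0 := by
    have hz : ∀ x : K, B (vb K x) (vb K (ζ * x)) = 0 := fun x => by
      obtain rfl | hx := eq_or_ne x 0
      · simpa using h.biAdd.zero_left _
      obtain ⟨u, hu⟩ := exists_eq_sq_or hζ (Units.mk0 x hx)
      have t1 := h.tor (1, u) (vb K 1) (vb K ζ)
      have t2 := h.tor (1, u) (vb K ζ) (vb K (ζ * ζ))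
      simp only [tor_vb, k1, k2, smul_zero] at t1 t2
      rcases hu with hu | hu
      · rw [show x = (u : K) ^ 2 from congrArg Units.val hu, ← t1]
        congr 2 <;> ring
      · rw [show x = ζ * (u : K) ^ 2 from congrArg Units.val hu, ← t2]
        congr 2 <;> ring
    exact BiAdd.eq_zero_of_graph hζ (h.biAdd.comp (vb K) (vb K)) (fun x => h.alt _)
      (fun x y => by simp only [hz, add_zero])
  refine h.biAdd.eq_zero_of_coord h.alt hbb (fun x y => ?_) hbd hmm (h.md_dd hq).1
    (h.md_dd hq).2 v w
  have h1 : ∀ y, B (vb K 1) (vm K y) = 0 := fun y => by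
    obtain rfl | hy := eq_or_ne y 0
    · simpa using h.biAdd.zero_right _
    have t := h.tor (Units.mk0 y hy, 1) (vb K 1) (vm K 1)
    rw [k3] at t
    simpa [tor_vb, tor_vm] using t
  have := h.shear y (vb K x) (vb K 1)
  simp only [shear_vb, h.biAdd.add_left, h.biAdd.add_right, (h.md_dd hq).1, hmm, hbd, hbb,
    (h.md_dd hq).2, h.biAdd.swap h.alt (vd K _) (vb K _), h.biAdd.swap h.alt (vd K _) (vm K _),
    h.biAdd.swap h.alt (vm K _) (vb K _), mul_one, h1] at this
  simpa using this

end QForm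

end Equivariant

section Vanishing

variable {K : Type} [Field K] {R N : Type} [CommRing R] [AddCommGroup N] [Module R N]

/-- The restriction of a character along `i` is additive. -/
def AddChar' (χ : Kˣ × Kˣ →* R) (i : Kˣ → Kˣ × Kˣ) : Prop :=
  ∀ u v w : Kˣ, (w : K) = u + v → χ (i w) = χ (i u) + χ (i v)

variable {χ : Kˣ × Kˣ →* R} {B : K × K × K → K × K × K → N} {P : K × K × K → N}
  {φ : K → K → N} {L : K → N} {f : K → K × K × K → N}

theorem smul_eq_self_imp [IsDomain R] [Module.IsTorsionFree R N] {r : R} {n : N} (h : r • n = n)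
    (hr : r ≠ 1) : n = 0 := by
  rw [← sub_eq_zero] at h
  nth_rw 2 [← one_smul R n] at h
  rw [← sub_smul, smul_eq_zero, sub_eq_zero] at h
  exact h.resolve_left hr

theorem smul_eq_neg_imp [IsDomain R] [Module.IsTorsionFree R N] {r : R} {n : N} (h : r • n = -n)
    (hr : r ≠ -1) : n = 0 := by
  rw [eq_neg_iff_add_eq_zero] at h
  nth_rw 2 [← one_smul R n] at h
  rw [← add_smul, smul_eq_zero, ← eq_neg_iff_add_eq_zero] at h
  exact h.resolve_left hr

theorem exists_sq_eq [Fintype K] (h2 : (2 : K) = 0) {x : K} (hx : x ≠ 0) :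
    ∃ u : Kˣ, (u : K) ^ 2 = x := by
  have := CharTwo.of_one_ne_zero_of_two_eq_zero (one_ne_zero (α := K)) h2
  obtain ⟨y, rfl⟩ := FiniteField.isSquare_of_char_two (ringChar.eq K 2) x
  exact ⟨Units.mk0 y (fun hy => hx (by simp [hy])), sq y⟩

/-- A vector-valued function transforming by an additive character is additive. -/
theorem add_of_addChar {i : Kˣ → Kˣ × Kˣ} (h2 : (2 : K) = 0) (h2' : (2 : R) = 0)
    (hχ : AddChar' χ i) {g : K → N} (h0 : g 0 = 0)
    (hg : ∀ u : Kˣ, g u = χ (i u) • g 1) (x y : K) : g (x + y) = g x + g y := by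
  have := CharTwo.of_one_ne_zero_of_two_eq_zero (one_ne_zero (α := K)) h2
  obtain rfl | hx := eq_or_ne x 0
  · simp [h0]
  obtain rfl | hy := eq_or_ne y 0
  · simp [h0]
  obtain hxy | hxy := eq_or_ne (x + y) 0
  · rw [hxy, h0, CharTwo.add_eq_zero.1 hxy, ← two_smul R, h2', zero_smul]
  have e := hg (Units.mk0 _ hxy)
  rw [hχ (Units.mk0 x hx) (Units.mk0 y hy) _ rfl, add_smul, ← hg, ← hg] at e
  exact e

theorem eq_zero_of_not_addChar [IsDomain R] [Module.IsTorsionFree R N] {i : Kˣ → Kˣ × Kˣ}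
    (hχ : ¬ AddChar' χ i) {n : N}
    (h : ∀ u v w : Kˣ, (w : K) = u + v → χ (i w) • n = χ (i u) • n + χ (i v) • n) : n = 0 := by
  simp only [AddChar', not_forall] at hχ
  obtain ⟨u, v, w, hw, hne⟩ := hχ
  have := h u v w hw
  rw [← add_smul, ← sub_eq_zero, ← sub_smul, smul_eq_zero, sub_eq_zero] at this
  exact this.resolve_left hne

namespace QForm

theorem bb_of_ne_one [IsDomain R] [Module.IsTorsionFree R N] (h : QForm χ B)
    (hχ : ¬ ∀ u : Kˣ, χ (u, 1) = 1) (x y : K) : B (vb K x) (vb K y) = 0 := by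
  obtain ⟨u, hu⟩ := not_forall.1 hχ
  refine smul_eq_self_imp (r := χ (u, 1)) ?_ hu
  rw [← h.tor]
  simp [tor_vb]

theorem bm_of_ne [IsDomain R] [Module.IsTorsionFree R N] (h : QForm χ B)
    (hχ : χ (-1, 1) ≠ -1) (x y : K) : B (vb K x) (vm K y) = 0 := by
  refine smul_eq_neg_imp (r := χ (-1, 1)) ?_ hχ
  rw [← h.tor, ← h.biAdd.neg_right]
  simp [tor_vb, tor_vm]

theorem bb_of_addChar [Fintype K] (h2 : (2 : K) = 0) (h2' : (2 : R) = 0) (h : QForm χ B)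
    (hχ : AddChar' χ (fun u => (1, u))) {ζ : Kˣ} (hζ : ∀ x, x ∈ Subgroup.zpowers ζ) (x y : K) :
    B (vb K x) (vb K y) = 0 := by
  have := CharTwo.of_one_ne_zero_of_two_eq_zero (one_ne_zero (α := K)) h2
  have key := add_of_addChar (χ := χ) h2 h2' hχ (g := fun x => B (vb K (x ^ 2)) (vb K (ζ * x ^ 2)))
    (by simpa using h.biAdd.zero_left 0) (fun u => by
      rw [← h.tor, tor_vb, tor_vb]; congr 2 <;> simp [mul_comm])
  refine BiAdd.eq_zero_of_graph hζ (h.biAdd.comp (vb K) (vb K)) (fun x => h.alt _)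
    (fun x y => ?_) x y
  obtain ⟨u, rfl⟩ := FiniteField.isSquare_of_char_two (ringChar.eq K 2) x
  obtain ⟨v, rfl⟩ := FiniteField.isSquare_of_char_two (ringChar.eq K 2) y
  have := key u v
  simp only [CharTwo.add_sq] at this
  simpa only [sq] using this

theorem bm_of_one [Fintype K] (hq : Fintype.card K ≠ 2) (h : QForm χ B)
    (hχ : ∀ u : Kˣ, χ (u, 1) = 1) (x y : K) : B (vb K x) (vm K y) = 0 := by
  refine eq_zero_of_const hq (g := fun y => B (vb K x) (vm K y))
    (fun a b => by simp [h.biAdd.add_right]) (fun y _ u hu => ?_) y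
  have := h.tor (Units.mk0 u hu, 1) (vb K x) (vm K y)
  rw [hχ, one_smul] at this
  simpa [tor_vb, tor_vm] using this

theorem bd_of_one [Fintype K] (hq : Fintype.card K ≠ 2) (h2 : (2 : K) = 0) (h : QForm χ B)
    (hχ : ∀ u : Kˣ, χ (u, 1) = 1) (x y : K) : B (vb K x) (vd K y) = 0 := by
  refine eq_zero_of_const hq (g := fun y => B (vb K x) (vd K y))
    (fun a b => by simp [h.biAdd.add_right]) (fun y _ u hu => ?_) y
  obtain ⟨u, rfl⟩ := exists_sq_eq h2 hu
  have := h.tor (u, 1) (vb K x) (vd K y)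
  rw [hχ, one_smul] at this
  simpa [tor_vb, tor_vd] using this

end QForm

namespace QPow

theorem eq_zero [Fintype K] (hq : Fintype.card K ≠ 2) (h : QPow χ P) (k : P (vb K 1) = 0)
    (v : K × K × K) : P v = 0 := by
  obtain ⟨hm, hd⟩ := eq_zero_of_mul_add_sq_mul hq (g := fun x => P (vm K x))
    (g' := fun x => P (vd K x)) (fun a b => by simp [h.add]) (fun s t => by
      have := h.shear s (vb K t)
      rwa [shear_vb, h.add, h.add, add_assoc, add_eq_left] at this)
  have hb := eq_zero_of_sq (g := fun x => P (vb K x)) (fun a b => by simp [h.add]) (fun u => by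
    have := h.tor (1, u) (vb K 1)
    rw [k, smul_zero, tor_vb] at this
    simpa using this)
  rw [eq_vb_add_vm_add_vd v, h.add, h.add, hm, hd, hb, add_zero, add_zero]

theorem b_of_ne_one [IsDomain R] [Module.IsTorsionFree R N] (h : QPow χ P)
    (hχ : ¬ ∀ u : Kˣ, χ (u, 1) = 1) (x : K) : P (vb K x) = 0 := by
  obtain ⟨u, hu⟩ := not_forall.1 hχ
  refine smul_eq_self_imp (r := χ (u, 1)) ?_ hu
  rw [← h.tor]
  simp [tor_vb]

theorem b_of_not_addChar [IsDomain R] [Module.IsTorsionFree R N] (h2 : (2 : K) = 0) (h : QPow χ P)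
    (hχ : ¬ AddChar' χ (fun u => (1, u))) : P (vb K 1) = 0 := by
  have := CharTwo.of_one_ne_zero_of_two_eq_zero (one_ne_zero (α := K)) h2
  refine eq_zero_of_not_addChar hχ fun u v w hw => ?_
  simp only [← h.tor, tor_vb, hw, ← h.add, ← map_add, CharTwo.add_sq, mul_one]

end QPow

theorem torRoot_one (u : Kˣ) (x : K) : torRoot (u, 1) x = u * x := by simp [torRoot]
theorem torRoot_diag (u : Kˣ) (x : K) : torRoot (u, u) x = x := by simp [torRoot]

namespace LForm

theorem eq_zero [Fintype K] (h : LForm χ φ) {ζ : Kˣ} (hζ : ∀ x, x ∈ Subgroup.zpowers ζ)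
    (k : φ 1 ζ = 0) (x y : K) : φ x y = 0 := by
  have hz : ∀ x : K, φ x (ζ * x) = 0 := fun x => by
    obtain rfl | hx := eq_or_ne x 0
    · simpa using h.biAdd.zero_left _
    have t := h.tor (Units.mk0 x hx, 1) 1 ζ
    rw [k, smul_zero, torRoot_one, torRoot_one] at t
    simpa [mul_comm] using t
  exact BiAdd.eq_zero_of_graph hζ h.biAdd h.alt (fun x y => by simp only [hz, add_zero]) x y

theorem eq_zero_of_ne [IsDomain R] [Module.IsTorsionFree R N] (h : LForm χ φ)
    (hχ : χ (-1, 1) ≠ 1) (x y : K) : φ x y = 0 := by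
  refine smul_eq_self_imp (r := χ (-1, 1)) ?_ hχ
  rw [← h.tor, torRoot_one, torRoot_one]
  simp [h.biAdd.neg_left, h.biAdd.neg_right]

theorem eq_zero_of_one [Fintype K] (hq : Fintype.card K ≠ 2) (h2 : (2 : K) ≠ 0) (h : LForm χ φ)
    (hχ : ∀ u : Kˣ, χ (u, 1) = 1) (x y : K) : φ x y = 0 := by
  by_cases hq3 : Fintype.card K = 3
  · exact h.biAdd.eq_zero_of_card_eq_three hq3 h.alt x y
  have := Fintype.one_lt_card (α := K)
  refine h.biAdd.eq_zero_of_invariant (by omega) h2 (fun u x y => ?_) x y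
  rw [← torRoot_one, ← torRoot_one, h.tor, hχ, one_smul]

theorem eq_zero_of_ne_one [IsDomain R] [Module.IsTorsionFree R N] (h : LForm χ φ)
    (hχ : ¬ ∀ u : Kˣ, χ (u, u) = 1) (x y : K) : φ x y = 0 := by
  obtain ⟨u, hu⟩ := not_forall.1 hχ
  refine smul_eq_self_imp (r := χ (u, u)) ?_ hu
  rw [← h.tor, torRoot_diag, torRoot_diag]

theorem eq_zero_of_addChar [Fintype K] (h2 : (2 : K) = 0) (h2' : (2 : R) = 0) (h : LForm χ φ)
    (hχ : AddChar' χ (fun u => (u, 1))) {ζ : Kˣ} (hζ : ∀ x, x ∈ Subgroup.zpowers ζ) (x y : K) :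
    φ x y = 0 := by
  have key := add_of_addChar (χ := χ) h2 h2' hχ (g := fun x => φ x (ζ * x))
    (by simpa using h.biAdd.zero_left 0) (fun u => by
      rw [← h.tor, torRoot_one, torRoot_one]; congr 1 <;> ring)
  exact BiAdd.eq_zero_of_graph hζ h.biAdd h.alt key x y

end LForm

namespace LPow

theorem eq_zero (h : LPow χ L) (k : L 1 = 0) (x : K) : L x = 0 := by
  obtain rfl | hx := eq_or_ne x 0
  · exact (AddMonoidHom.mk' L h.add).map_zero
  have t := h.tor (Units.mk0 x hx, 1) 1
  rw [k, smul_zero, torRoot_one] at t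
  simpa using t

theorem eq_zero_of_ne [IsDomain R] [Module.IsTorsionFree R N] (h : LPow χ L)
    (hχ : χ (-1, 1) ≠ -1) (x : K) : L x = 0 := by
  refine smul_eq_neg_imp (r := χ (-1, 1)) ?_ hχ
  rw [← h.tor, torRoot_one]
  simpa using (AddMonoidHom.mk' L h.add).map_neg x

theorem eq_zero_of_ne_one [IsDomain R] [Module.IsTorsionFree R N] (h : LPow χ L)
    (hχ : ¬ ∀ u : Kˣ, χ (u, u) = 1) (x : K) : L x = 0 := by
  obtain ⟨u, hu⟩ := not_forall.1 hχ
  refine smul_eq_self_imp (r := χ (u, u)) ?_ hu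
  rw [← h.tor, torRoot_diag]

theorem one_of_not_addChar [IsDomain R] [Module.IsTorsionFree R N] (h : LPow χ L)
    (hχ : ¬ AddChar' χ (fun u => (u, 1))) : L 1 = 0 := by
  refine eq_zero_of_not_addChar hχ fun u v w hw => ?_
  simp only [← h.tor, torRoot_one, hw, ← h.add, mul_one]

end LPow

end Vanishing

namespace Coc

variable {K : Type} [Field K] {R N : Type} [CommRing R] [AddCommGroup N] [Module R N]
  {χ : Kˣ × Kˣ →* R} {f : K → K × K × K → N}

theorem map_zero_left (h : Coc χ f) (v : K × K × K) : f 0 v = 0 := by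
  have := h.coc 0 0 v
  rwa [add_zero, show shear 0 v = v by simp [shear], left_eq_add] at this

theorem map_zero (h : Coc χ f) (s : K) : f s 0 = 0 := (AddMonoidHom.mk' (f s) (h.add s)).map_zero

theorem map_neg (h : Coc χ f) (s : K) (v : K × K × K) : f s (-v) = -f s v :=
  (AddMonoidHom.mk' (f s) (h.add s)).map_neg v

theorem eq_zero_of_coord (h : Coc χ f) (hd : ∀ s z, f s (vd K z) = 0) (hm : ∀ s z, f s (vm K z) = 0)
    (hb : ∀ s z, f s (vb K z) = 0) (s : K) (v : K × K × K) : f s v = 0 := by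
  rw [eq_vb_add_vm_add_vd v, h.add, h.add, hd, hm, hb, add_zero, add_zero]

theorem biAdd_d (h : Coc χ f) : BiAdd fun s z => f s (vd K z) :=
  ⟨fun s s' z => by rw [h.coc, shear_vd, add_comm], fun s z z' => by rw [map_add, h.add]⟩

theorem biAdd_m (h : Coc χ f) (hd : ∀ s z, f s (vd K (2 * z)) = 0) :
    BiAdd fun s z => f s (vm K z) :=
  ⟨fun s s' z => by rw [h.coc, shear_vm, h.add, mul_assoc, hd, add_zero, add_comm],
    fun s z z' => by rw [map_add, h.add]⟩

theorem biAdd_b (h : Coc χ f) (hd : ∀ s z, f s (vd K z) = 0) (hm : ∀ s z, f s (vm K z) = 0) :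
    BiAdd fun s z => f s (vb K z) :=
  ⟨fun s s' z => by rw [h.coc, shear_vb, h.add, h.add, hm, hd, add_zero, add_zero, add_comm],
    fun s z z' => by rw [map_add, h.add]⟩

theorem d_of_three (h : Coc χ f) (h2 : (2 : K) ≠ 0) (h3 : (3 : K) = 0) (s t : K) :
    f s (vd K t) = 0 := by
  obtain rfl | hs := eq_or_ne s 0
  · exact h.map_zero_left _
  have key : ∀ t, f s (vd K (2 * s ^ 2 * t)) = 0 := fun t => by
    have e1 := h.coc s (s + s) (vb K t)
    rw [show s + (s + s) = 0 by linear_combination s * h3, h.map_zero_left, h.coc, ← h.add,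
      ← h.add, shear_vb, shear_vb] at e1
    rw [e1]
    congr 1
    ext
    · simp [vb, vm, vd]; linear_combination (-t) * h3
    · simp [vb, vm, vd]; linear_combination (-s * t) * h3
    · simp [vb, vm, vd]; linear_combination (-s ^ 2 * t) * h3
  have := key ((2 * s ^ 2)⁻¹ * t)
  rwa [mul_inv_cancel_left₀ (mul_ne_zero h2 (pow_ne_zero 2 hs))] at this

theorem m_eq_d (h : Coc χ f) (h2 : (2 : K) = 0) (s t : K) :
    f s (vm K (s * t)) = -f s (vd K (s * (s * t))) := by
  have := CharTwo.of_one_ne_zero_of_two_eq_zero (one_ne_zero (α := K)) h2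
  have e1 := h.coc s s (vb K t)
  rw [CharTwo.add_self_eq_zero, h.map_zero_left, shear_vb, ← h.add,
    show vb K t + (vb K t + vm K (s * t) + vd K (s ^ 2 * t)) =
      vm K (s * t) + vd K (s ^ 2 * t) by
        rw [add_assoc, ← add_assoc, ← map_add, CharTwo.add_self_eq_zero, _root_.map_zero, zero_add],
    h.add, sq, mul_assoc] at e1
  exact eq_neg_of_add_eq_zero_left e1.symm

theorem d_of_one (h : Coc χ f) (h2 : (2 : K) ≠ 0) (hχ : ∀ u : Kˣ, χ (u, u) = 1) (s t : K) :
    f s (vd K t) = 0 := by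
  by_cases h3 : (3 : K) = 0
  · exact h.d_of_three h2 h3 s t
  have key : ∀ t, f s (vd K (3 * t)) = 0 := fun t => by
    have := h.tor (Units.mk0 2 h2, Units.mk0 2 h2) s (vd K t)
    rw [hχ, one_smul, torRoot_diag, tor_vd, ← sub_eq_zero, sub_eq_add_neg, ← h.map_neg, ← h.add,
      ← _root_.map_neg, ← map_add] at this
    rw [← this]
    congr 2
    simp
    ring
  have := key (t / 3)
  rwa [mul_div_cancel₀ _ h3] at this

theorem m_of_d (h : Coc χ f) (h2 : (2 : K) = 0) (hd : ∀ s z, f s (vd K z) = 0) (s y : K) :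
    f s (vm K y) = 0 := by
  obtain rfl | hs := eq_or_ne s 0
  · exact h.map_zero_left _
  have := h.m_eq_d h2 s (s⁻¹ * y)
  rwa [mul_inv_cancel_left₀ hs, hd, neg_zero] at this

theorem d_eq (h : Coc χ f) (h2 : (2 : K) = 0) (s z : K) : f s (vd K z) = f 1 (vd K (s * z)) := by
  have := CharTwo.of_one_ne_zero_of_two_eq_zero (one_ne_zero (α := K)) h2
  have hm := h.biAdd_m (fun s z => by rw [h2, zero_mul, _root_.map_zero, h.map_zero])
  have hd := h.biAdd_d
  have hmd : ∀ s y, f s (vm K y) = -f s (vd K (s * y)) := fun s y => by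
    obtain rfl | hs := eq_or_ne s 0
    · rw [h.map_zero_left, h.map_zero_left, neg_zero]
    have := h.m_eq_d h2 s (s⁻¹ * y)
    rwa [mul_inv_cancel_left₀ hs] at this
  have key : ∀ s s' y, f s (vd K (s' * y)) + f s' (vd K (s * y)) = 0 := fun s s' y => by
    have e := hm.add_left s s' y
    simp only [hmd, add_mul, map_add, h.add, hd.add_left] at e
    have e' := sub_eq_zero.2 e
    rw [← neg_eq_zero, ← e']; abel
  have e := key s 1 z
  rw [one_mul] at e
  rw [eq_neg_of_add_eq_zero_left e, ← h.map_neg, ← _root_.map_neg, CharTwo.neg_eq]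

theorem one_d_tor (h : Coc χ f) (h2 : (2 : K) = 0) (u : Kˣ × Kˣ) (z : K) :
    f 1 (vd K (u.1 ^ 3 * (u.2 : K)⁻¹ * z)) = χ u • f 1 (vd K z) := by
  rw [← h.tor, tor_vd, h.d_eq h2 (torRoot u 1)]
  congr 2
  simp [torRoot]; ring

section

variable [Fintype K]

theorem b_eq_zero (h : Coc χ f) (hd : ∀ s z, f s (vd K z) = 0) (hm : ∀ s z, f s (vm K z) = 0)
    (k : f 1 (vb K 1) = 0) (s t : K) : f s (vb K t) = 0 := by
  have hb := h.biAdd_b hd hm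
  refine eq_zero_of_sq (g := fun t => f s (vb K t)) (hb.add_right s) (fun u => ?_) t
  obtain rfl | hs := eq_or_ne s 0
  · exact hb.zero_left _
  have := h.tor (Units.mk0 s hs * u, u) 1 (vb K 1)
  rw [k, smul_zero, tor_vb] at this
  simpa [torRoot] using this

theorem d_eq_zero (h : Coc χ f) (k : f 1 (vd K 1) = 0) (s t : K) : f s (vd K t) = 0 := by
  refine eq_zero_of_sq (g := fun t => f s (vd K t)) (h.biAdd_d.add_right s) (fun u => ?_) t
  obtain rfl | hs := eq_or_ne s 0
  · exact h.biAdd_d.zero_left _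
  have := h.tor (u, (Units.mk0 s hs)⁻¹ * u) 1 (vd K 1)
  rw [k, smul_zero, tor_vd] at this
  simpa [torRoot] using this

theorem m_eq_zero (h : Coc χ f) (hd : ∀ s z, f s (vd K (2 * z)) = 0)
    (k : f 1 (vm K 1) = 0) (s t : K) : f s (vm K t) = 0 := by
  have hm := h.biAdd_m hd
  obtain rfl | hs := eq_or_ne s 0
  · exact hm.zero_left _
  have key := eq_zero_of_sq (g := fun t => f s (vm K (s * t)))
    (fun a b => by simp [mul_add, h.add]) (fun u => by
      have := h.tor (Units.mk0 s hs * u, u) 1 (vm K 1)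
      rw [k, smul_zero, tor_vm] at this
      simpa [torRoot, mul_assoc, sq] using this) (s⁻¹ * t)
  simpa [hs] using key

theorem m_of_one (h : Coc χ f) (hq : 3 < Fintype.card K) (h2 : (2 : K) ≠ 0)
    (hχ : ∀ u : Kˣ, χ (u, 1) = 1) (hd : ∀ s z, f s (vd K (2 * z)) = 0) (s t : K) :
    f s (vm K t) = 0 := by
  refine (h.biAdd_m hd).eq_zero_of_invariant hq h2 (fun u x y => ?_) s t
  have := h.tor (u, 1) x (vm K y)
  rw [hχ, one_smul, torRoot_one, tor_vm] at this
  simpa using this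

end

section

variable [IsDomain R] [Module.IsTorsionFree R N]

theorem d_of_ne (h : Coc χ f) (hχ : χ (-1, 1) ≠ -1) (s t : K) : f s (vd K t) = 0 := by
  refine smul_eq_neg_imp (r := χ (-1, 1)) ?_ hχ
  rw [← h.tor, ← h.biAdd_d.neg_left, torRoot_one, tor_vd]
  simp

theorem b_of_ne (h : Coc χ f) (hd : ∀ s z, f s (vd K z) = 0) (hm : ∀ s z, f s (vm K z) = 0)
    (hχ : χ (-1, 1) ≠ -1) (s t : K) : f s (vb K t) = 0 := by
  refine smul_eq_neg_imp (r := χ (-1, 1)) ?_ hχ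
  rw [← h.tor, ← (h.biAdd_b hd hm).neg_left, torRoot_one, tor_vb]
  simp

theorem m_of_ne (h : Coc χ f) (hd : ∀ s z, f s (vd K (2 * z)) = 0)
    (hχ : χ (-1, 1) ≠ 1) (s t : K) : f s (vm K t) = 0 := by
  refine smul_eq_self_imp (r := χ (-1, 1)) ?_ hχ
  have hm := h.biAdd_m hd
  have := hm.neg_left s (-t)
  rw [hm.neg_right, hm.neg_right, neg_neg] at this
  rw [← h.tor, torRoot_one, tor_vm]
  simpa [h.map_neg] using this

theorem b_of_not_addChar (h : Coc χ f)
    (hd : ∀ s z, f s (vd K z) = 0) (hm : ∀ s z, f s (vm K z) = 0)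
    (hχ : ¬ AddChar' χ (fun u => (u, 1))) (s t : K) : f s (vb K t) = 0 := by
  refine eq_zero_of_not_addChar hχ fun u v w hw => ?_
  have hb := (h.biAdd_b hd hm).add_left
  simp only [← h.tor, torRoot_one, tor_vb, hw, add_mul, hb]

end

section Even

variable [Fintype K]

theorem d_of_one_even (h : Coc χ f) (hq : Fintype.card K ≠ 2) (h2 : (2 : K) = 0)
    (hχ : ∀ u : Kˣ, χ (u, u) = 1) (s z : K) : f s (vd K z) = 0 := by
  rw [h.d_eq h2]
  refine eq_zero_of_const hq (g := fun z => f 1 (vd K z)) (h.biAdd_d.add_right 1)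
    (fun x _ u hu => ?_) _
  obtain ⟨u, rfl⟩ := exists_sq_eq h2 hu
  have := h.one_d_tor h2 (u, u) x
  rw [hχ, one_smul, pow_succ, mul_inv_cancel_right₀ u.ne_zero] at this
  exact this

theorem d_of_addChar (h : Coc χ f) (hq : Fintype.card K ≠ 2) (h2 : (2 : K) = 0)
    (hχ : AddChar' χ (fun u => (u, 1))) (s z : K) : f s (vd K z) = 0 := by
  obtain ⟨u, v, hu, hv, huv⟩ := exists_add_ne_zero hq
  have key : ∀ x, f 1 (vd K ((u ^ 2 * v + u * v ^ 2) * x)) = 0 := fun x => by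
    have e := congrArg (· • f 1 (vd K x))
      (hχ (Units.mk0 u hu) (Units.mk0 v hv) (Units.mk0 _ huv) rfl)
    simp only [add_smul, ← h.one_d_tor h2, ← h.add, ← map_add] at e
    simp only [Units.val_mk0, Units.val_one, inv_one, mul_one] at e
    rw [← sub_eq_zero, sub_eq_add_neg, ← h.map_neg, ← h.add, ← _root_.map_neg, ← map_add] at e
    rw [← e]
    congr 2
    linear_combination (-(u ^ 2 * v + u * v ^ 2) * x) * h2
  have hw : u ^ 2 * v + u * v ^ 2 ≠ 0 := by
    rw [show u ^ 2 * v + u * v ^ 2 = u * v * (u + v) by ring]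
    exact mul_ne_zero (mul_ne_zero hu hv) huv
  have := key ((u ^ 2 * v + u * v ^ 2)⁻¹ * (s * z))
  rwa [mul_inv_cancel_left₀ hw, ← h.d_eq h2] at this

theorem b_of_one (h : Coc χ f) (hq : Fintype.card K ≠ 2)
    (hd : ∀ s z, f s (vd K z) = 0) (hm : ∀ s z, f s (vm K z) = 0)
    (hχ : ∀ u : Kˣ, χ (u, 1) = 1) (s t : K) : f s (vb K t) = 0 := by
  refine eq_zero_of_const hq (g := fun s => f s (vb K t))
    (fun a b => (h.biAdd_b hd hm).add_left a b t) (fun x _ u hu => ?_) s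
  have := h.tor (Units.mk0 u hu, 1) x (vb K t)
  rw [hχ, one_smul, torRoot_one, tor_vb] at this
  simpa using this

theorem b_of_one' (h : Coc χ f) (hq : Fintype.card K ≠ 2) (h2 : (2 : K) = 0)
    (hχ : ∀ u : Kˣ, χ (u, u) = 1) (s t : K) : f s (vb K t) = 0 := by
  refine eq_zero_of_const hq (g := fun t => f s (vb K t)) (fun a b => by rw [map_add, h.add])
    (fun x _ u hu => ?_) t
  obtain ⟨u, rfl⟩ := exists_sq_eq h2 hu
  have := h.tor (u, u) s (vb K x)
  rwa [hχ, one_smul, torRoot_diag, tor_vb] at this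

end Even

end Coc

section Borel

open Multiplicative (ofAdd)

variable {K : Type} [Field K]

theorem shear_zero (v : K × K × K) : shear 0 v = v := by simp [shear]

theorem shear_shear (s t : K) (v : K × K × K) : shear s (shear t v) = shear (s + t) v := by
  ext <;> simp [shear] <;> ring

theorem shear_add (s : K) (v w : K × K × K) : shear s (v + w) = shear s v + shear s w := by
  ext <;> simp [shear] <;> ring

theorem tor_one (v : K × K × K) : tor 1 v = v := by simp [tor]

theorem tor_tor (u u' : Kˣ × Kˣ) (v : K × K × K) : tor u (tor u' v) = tor (u * u') v := by
  ext <;> simp [tor] <;> ring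

theorem tor_add (u : Kˣ × Kˣ) (v w : K × K × K) : tor u (v + w) = tor u v + tor u w := by
  ext <;> simp [tor] <;> ring

theorem tor_shear (u : Kˣ × Kˣ) (s : K) (v : K × K × K) :
    tor u (shear s v) = shear (torRoot u s) (tor u v) := by
  have := u.2.ne_zero
  ext
  · simp [tor, shear]
  · simp [tor, shear, torRoot]; field_simp
  · simp [tor, shear, torRoot]; field_simp

variable (K) in
/-- The action of the short root group on symmetric matrices by automorphisms. -/
def shearAut : Multiplicative K →* MulAut (Multiplicative (K × K × K)) where
  toFun s :=
    { toFun := fun v => ofAdd (shear s.toAdd v.toAdd)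
      invFun := fun v => ofAdd (shear (-s.toAdd) v.toAdd)
      left_inv := fun v => by simp [shear_shear, shear_zero]
      right_inv := fun v => by simp [shear_shear, shear_zero]
      map_mul' := fun v w => congrArg ofAdd (shear_add _ _ _) }
  map_one' := by ext1 v; exact congrArg ofAdd (shear_zero _)
  map_mul' s t := by ext1 v; exact congrArg ofAdd (shear_shear _ _ _).symm

variable (K) in
/-- The action of the torus on symmetric matrices by automorphisms. -/
def torAut : Kˣ × Kˣ →* MulAut (Multiplicative (K × K × K)) where
  toFun u :=
    { toFun := fun v => ofAdd (tor u v.toAdd)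
      invFun := fun v => ofAdd (tor u⁻¹ v.toAdd)
      left_inv := fun v => by simp [tor_tor, tor_one]
      right_inv := fun v => by simp [tor_tor, tor_one]
      map_mul' := fun v w => congrArg ofAdd (tor_add _ _ _) }
  map_one' := by ext1 v; exact congrArg ofAdd (tor_one _)
  map_mul' s t := by ext1 v; exact congrArg ofAdd (tor_tor _ _ _).symm

/-- The root subgroups and torus of a Borel subgroup. -/
structure BorelData (K B : Type) [Field K] [Group B] where
  q : Multiplicative (K × K × K) →* B
  a : Multiplicative K →* B
  h : Kˣ × Kˣ →* B
  a_q : ∀ s v, a (ofAdd s) * q (ofAdd v) = q (ofAdd (shear s v)) * a (ofAdd s)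
  h_q : ∀ u v, h u * q (ofAdd v) = q (ofAdd (tor u v)) * h u
  h_a : ∀ u s, h u * a (ofAdd s) = a (ofAdd (torRoot u s)) * h u

namespace BorelData

variable {B : Type} [Group B]

/-- The unipotent radical. -/
def unip (D : BorelData K B) : Multiplicative (K × K × K) ⋊[shearAut K] Multiplicative K →* B :=
  SemidirectProduct.lift D.q D.a fun s => MonoidHom.ext fun v => by
    exact eq_mul_inv_of_mul_eq (D.a_q s.toAdd v.toAdd).symm

/-- The subgroup generated by the abelian normal subgroup and the torus. -/
def solv (D : BorelData K B) : Multiplicative (K × K × K) ⋊[torAut K] (Kˣ × Kˣ) →* B :=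
  SemidirectProduct.lift D.q D.h fun u => MonoidHom.ext fun v => by
    exact eq_mul_inv_of_mul_eq (D.h_q u v.toAdd).symm

variable {F M V R : Type} [Field F] [AddCommGroup M] [Module F M] [AddCommGroup V] [Module F V]
  [CommRing R] [Module R M] {ρ : Representation F B M} {c : Fam ρ V}

/-- The unipotent radical acts trivially and the torus acts through `χ`. -/
structure Acts (D : BorelData K B) (ρ : Representation F B M) (χ : Kˣ × Kˣ →* R) : Prop where
  q : ∀ v, ρ (D.q v) = 1
  a : ∀ s, ρ (D.a s) = 1
  h : ∀ u m, ρ (D.h u) m = χ u • m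

variable {D : BorelData K B} {χ : Kˣ × Kˣ →* R}

theorem Acts.h_comp [SMulCommClass F R M] (hD : D.Acts ρ χ) (u : Kˣ × Kˣ) (n : V →ₗ[F] M) :
    ρ (D.h u) ∘ₗ n = χ u • n := LinearMap.ext fun v => hD.h u (n v)

theorem Acts.a_comp (hD : D.Acts ρ χ) (s : Multiplicative K) (n : V →ₗ[F] M) :
    ρ (D.a s) ∘ₗ n = n := by rw [hD.a]; rfl

theorem qForm [SMulCommClass F R M] (hD : D.Acts ρ χ) : QForm χ (FamExt.comm c D.q) where
  biAdd := ⟨FamExt.comm_add_left hD.q, FamExt.comm_add_right hD.q⟩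
  alt := FamExt.comm_self
  shear s v w := by
    rw [← FamExt.comm_conj hD.q (D.a_q s v) (D.a_q s w), hD.a_comp]
  tor u v w := by
    rw [← FamExt.comm_conj hD.q (D.h_q u v) (D.h_q u w), hD.h_comp]

theorem lForm [SMulCommClass F R M] (hD : D.Acts ρ χ) : LForm χ (FamExt.comm c D.a) where
  biAdd := ⟨FamExt.comm_add_left hD.a, FamExt.comm_add_right hD.a⟩
  alt := FamExt.comm_self
  tor u v w := by
    rw [← FamExt.comm_conj hD.a (D.h_a u v) (D.h_a u w), hD.h_comp]

section

variable {p : ℕ} [CharP F p] [CharP K p]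

theorem qPow [SMulCommClass F R M] (hD : D.Acts ρ χ) (h : ∀ v w, FamExt.comm c D.q v w = 0) :
    QPow χ (FamExt.pow c D.q p) where
  add v w := FamExt.pow_add' hD.q (fun a => by ext <;> simp) (h v w)
  shear s v := by
    rw [← FamExt.pow_conj hD.q (fun a => by ext <;> simp) (D.a_q s v), hD.a_comp]
  tor u v := by
    rw [← FamExt.pow_conj hD.q (fun a => by ext <;> simp) (D.h_q u v), hD.h_comp]

theorem lPow [SMulCommClass F R M] (hD : D.Acts ρ χ) (h : ∀ v w, FamExt.comm c D.a v w = 0) :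
    LPow χ (FamExt.pow c D.a p) where
  add v w := FamExt.pow_add' hD.a (fun a => by simp) (h v w)
  tor u v := by
    rw [← FamExt.pow_conj hD.a (fun a => by simp) (D.h_a u v), hD.h_comp]

end

/-- A lift of the abelian normal subgroup which is normalised by lifts of the torus. -/
structure Lift (D : BorelData K B) (c : Fam ρ V) where
  q : Multiplicative (K × K × K) →* FamExt c
  h : Kˣ × Kˣ → FamExt c
  q_snd : ∀ v, (q v).snd = D.q v
  h_snd : ∀ u, (h u).snd = D.h u
  h_q : ∀ u v, h u * q (ofAdd v) = q (ofAdd (tor u v)) * h u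

theorem exists_lift [Finite K] (h0 : (Nat.card (Kˣ × Kˣ) : F) ≠ 0)
    (σ : Multiplicative (K × K × K) →* FamExt c) (hσ : ∀ v, (σ v).snd = D.q v) :
    Nonempty (D.Lift c) := by
  obtain ⟨τ, hτ⟩ := FamExt.exists_transfer (c := c) D.solv SemidirectProduct.inl
    SemidirectProduct.inl_injective (by
      rw [SemidirectProduct.range_inl_eq_ker_rightHom, Subgroup.index_ker,
        MonoidHom.range_eq_top.2 SemidirectProduct.rightHom_surjective]
      rwa [Nat.card_congr (Subgroup.topEquiv).toEquiv]) σ (fun v => by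
        rw [hσ, solv, SemidirectProduct.lift_inl])
  refine ⟨⟨τ.comp SemidirectProduct.inl, fun u => τ (SemidirectProduct.inr u), fun v => ?_,
    fun u => ?_, fun u v => ?_⟩⟩
  · rw [MonoidHom.comp_apply, hτ, solv, SemidirectProduct.lift_inl]
  · rw [hτ, solv, SemidirectProduct.lift_inr]
  · rw [MonoidHom.comp_apply, MonoidHom.comp_apply, ← map_mul, ← map_mul]
    congr 1
    have := SemidirectProduct.inl_aut (φ := torAut K) u (ofAdd v)
    rw [map_inv] at this
    exact mul_inv_eq_iff_eq_mul.1 this.symm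

namespace Lift

/-- The restriction of a lift along a linear map. -/
def map (L : D.Lift c) {V' : Type} [AddCommGroup V'] [Module F V'] (j : V' →ₗ[F] V) :
    D.Lift (c.comap j) where
  q := (FamExt.map c j).comp L.q
  h u := FamExt.map c j (L.h u)
  q_snd v := L.q_snd v
  h_snd u := L.h_snd u
  h_q u v := by simp only [MonoidHom.comp_apply, ← map_mul, L.h_q]

/-- The defect of equivariance of a lift under the short root group. -/
def coc (L : D.Lift c) (s : K) (v : K × K × K) : V →ₗ[F] M :=
  (FamExt.sec c (D.a (ofAdd s)) * L.q (ofAdd v) * (FamExt.sec c (D.a (ofAdd s)))⁻¹ *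
    (L.q (ofAdd (shear s v)))⁻¹).val

theorem coc_map (L : D.Lift c) {V' : Type} [AddCommGroup V'] [Module F V'] (j : V' →ₗ[F] V)
    (s : K) (v : K × K × K) : (L.map j).coc s v = L.coc s v ∘ₗ j := by
  simp only [coc, map, ← FamExt.map_sec, MonoidHom.comp_apply, ← map_mul, ← map_inv,
    FamExt.val_map]

theorem q_comm (hD : D.Acts ρ χ) (L : D.Lift c) (v) (n : V →ₗ[F] M) :
    L.q v * FamExt.ι c n = FamExt.ι c n * L.q v :=
  FamExt.commute_ι_of_eq_one (by rw [L.q_snd, hD.q]) n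

theorem a_comm (hD : D.Acts ρ χ) {x : FamExt c} {s : Multiplicative K} (hx : x.snd = D.a s)
    (n : V →ₗ[F] M) : x * FamExt.ι c n = FamExt.ι c n * x :=
  FamExt.commute_ι_of_eq_one (by rw [hx, hD.a]) n

theorem coc_spec (hD : D.Acts ρ χ) (L : D.Lift c) {x : FamExt c} {s : K}
    (hx : x.snd = D.a (ofAdd s)) (v : K × K × K) :
    x * L.q (ofAdd v) = FamExt.ι c (L.coc s v) * (L.q (ofAdd (shear s v)) * x) := by
  obtain ⟨n, rfl⟩ := FamExt.exists_ι (x := x) (y := FamExt.sec c (D.a (ofAdd s))) hx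
  generalize hx' : FamExt.sec c (D.a (ofAdd s)) = x
  have key : x * L.q (ofAdd v) = FamExt.ι c (L.coc s v) * (L.q (ofAdd (shear s v)) * x) := by
    rw [coc, FamExt.ι_val, hx']
    · group
    · simp only [FamExt.mul_snd, FamExt.inv_snd, FamExt.sec_snd, L.q_snd, D.a_q]
      group
  rw [mul_assoc, key, ← mul_assoc, FamExt.ι_comm, ← mul_assoc (L.q _), L.q_comm hD]
  simp only [mul_assoc]

theorem coc_eq (hD : D.Acts ρ χ) (L : D.Lift c) {x : FamExt c} {s : K}
    (hx : x.snd = D.a (ofAdd s)) {v : K × K × K} {n : V →ₗ[F] M}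
    (h : x * L.q (ofAdd v) = FamExt.ι c n * (L.q (ofAdd (shear s v)) * x)) : L.coc s v = n :=
  FamExt.ι_mul_inj ((L.coc_spec hD hx v).symm.trans h)

theorem isCoc [SMulCommClass F R M] (hD : D.Acts ρ χ) (L : D.Lift c) : Coc χ L.coc where
  add s v w := by
    set x := FamExt.sec c (D.a (ofAdd s)) with hx
    refine L.coc_eq hD (x := x) rfl ?_
    rw [ofAdd_add, map_mul, ← mul_assoc, L.coc_spec hD (x := x) rfl, mul_assoc, mul_assoc,
      L.coc_spec hD (x := x) rfl, shear_add, ofAdd_add, map_mul, FamExt.ι_add,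
      ← mul_assoc (L.q _) (FamExt.ι c _), L.q_comm hD]
    simp only [mul_assoc]
  coc s s' v := by
    set x := FamExt.sec c (D.a (ofAdd s)) with hx
    set y := FamExt.sec c (D.a (ofAdd s')) with hy
    refine L.coc_eq hD (x := x * y) (by simp [hx, hy]) ?_
    rw [mul_assoc, L.coc_spec hD (x := y) rfl, ← mul_assoc, a_comm hD (x := x) rfl, mul_assoc,
      ← mul_assoc x, L.coc_spec hD (x := x) rfl, shear_shear, FamExt.ι_add]
    simp only [mul_assoc]
  tor u s v := by
    set x := FamExt.sec c (D.a (ofAdd s)) with hx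
    have h1 : ∀ v, L.h u * L.q (ofAdd v) * (L.h u)⁻¹ = L.q (ofAdd (_root_.tor u v)) :=
      fun v => by rw [L.h_q]; group
    refine L.coc_eq hD (x := L.h u * x * (L.h u)⁻¹) ?_ ?_
    · simp only [FamExt.mul_snd, FamExt.inv_snd, L.h_snd, hx, FamExt.sec_snd, D.h_a]
      group
    · have h3 := FamExt.mul_ι (L.h u) (L.coc s v)
      rw [L.h_snd, hD.h_comp] at h3
      have h4 := L.coc_spec hD (x := x) rfl v
      rw [← tor_shear, ← h1, ← h1]
      calc _ = L.h u * (x * L.q (ofAdd v)) * (L.h u)⁻¹ := by group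
        _ = L.h u * FamExt.ι c (L.coc s v) * (L.q (ofAdd (_root_.shear s v)) * x) * (L.h u)⁻¹ := by
          rw [h4]; simp only [mul_assoc]
        _ = _ := by rw [h3]; simp only [mul_assoc, inv_mul_cancel_left]

/-- A lift with vanishing defect splits the extension. -/
theorem splits (hD : D.Acts ρ χ) (L : D.Lift c) (h0 : ∀ s v, L.coc s v = 0)
    (hU : Function.Injective D.unip) (hi : (D.unip.range.index : F) ≠ 0)
    (σ : Multiplicative K →* FamExt c) (hσ : ∀ s, (σ s).snd = D.a s) : Splits c := by
  refine FamExt.splits_of_transfer D.unip hU hi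
    (SemidirectProduct.lift L.q σ fun s => MonoidHom.ext fun v => ?_)
    fun x => ?_
  · have := L.coc_spec hD (s := s.toAdd) (hσ s) v.toAdd
    rw [h0, FamExt.ι_zero, one_mul] at this
    exact eq_mul_inv_of_mul_eq this.symm
  · rw [unip, ← SemidirectProduct.inl_left_mul_inr_right x]
    simp only [map_mul, SemidirectProduct.lift_inl, SemidirectProduct.lift_inr, FamExt.mul_snd,
      L.q_snd, hσ]

end Lift

end BorelData

end Borel

section Table

open Module

variable {K R : Type} [Field K] [Fintype K] [CommRing R]

/-- A list of conditions on a weight outside of which the relevant coordinates of equivariant forms,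
power maps and cocycles vanish. The pairs `x` are coordinates which determine an
equivariant form. -/
structure VanishTable (χ : Kˣ × Kˣ →* R) (ζ : Kˣ) (x : Fin 3 → (K × K × K) × (K × K × K))
    (C : Fin 9 → Prop) : Prop where
  form : ∀ (N : Type) [AddCommGroup N] [Module R N] [IsTorsionFree R N]
    (B : K × K × K → K × K × K → N), QForm χ B → (¬ C 0 → B (x 0).1 (x 0).2 = 0) ∧
      (¬ C 1 → B (x 1).1 (x 1).2 = 0) ∧ (¬ C 2 → B (x 2).1 (x 2).2 = 0) ∧
      ((∀ i, B (x i).1 (x i).2 = 0) → ∀ v w, B v w = 0)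
  rootForm : ∀ (N : Type) [AddCommGroup N] [Module R N] [IsTorsionFree R N]
    (φ : K → K → N), LForm χ φ → ¬ C 3 → φ 1 ζ = 0
  pow : ∀ (N : Type) [AddCommGroup N] [Module R N] [IsTorsionFree R N]
    (P : K × K × K → N), QPow χ P → ¬ C 4 → P (vb K 1) = 0
  rootPow : ∀ (N : Type) [AddCommGroup N] [Module R N] [IsTorsionFree R N]
    (P : K → N), LPow χ P → ¬ C 5 → P 1 = 0
  cocD : ∀ (N : Type) [AddCommGroup N] [Module R N] [IsTorsionFree R N]
    (f : K → K × K × K → N), Coc χ f → ¬ C 6 → f 1 (vd K 1) = 0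
  cocM : ∀ (N : Type) [AddCommGroup N] [Module R N] [IsTorsionFree R N]
    (f : K → K × K × K → N), Coc χ f → (∀ s z, f s (vd K z) = 0) → ¬ C 7 → f 1 (vm K 1) = 0
  cocB : ∀ (N : Type) [AddCommGroup N] [Module R N] [IsTorsionFree R N]
    (f : K → K × K × K → N), Coc χ f → (∀ s z, f s (vd K z) = 0) → (∀ s z, f s (vm K z) = 0) →
      ¬ C 8 → f 1 (vb K 1) = 0

namespace BorelData

variable {B F M V : Type} [Group B] [Field F] [AddCommGroup M] [Module F M] [AddCommGroup V]
  [Module F V] [FiniteDimensional F V] [FiniteDimensional F M] [Module R M] [SMulCommClass F R M]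
  {ρ : Representation F B M} {c : Fam ρ V} {D : BorelData K B} {χ : Kˣ × Kˣ →* R}
  {ζ : Kˣ} {x : Fin 3 → (K × K × K) × (K × K × K)} {C : Fin 9 → Prop}

open Classical in
/-- The contribution of a condition to the codimension. -/
noncomputable def cost (F M : Type) [Field F] [AddCommGroup M] [Module F M] (P : Prop) : ℕ :=
  if P then finrank F M else 0

theorem red_cost (P : Prop) (n : V →ₗ[F] M) (h0 : ¬ P → n = 0) {l : ℕ}
    (h : ∀ (V' : Type) [AddCommGroup V'] [Module F V'] [FiniteDimensional F V'] (j : V' →ₗ[F] V),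
      n ∘ₗ j = 0 → Red (c.comap j) l) : Red c (cost F M P + l) := by
  classical
  exact Red.kill_if P n h0 h

variable [IsTorsionFree R M]

theorem red_of_lift (hD : D.Acts ρ χ) (T : VanishTable χ ζ x C)
    (hU : Function.Injective D.unip) (hi : (D.unip.range.index : F) ≠ 0) (L : D.Lift c)
    (σ : Multiplicative K →* FamExt c) (hσ : ∀ s, (σ s).snd = D.a s) :
    Red c (cost F M (C 6) + (cost F M (C 7) + (cost F M (C 8) + 0))) := by
  refine red_cost _ (L.coc 1 (vd K 1)) (T.cocD _ _ (L.isCoc hD)) fun V₁ _ _ _ j₁ h₁ => ?_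
  rw [← L.coc_map] at h₁
  have hd := ((L.map j₁).isCoc hD).d_eq_zero h₁
  refine red_cost _ ((L.map j₁).coc 1 (vm K 1)) (T.cocM _ _ ((L.map j₁).isCoc hD) hd)
    fun V₂ _ _ _ j₂ h₂ => ?_
  set L₂ := (L.map j₁).map j₂ with hL₂
  rw [← (L.map j₁).coc_map] at h₂
  have hd₂ : ∀ s z, L₂.coc s (vd K z) = 0 := fun s z => by
    rw [hL₂, (L.map j₁).coc_map, hd, LinearMap.zero_comp]
  have hm₂ := (L₂.isCoc hD).m_eq_zero (fun s z => hd₂ s _) h₂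
  refine red_cost _ (L₂.coc 1 (vb K 1)) (T.cocB _ _ (L₂.isCoc hD) hd₂ hm₂)
    fun V₃ _ _ _ j₃ h₃ => ?_
  rw [← L₂.coc_map] at h₃
  have h₀ : ∀ s v, (L₂.map j₃).coc s v = 0 :=
    ((L₂.map j₃).isCoc hD).eq_zero_of_coord
      (fun s z => by rw [L₂.coc_map, hd₂, LinearMap.zero_comp])
      (fun s z => by rw [L₂.coc_map, hm₂, LinearMap.zero_comp])
      (((L₂.map j₃).isCoc hD).b_eq_zero
        (fun s z => by rw [L₂.coc_map, hd₂, LinearMap.zero_comp])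
        (fun s z => by rw [L₂.coc_map, hm₂, LinearMap.zero_comp]) h₃)
  exact Red.of_splits ((L₂.map j₃).splits hD h₀ hU hi
    ((FamExt.map _ j₃).comp ((FamExt.map _ j₂).comp ((FamExt.map c j₁).comp σ))) hσ) 0

theorem red_of_comm_eq_zero (p : ℕ) [Fact p.Prime] [CharP F p] [CharP K p]
    (hD : D.Acts ρ χ) (T : VanishTable χ ζ x C)
    (hq : Fintype.card K ≠ 2) (h0 : (Nat.card (Kˣ × Kˣ) : F) ≠ 0)
    (hU : Function.Injective D.unip) (hi : (D.unip.range.index : F) ≠ 0)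
    (hcq : ∀ v w, FamExt.comm c D.q v w = 0) (hca : ∀ v w, FamExt.comm c D.a v w = 0) :
    Red c (cost F M (C 4) + (cost F M (C 5) +
      (cost F M (C 6) + (cost F M (C 7) + (cost F M (C 8) + 0))))) := by
  refine red_cost _ (FamExt.pow c D.q p (vb K 1)) (T.pow _ _ (qPow hD hcq))
    fun V₁ _ _ _ j₁ h₁ => ?_
  have hca₁ : ∀ v w, FamExt.comm (c.comap j₁) D.a v w = 0 := fun v w => by
    rw [FamExt.comm_map, hca, LinearMap.zero_comp]
  have hcq₁ : ∀ v w, FamExt.comm (c.comap j₁) D.q v w = 0 := fun v w => by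
    rw [FamExt.comm_map, hcq, LinearMap.zero_comp]
  rw [← FamExt.pow_map] at h₁
  have hp₁ := (qPow (p := p) hD hcq₁).eq_zero hq h₁
  refine red_cost _ (FamExt.pow (c.comap j₁) D.a p (1 : K)) (T.rootPow _ _ (lPow hD hca₁))
    fun V₂ _ _ _ j₂ h₂ => ?_
  have hca₂ : ∀ v w, FamExt.comm ((c.comap j₁).comap j₂) D.a v w = 0 := fun v w => by
    rw [FamExt.comm_map, hca₁, LinearMap.zero_comp]
  rw [← FamExt.pow_map] at h₂
  have hp₂ := (lPow (p := p) hD hca₂).eq_zero h₂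
  obtain ⟨τ, hτ⟩ := FamExt.exists_hom_lift hD.q (p := p) (fun a => by ext <;> simp)
    (c := (c.comap j₁).comap j₂)
    (fun v w => by rw [FamExt.comm_map, hcq₁, LinearMap.zero_comp])
    (fun v => by rw [FamExt.pow_map, hp₁, LinearMap.zero_comp])
  obtain ⟨σ, hσ⟩ := FamExt.exists_hom_lift hD.a (p := p) (fun a => by simp) hca₂ hp₂
  obtain ⟨L⟩ := exists_lift h0 τ hτ
  exact red_of_lift hD T hU hi L σ hσ

theorem codim_of_table (p : ℕ) [Fact p.Prime] [CharP F p] [CharP K p]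
    (hD : D.Acts ρ χ) (T : VanishTable χ ζ x C)
    (hζ : ∀ x, x ∈ Subgroup.zpowers ζ)
    (hq : Fintype.card K ≠ 2) (h0 : (Nat.card (Kˣ × Kˣ) : F) ≠ 0)
    (hU : Function.Injective D.unip) (hi : (D.unip.range.index : F) ≠ 0) :
    Codim ρ (∑ i, cost F M (C i)) := by
  intro V _ _ _ c
  suffices Red c (cost F M (C 0) + (cost F M (C 1) + (cost F M (C 2) + (cost F M (C 3) +
      (cost F M (C 4) + (cost F M (C 5) +
      (cost F M (C 6) + (cost F M (C 7) + (cost F M (C 8) + 0))))))))) by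
    refine this.mono (le_of_eq ?_)
    simp [Fin.sum_univ_succ]
  refine red_cost _ (FamExt.comm c D.q (x 0).1 (x 0).2) (T.form _ _ (qForm hD)).1
    fun V₁ _ _ _ j₁ h₁ => ?_
  refine red_cost _ (FamExt.comm (c.comap j₁) D.q (x 1).1 (x 1).2) (T.form _ _ (qForm hD)).2.1
    fun V₂ _ _ _ j₂ h₂ => ?_
  refine red_cost _ (FamExt.comm ((c.comap j₁).comap j₂) D.q (x 2).1 (x 2).2)
    (T.form _ _ (qForm hD)).2.2.1
    fun V₃ _ _ _ j₃ h₃ => ?_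
  have hc : ∀ v w, FamExt.comm (((c.comap j₁).comap j₂).comap j₃) D.q v w = 0 :=
    (T.form _ _ (qForm hD)).2.2.2 fun i => by
      fin_cases i
      · change FamExt.comm _ D.q (x 0).1 (x 0).2 = 0
        rw [FamExt.comm_map, FamExt.comm_map, FamExt.comm_map, h₁, LinearMap.zero_comp,
          LinearMap.zero_comp]
      · change FamExt.comm _ D.q (x 1).1 (x 1).2 = 0
        rw [FamExt.comm_map, FamExt.comm_map, h₂, LinearMap.zero_comp]
      · change FamExt.comm _ D.q (x 2).1 (x 2).2 = 0
        rw [FamExt.comm_map, h₃]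
  refine red_cost _ (FamExt.comm (((c.comap j₁).comap j₂).comap j₃) D.a 1 (ζ : K))
    (T.rootForm _ _ (lForm hD))
    fun V₄ _ _ _ j₄ h₄ => ?_
  rw [← FamExt.comm_map] at h₄
  exact red_of_comm_eq_zero p hD T hq h0 hU hi
    (fun v w => by rw [FamExt.comm_map, hc, LinearMap.zero_comp]) ((lForm hD).eq_zero hζ h₄)

end BorelData

theorem map_neg_one_eq {K R : Type} [Field K] [CommRing R] [IsDomain R] (χ : Kˣ × Kˣ →* R) :
    χ (-1, 1) = 1 ∨ χ (-1, 1) = -1 := by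
  rw [← sq_eq_one_iff, ← map_pow]
  simp [← Prod.one_eq_mk]

variable {K R : Type} [Field K] [Fintype K] [CommRing R] {χ : Kˣ × Kˣ →* R} {ζ : Kˣ}

theorem vanishTable_odd [IsDomain R] (hq : Fintype.card K ≠ 2) (h2 : (2 : K) ≠ 0)
    (h2' : (2 : R) ≠ 0)
    (hζ : ∀ x, x ∈ Subgroup.zpowers ζ) :
    VanishTable χ ζ ![(vb K 1, vb K ζ), (vb K ζ, vb K (ζ * ζ)), (vb K 1, vm K 1)]
      ![(∀ u, χ (u, 1) = 1) ∧ Fintype.card K ≠ 3, (∀ u, χ (u, 1) = 1) ∧ Fintype.card K ≠ 3,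
        χ (-1, 1) = -1, χ (-1, 1) = 1 ∧ ¬ ∀ u, χ (u, 1) = 1, ∀ u, χ (u, 1) = 1,
        χ (-1, 1) = -1 ∧ ∀ u, χ (u, u) = 1, χ (-1, 1) = -1 ∧ ¬ ∀ u, χ (u, u) = 1,
        χ (-1, 1) = 1 ∧ ((¬ ∀ u, χ (u, 1) = 1) ∨ Fintype.card K = 3), χ (-1, 1) = -1] where
  form N _ _ _ B h := by
    have key (hC : ¬ ((∀ u, χ (u, 1) = 1) ∧ Fintype.card K ≠ 3)) (x y : K) :
        B (vb K x) (vb K y) = 0 := by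
      by_cases h1 : ∀ u, χ (u, 1) = 1
      · exact (h.biAdd.comp (vb K) (vb K)).eq_zero_of_card_eq_three
          (not_not.1 fun h3 => hC ⟨h1, h3⟩) (fun x => h.alt _) x y
      · exact h.bb_of_ne_one h1 x y
    exact ⟨fun hC => key hC _ _, fun hC => key hC _ _, fun hC => h.bm_of_ne hC _ _,
      fun hB => h.eq_zero_odd hq h2 h2' hζ (hB 0) (hB 1) (hB 2)⟩
  rootForm N _ _ _ φ h hC := by
    by_cases h1 : ∀ u, χ (u, 1) = 1
    · exact h.eq_zero_of_one hq h2 h1 _ _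
    · exact h.eq_zero_of_ne (fun h3 => hC ⟨h3, h1⟩) _ _
  pow N _ _ _ P h hC := h.b_of_ne_one hC _
  rootPow N _ _ _ P h hC := by
    by_cases h1 : ∀ u, χ (u, u) = 1
    · exact h.eq_zero_of_ne (fun h3 => hC ⟨h3, h1⟩) _
    · exact h.eq_zero_of_ne_one h1 _
  cocD N _ _ _ f h hC := by
    by_cases h1 : ∀ u, χ (u, u) = 1
    · exact h.d_of_one h2 h1 _ _
    · exact h.d_of_ne (fun h3 => hC ⟨h3, h1⟩) _ _
  cocM N _ _ _ f h hd hC := by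
    by_cases h1 : χ (-1, 1) = 1
    · have h3 : (∀ u, χ (u, 1) = 1) ∧ Fintype.card K ≠ 3 := by
        have : ¬ ((¬ ∀ u, χ (u, 1) = 1) ∨ Fintype.card K = 3) := fun h' => hC ⟨h1, h'⟩
        tauto
      have := Fintype.one_lt_card (α := K)
      exact h.m_of_one (by omega) h2 h3.1 (fun s z => hd s _) _ _
    · exact h.m_of_ne (fun s z => hd s _) h1 _ _
  cocB N _ _ _ f h hd hm hC := h.b_of_ne hd hm hC _ _

theorem vanishTable_even [IsDomain R] (hq : Fintype.card K ≠ 2) (h2 : (2 : K) = 0)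
    (h2' : (2 : R) = 0)
    (hζ : ∀ x, x ∈ Subgroup.zpowers ζ) :
    VanishTable χ ζ ![(vb K 1, vb K ζ), (vb K 1, vm K 1), (vb K 1, vd K 1)]
      ![(∀ u, χ (u, 1) = 1) ∧ ¬ AddChar' χ (fun u => (1, u)), ¬ ∀ u, χ (u, 1) = 1,
        ¬ ∀ u, χ (u, 1) = 1, (∀ u, χ (u, u) = 1) ∧ ¬ AddChar' χ (fun u => (u, 1)),
        (∀ u, χ (u, 1) = 1) ∧ AddChar' χ (fun u => (1, u)),
        (∀ u, χ (u, u) = 1) ∧ AddChar' χ (fun u => (u, 1)),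
        (¬ ∀ u, χ (u, u) = 1) ∧ ¬ AddChar' χ (fun u => (u, 1)), False,
        (¬ ∀ u, χ (u, 1) = 1) ∧ (¬ ∀ u, χ (u, u) = 1) ∧ AddChar' χ (fun u => (u, 1))] where
  form N _ _ _ B h := by
    refine ⟨fun hC => ?_, fun hC => h.bm_of_one hq (not_not.1 hC) _ _,
      fun hC => h.bd_of_one hq h2 (not_not.1 hC) _ _,
      fun hB => h.eq_zero_even hq h2 hζ (hB 0) (hB 1) (hB 2)⟩
    by_cases h1 : ∀ u, χ (u, 1) = 1
    · exact h.bb_of_addChar h2 h2' (not_not.1 fun h3 => hC ⟨h1, h3⟩) hζ _ _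
    · exact h.bb_of_ne_one h1 _ _
  rootForm N _ _ _ φ h hC := by
    by_cases h1 : ∀ u, χ (u, u) = 1
    · exact h.eq_zero_of_addChar h2 h2' (not_not.1 fun h3 => hC ⟨h1, h3⟩) hζ _ _
    · exact h.eq_zero_of_ne_one h1 _ _
  pow N _ _ _ P h hC := by
    by_cases h1 : ∀ u, χ (u, 1) = 1
    · exact h.b_of_not_addChar h2 (fun h3 => hC ⟨h1, h3⟩)
    · exact h.b_of_ne_one h1 _
  rootPow N _ _ _ P h hC := by
    by_cases h1 : ∀ u, χ (u, u) = 1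
    · exact h.one_of_not_addChar (fun h3 => hC ⟨h1, h3⟩)
    · exact h.eq_zero_of_ne_one h1 _
  cocD N _ _ _ f h hC := by
    by_cases h1 : ∀ u, χ (u, u) = 1
    · exact h.d_of_one_even hq h2 h1 _ _
    · exact h.d_of_addChar hq h2 (not_not.1 fun h3 => hC ⟨h1, h3⟩) _ _
  cocM N _ _ _ f h hd _ := h.m_of_d h2 hd _ _
  cocB N _ _ _ f h hd hm hC := by
    by_cases h1 : ∀ u, χ (u, 1) = 1
    · exact h.b_of_one hq hd hm h1 _ _
    by_cases h3 : ∀ u, χ (u, u) = 1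
    · exact h.b_of_one' hq h2 h3 _ _
    · exact h.b_of_not_addChar hd hm (fun h4 => hC ⟨h1, h3, h4⟩) _ _

theorem map_eq_one_of_card_eq_three (hq : Fintype.card K = 3) (h : χ (-1, 1) = 1) (u : Kˣ) :
    χ (u, 1) = 1 := by
  have h1 := FiniteField.pow_card_sub_one_eq_one (u : K) u.ne_zero
  rw [hq] at h1
  obtain h1 | h1 := sq_eq_one_iff.1 h1
  · rw [Units.val_eq_one.1 h1]; exact map_one χ
  · rw [show u = -1 from Units.ext h1, h]

namespace BorelData

variable {B F M : Type} [Group B] [Field F] [AddCommGroup M] [Module F M]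
  [FiniteDimensional F M] [Module R M] [SMulCommClass F R M] [IsTorsionFree R M]
  {ρ : Representation F B M} {D : BorelData K B}

theorem codim_le [IsDomain R] (p : ℕ) [Fact p.Prime] [CharP F p] [CharP K p] [CharP R p]
    (hD : D.Acts ρ χ)
    (hq : Fintype.card K ≠ 2) (h0 : (Nat.card (Kˣ × Kˣ) : F) ≠ 0)
    (hU : Function.Injective D.unip) (hi : (D.unip.range.index : F) ≠ 0) :
    Codim ρ (3 * finrank F M) := by
  obtain ⟨ζ, hζ⟩ := IsCyclic.exists_generator (α := Kˣ)
  have hK : (2 : K) = 0 ↔ p ∣ 2 := by rw [← CharP.cast_eq_zero_iff K p]; simp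
  have hR : (2 : R) = 0 ↔ p ∣ 2 := by rw [← CharP.cast_eq_zero_iff R p]; simp
  by_cases h2 : (2 : K) = 0
  · refine (codim_of_table p hD (vanishTable_even (χ := χ) hq h2 (hR.2 (hK.1 h2)) hζ) hζ hq h0 hU
      hi).mono ?_
    by_cases h1 : ∀ u, χ (u, 1) = 1 <;> by_cases h3 : ∀ u, χ (u, u) = 1 <;>
      by_cases h4 : AddChar' χ (fun u => (u, 1)) <;> by_cases h5 : AddChar' χ (fun u => (1, u)) <;>
      simp [Fin.sum_univ_succ, cost, h1, h3, h4, h5] <;> omega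
  · have h2' : (2 : R) ≠ 0 := fun h => h2 (hK.2 (hR.1 h))
    refine (codim_of_table p hD (vanishTable_odd (χ := χ) hq h2 h2' hζ) hζ hq h0 hU
      hi).mono ?_
    have hne : (1 : R) ≠ -1 := fun h => h2' (by linear_combination h)
    by_cases h1 : ∀ u, χ (u, 1) = 1
    · by_cases h4 : Fintype.card K = 3 <;> simp [Fin.sum_univ_succ, cost, h1, hne, h4] <;> omega
    · obtain h | h := map_neg_one_eq χ
      · have h4 : Fintype.card K ≠ 3 := fun h4 => h1 (map_eq_one_of_card_eq_three h4 h)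
        simp [Fin.sum_univ_succ, cost, h1, h, hne, h4]; omega
      · by_cases h3 : ∀ u, χ (u, u) = 1 <;>
          simp [Fin.sum_univ_succ, cost, h1, h, hne.symm, h3] <;> omega

end BorelData

end Table

section Irreducible

open Module

variable {F : Type} [Field F]

/-- A linear bound on the codimension may be checked on irreducible representations. -/
theorem Codim.of_irreducible {G : Type} [Group G] (r : ℕ)
    (h : ∀ (M : Type) [AddCommGroup M] [Module F M] [FiniteDimensional F M]
      (ρ : Representation F G M), Nontrivial M →
      (∀ W : Submodule F M, (∀ g, W ≤ W.comap (ρ g)) → W = ⊥ ∨ W = ⊤) →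
      Codim ρ (r * finrank F M))
    {M : Type} [AddCommGroup M] [Module F M] [FiniteDimensional F M]
    (ρ : Representation F G M) : Codim ρ (r * finrank F M) := by
  induction hn : finrank F M using Nat.strong_induction_on generalizing M with
  | _ n ih =>
    subst hn
    rcases subsingleton_or_nontrivial M with hM | hM
    · intro V _ _ _ c
      exact .of_splits (splits_of_cochain (fun _ => 0) fun _ _ =>
        LinearMap.ext fun _ => Subsingleton.elim _ _) _
    by_cases hW : ∀ W : Submodule F M, (∀ g, W ≤ W.comap (ρ g)) → W = ⊥ ∨ W = ⊤
    · exact h M ρ hM hW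
    push Not at hW
    obtain ⟨W, hW, hbot, htop⟩ := hW
    have h1 : finrank F W < finrank F M := Submodule.finrank_lt htop
    have h2 := W.finrank_quotient_add_finrank
    have h3 : finrank F W ≠ 0 := fun h0 => hbot (Submodule.finrank_eq_zero.1 h0)
    rw [← h2, Nat.add_comm, Nat.mul_add]
    exact Codim.of_exact W.subtype W.mkQ W.subtype_injective W.mkQ_surjective (by simp)
      (fun g => LinearMap.ext fun w => rfl) (fun g => LinearMap.ext fun w => rfl)
      (ih _ h1 (ρ.subrepresentation W hW) rfl)
      (ih _ (by omega) (ρ.quotient W hW) rfl)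

/-- A finite `p`-group acting linearly in characteristic `p` has a nonzero fixed vector. -/
theorem IsPGroup.exists_fixed_vector {p : ℕ} [Fact p.Prime] [CharP F p] {P : Type} [Group P]
    [Finite P] (hP : IsPGroup p P) {M : Type} [AddCommGroup M] [Module F M] [Nontrivial M]
    (σ : Representation F P M) : ∃ m ≠ 0, ∀ g, σ g m = m := by
  obtain ⟨m₀, hm₀⟩ := exists_ne (0 : M)
  let S : AddSubgroup M := AddSubgroup.closure (Set.range fun g => σ g m₀)
  have hS : ∀ g, ∀ m ∈ S, σ g m ∈ S := fun g m hm => by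
    have : S ≤ S.comap (σ g).toAddMonoidHom := by
      rw [AddSubgroup.closure_le]
      rintro _ ⟨k, rfl⟩
      refine AddSubgroup.subset_closure ⟨g * k, ?_⟩
      simp
    exact this hm
  have hp : ∀ m : M, p • m = 0 := fun m => by
    rw [← Nat.cast_smul_eq_nsmul F, CharP.cast_eq_zero, zero_smul]
  have hfg : AddGroup.FG S :=
    (AddGroup.fg_iff_addSubgroup_fg _).2 ((AddSubgroup.fg_iff _).2 ⟨_, rfl, Set.finite_range _⟩)
  have hfin : Finite S := AddCommGroup.finite_of_fg_isAddTorsion S fun x =>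
    isOfFinAddOrder_iff_nsmul_eq_zero.2 ⟨p, (Fact.out : p.Prime).pos, Subtype.ext (hp x)⟩
  let _ : MulAction P S :=
    { smul := fun g m => ⟨σ g m, hS g m m.2⟩
      one_smul := fun m => Subtype.ext (by change σ 1 (m : M) = m; simp)
      mul_smul := fun g k m => Subtype.ext (by
        change σ (g * k) (m : M) = σ g (σ k m); simp) }
  have hdvd : p ∣ Nat.card S := by
    have hmem : m₀ ∈ S := AddSubgroup.subset_closure ⟨1, by simp⟩
    rw [← addOrderOf_eq_prime (x := (⟨m₀, hmem⟩ : S)) (Subtype.ext (hp m₀))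
      (fun h => hm₀ (congrArg Subtype.val h))]
    exact addOrderOf_dvd_natCard _
  obtain ⟨b, hb, hb0⟩ := hP.exists_fixed_point_of_prime_dvd_card_of_fixed_point S hdvd
    (a := 0) (fun g => Subtype.ext (map_zero (σ g)))
  exact ⟨b, fun h => hb0 (Subtype.ext h.symm), fun g => congrArg Subtype.val (hb g)⟩

namespace BorelData

open Multiplicative (ofAdd)
open scoped IsMulCommutative

variable {K B : Type} [Field K] [Group B] {D : BorelData K B} {M : Type} [AddCommGroup M]
  [Module F M] {ρ : Representation F B M}

theorem invariant_of_generators [FiniteDimensional F M]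
    (hgen : Subgroup.closure (Set.range D.q ∪ Set.range D.a ∪ Set.range D.h) = ⊤)
    {W : Submodule F M} (hq : ∀ v, W ≤ W.comap (ρ (D.q v))) (ha : ∀ s, W ≤ W.comap (ρ (D.a s)))
    (hh : ∀ u, W ≤ W.comap (ρ (D.h u))) (g : B) : W ≤ W.comap (ρ g) := by
  have hg : g ∈ Subgroup.closure (Set.range D.q ∪ Set.range D.a ∪ Set.range D.h) := by
    rw [hgen]; trivial
  suffices h : W ≤ W.comap (ρ g) ∧ W ≤ W.comap (ρ g⁻¹) from h.1
  induction hg using Subgroup.closure_induction with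
  | mem x hx =>
    rcases hx with (⟨v, rfl⟩ | ⟨s, rfl⟩) | ⟨u, rfl⟩
    · exact ⟨hq v, map_inv D.q v ▸ hq v⁻¹⟩
    · exact ⟨ha s, map_inv D.a s ▸ ha s⁻¹⟩
    · exact ⟨hh u, map_inv D.h u ▸ hh u⁻¹⟩
  | one =>
    rw [inv_one, map_one]
    exact ⟨le_rfl, le_rfl⟩
  | mul x y _ _ hx hy =>
    refine ⟨fun m hm => ?_, fun m hm => ?_⟩
    · rw [Submodule.mem_comap, map_mul]
      exact hx.1 (hy.1 hm)
    · rw [Submodule.mem_comap, mul_inv_rev, map_mul]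
      exact hy.2 (hx.2 hm)
  | inv x _ hx => exact ⟨hx.2, by simpa using hx.1⟩

theorem unip_trivial_of_irreducible [FiniteDimensional F M] [Nontrivial M] [Finite K] {p : ℕ}
    [Fact p.Prime] [CharP F p] [CharP K p]
    (hgen : Subgroup.closure (Set.range D.q ∪ Set.range D.a ∪ Set.range D.h) = ⊤)
    (hirr : ∀ W : Submodule F M, (∀ g, W ≤ W.comap (ρ g)) → W = ⊥ ∨ W = ⊤) :
    (∀ v, ρ (D.q v) = 1) ∧ ∀ s, ρ (D.a s) = 1 := by
  let W : Submodule F M :=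
    { carrier := {m | (∀ v, ρ (D.q v) m = m) ∧ ∀ s, ρ (D.a s) m = m}
      add_mem' := fun ha hb => ⟨fun v => by rw [map_add, ha.1, hb.1],
        fun s => by rw [map_add, ha.2, hb.2]⟩
      zero_mem' := by simp
      smul_mem' := fun r m hm => ⟨fun v => by rw [map_smul, hm.1],
        fun s => by rw [map_smul, hm.2]⟩ }
  have hWinv := invariant_of_generators (ρ := ρ) hgen (W := W)
    (fun v m hm => by rwa [Submodule.mem_comap, hm.1])
    (fun s m hm => by rwa [Submodule.mem_comap, hm.2])
    (fun u m hm => by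
      refine ⟨fun v => ?_, fun s => ?_⟩
      · have h := D.h_q u (tor u⁻¹ v.toAdd)
        rw [tor_tor, mul_inv_cancel, tor_one] at h
        have h' := congrArg (fun g => ρ g m) h
        simp only [map_mul, Module.End.mul_apply, hm.1] at h'
        exact h'.symm
      · have h := D.h_a u (torRoot u⁻¹ s.toAdd)
        have h1 := u.1.ne_zero
        have h2 := u.2.ne_zero
        have : torRoot u (torRoot u⁻¹ s.toAdd) = s.toAdd := by
          simp only [torRoot, Prod.fst_inv, Prod.snd_inv, Units.val_inv_eq_inv_val]
          field_simp
        rw [this] at h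
        have h' := congrArg (fun g => ρ g m) h
        simp only [map_mul, Module.End.mul_apply, hm.2] at h'
        exact h'.symm)
  have : Finite (Multiplicative (K × K × K) ⋊[shearAut K] Multiplicative K) :=
    .of_equiv _ SemidirectProduct.equivProd.symm
  obtain ⟨m, hm0, hm⟩ := IsPGroup.exists_fixed_vector (p := p)
    (P := Multiplicative (K × K × K) ⋊[shearAut K] Multiplicative K) (by
      have := Fintype.ofFinite K
      obtain ⟨n, -, hn⟩ := FiniteField.card K p
      refine IsPGroup.of_card (n := n * 4) ?_
      rw [SemidirectProduct.card, Nat.card_congr Multiplicative.toAdd,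
        Nat.card_congr Multiplicative.toAdd, Nat.card_prod, Nat.card_prod,
        Nat.card_eq_fintype_card, hn, pow_mul]
      ring) (ρ.comp D.unip)
  have htop : W = ⊤ := (hirr W hWinv).resolve_left fun h => hm0 (by
    have : m ∈ W := ⟨fun v => by
      have := hm (SemidirectProduct.inl v)
      rwa [MonoidHom.comp_apply, unip, SemidirectProduct.lift_inl] at this, fun s => by
      have := hm (SemidirectProduct.inr s)
      rwa [MonoidHom.comp_apply, unip, SemidirectProduct.lift_inr] at this⟩
    rwa [h] at this)
  have hall (m : M) : m ∈ W := htop ▸ Submodule.mem_top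
  exact ⟨fun v => LinearMap.ext fun m => (hall m).1 v, fun s => LinearMap.ext fun m => (hall m).2 s⟩

/-- The codimension bound for all representations of a Borel subgroup in defining
characteristic. -/
theorem codim_of_generators [Fintype K] [FiniteDimensional F M] (p : ℕ) [Fact p.Prime]
    [CharP F p] [CharP K p]
    (hgen : Subgroup.closure (Set.range D.q ∪ Set.range D.a ∪ Set.range D.h) = ⊤)
    (hq : Fintype.card K ≠ 2) (h0 : (Nat.card (Kˣ × Kˣ) : F) ≠ 0)
    (hU : Function.Injective D.unip) (hi : (D.unip.range.index : F) ≠ 0)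
    (ρ : Representation F B M) : Codim ρ (3 * finrank F M) := by
  refine Codim.of_irreducible 3 (fun M _ _ _ ρ hM hirr => ?_) ρ
  obtain ⟨hQ, hA⟩ := unip_trivial_of_irreducible (p := p) hgen hirr
  let S : Set (End F M) := Set.range fun u => ρ (D.h u)
  have hcomm : ∀ a ∈ S, ∀ b ∈ S, a * b = b * a := by
    rintro _ ⟨u, rfl⟩ _ ⟨u', rfl⟩
    simp only [← map_mul, mul_comm]
  have : IsMulCommutative (Algebra.adjoin F S) := Algebra.isMulCommutative_adjoin F hcomm
  let χ : Kˣ × Kˣ →* Algebra.adjoin F S :=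
    { toFun := fun u => ⟨ρ (D.h u), Algebra.subset_adjoin ⟨u, rfl⟩⟩
      map_one' := Subtype.ext (by simp)
      map_mul' := fun u u' => Subtype.ext (by simp) }
  have hinj (r : Algebra.adjoin F S) (hr : r ≠ 0) : Function.Injective (r : End F M) := by
    rw [← LinearMap.ker_eq_bot]
    refine (hirr _ (invariant_of_generators hgen (fun v => ?_) (fun s => ?_)
      fun u m hm => ?_)).resolve_right fun h => hr (Subtype.ext (LinearMap.ker_eq_top.1 h))
    · rw [hQ]; exact le_rfl
    · rw [hA]; exact le_rfl
    · have h : (r : End F M) * ρ (D.h u) = ρ (D.h u) * r := congrArg Subtype.val (mul_comm r (χ u))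
      rw [Submodule.mem_comap, LinearMap.mem_ker, ← Module.End.mul_apply, h, Module.End.mul_apply,
        LinearMap.mem_ker.1 hm, map_zero]
  have : IsDomain (Algebra.adjoin F S) := by
    have : Nontrivial (Algebra.adjoin F S) := inferInstance
    have : NoZeroDivisors (Algebra.adjoin F S) := ⟨fun {a b} hab => by
      by_contra! h
      obtain ⟨m, hm⟩ := exists_ne (0 : M)
      apply hm
      apply hinj b h.2
      apply hinj a h.1
      simpa using congrArg (fun t : Algebra.adjoin F S => (t : End F M) m) hab⟩
    exact NoZeroDivisors.to_isDomain _
  have : IsTorsionFree (Algebra.adjoin F S) M := .of_smul_eq_zero fun r m h => by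
    by_contra! h'
    exact h'.2 (hinj r h'.1 (h.trans (map_zero (r : End F M)).symm))
  have : CharP (Algebra.adjoin F S) p :=
    charP_of_injective_algebraMap (algebraMap F (Algebra.adjoin F S)).injective p
  exact codim_le p (χ := χ) ⟨hQ, hA, fun u m => rfl⟩ hq h0 hU hi

end BorelData

end Irreducible

section SpBorel

open Matrix Module
open Multiplicative (ofAdd)

namespace SpBorel

variable {K : Type} [Field K]

theorem fromBlocks_mem {A S D : Matrix (Fin 2) (Fin 2) K} (h : A * Dᵀ = 1) (hS : A * Sᵀ = S * Aᵀ) :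
    Matrix.fromBlocks A S 0 D ∈ symplecticGroup (Fin 2) K := by
  rw [SymplecticGroup.mem_iff, Matrix.J, Matrix.fromBlocks_transpose, Matrix.fromBlocks_multiply,
    Matrix.fromBlocks_multiply]
  have h' : D * Aᵀ = 1 := by simpa using congrArg Matrix.transpose h
  simp [h, h', hS]

variable (K) in
/-- The unipotent radical of the Siegel parabolic subgroup. -/
def siegel : Multiplicative (K × K × K) →* symplecticGroup (Fin 2) K where
  toFun v := ⟨Matrix.fromBlocks 1
    !![v.toAdd.2.2, v.toAdd.2.1; v.toAdd.2.1, v.toAdd.1] 0 1, fromBlocks_mem (by simp) (by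
      ext i j; fin_cases i <;> fin_cases j <;> simp)⟩
  map_one' := Subtype.ext (by
    ext (i | i) (j | j) <;> fin_cases i <;> fin_cases j <;> simp)
  map_mul' v w := Subtype.ext (by
    rw [Submonoid.coe_mul, Matrix.fromBlocks_multiply]
    refine Matrix.fromBlocks_inj.2 ⟨by simp, ?_, by simp, by simp⟩
    ext i j
    fin_cases i <;> fin_cases j <;> simp [add_comm])

variable (K) in
/-- The short root subgroup of the Levi factor. -/
def root : Multiplicative K →* symplecticGroup (Fin 2) K where
  toFun s := ⟨Matrix.fromBlocks !![1, s.toAdd; 0, 1] 0 0 !![1, 0; -s.toAdd, 1],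
    fromBlocks_mem (by ext i j; fin_cases i <;> fin_cases j <;> simp [Matrix.mul_apply]) (by simp)⟩
  map_one' := Subtype.ext (by
    ext (i | i) (j | j) <;> fin_cases i <;> fin_cases j <;> simp)
  map_mul' v w := Subtype.ext (by
    rw [Submonoid.coe_mul, Matrix.fromBlocks_multiply]
    refine Matrix.fromBlocks_inj.2 ⟨?_, ?_, ?_, ?_⟩ <;> ext i j <;> fin_cases i <;> fin_cases j <;>
      simp [add_comm])

variable (K) in
/-- The diagonal torus. -/
def torus : Kˣ × Kˣ →* symplecticGroup (Fin 2) K where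
  toFun u := ⟨Matrix.fromBlocks !![(u.1 : K), 0; 0, u.2] 0 0 !![(u.1 : K)⁻¹, 0; 0, (u.2 : K)⁻¹],
    fromBlocks_mem (by ext i j; fin_cases i <;> fin_cases j <;> simp [Matrix.mul_apply]) (by simp)⟩
  map_one' := Subtype.ext (by
    ext (i | i) (j | j) <;> fin_cases i <;> fin_cases j <;> simp)
  map_mul' v w := Subtype.ext (by
    rw [Submonoid.coe_mul, Matrix.fromBlocks_multiply]
    refine Matrix.fromBlocks_inj.2 ⟨?_, ?_, ?_, ?_⟩ <;> ext i j <;> fin_cases i <;> fin_cases j <;>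
      simp [mul_comm])

theorem root_siegel (s : K) (v : K × K × K) :
    root K (ofAdd s) * siegel K (ofAdd v) = siegel K (ofAdd (shear s v)) * root K (ofAdd s) :=
  Subtype.ext (by
    simp only [Submonoid.coe_mul, root, siegel, MonoidHom.coe_mk, OneHom.coe_mk,
      Matrix.fromBlocks_multiply, Matrix.mul_one, Matrix.one_mul]
    refine Matrix.fromBlocks_inj.2 ⟨?_, ?_, ?_, ?_⟩ <;> ext i j <;> fin_cases i <;> fin_cases j <;>
      simp [shear] <;> ring)

theorem torus_siegel (u : Kˣ × Kˣ) (v : K × K × K) :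
    torus K u * siegel K (ofAdd v) = siegel K (ofAdd (tor u v)) * torus K u :=
  Subtype.ext (by
    have h1 := u.1.ne_zero
    have h2 := u.2.ne_zero
    simp only [Submonoid.coe_mul, torus, siegel, MonoidHom.coe_mk, OneHom.coe_mk,
      Matrix.fromBlocks_multiply, Matrix.mul_one, Matrix.one_mul]
    refine Matrix.fromBlocks_inj.2 ⟨?_, ?_, ?_, ?_⟩ <;> ext i j <;> fin_cases i <;> fin_cases j <;>
      simp [tor] <;> field_simp)

theorem torus_root (u : Kˣ × Kˣ) (s : K) :
    torus K u * root K (ofAdd s) = root K (ofAdd (torRoot u s)) * torus K u :=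
  Subtype.ext (by
    have h1 := u.1.ne_zero
    have h2 := u.2.ne_zero
    simp only [Submonoid.coe_mul, torus, root, MonoidHom.coe_mk, OneHom.coe_mk,
      Matrix.fromBlocks_multiply]
    refine Matrix.fromBlocks_inj.2 ⟨?_, ?_, ?_, ?_⟩ <;> ext i j <;> fin_cases i <;> fin_cases j <;>
      simp [torRoot] <;> field_simp)

variable (K) in
/-- The Borel subgroup of upper triangular symplectic matrices. -/
def borel : Subgroup (symplecticGroup (Fin 2) K) :=
  Subgroup.closure (Set.range (siegel K) ∪ Set.range (root K) ∪ Set.range (torus K))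

variable (K) in
/-- The root subgroups and torus of the Borel subgroup of the symplectic group. -/
def data : BorelData K (borel K) where
  q := (siegel K).codRestrict _ fun v => Subgroup.subset_closure (.inl (.inl ⟨v, rfl⟩))
  a := (root K).codRestrict _ fun s => Subgroup.subset_closure (.inl (.inr ⟨s, rfl⟩))
  h := (torus K).codRestrict _ fun u => Subgroup.subset_closure (.inr ⟨u, rfl⟩)
  a_q s v := Subtype.ext (root_siegel s v)
  h_q u v := Subtype.ext (torus_siegel u v)
  h_a u s := Subtype.ext (torus_root u s)

theorem closure_data : Subgroup.closure
    (Set.range (data K).q ∪ Set.range (data K).a ∪ Set.range (data K).h) = ⊤ := by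
  refine Eq.trans (congrArg Subgroup.closure ?_) (Subgroup.closure_closure_coe_preimage
    (k := Set.range (siegel K) ∪ Set.range (root K) ∪ Set.range (torus K)))
  ext x
  have h {α : Type} (f : α → borel K) : (∃ y, f y = x) ↔ ∃ y, (f y).val = x.val :=
    exists_congr fun _ => Subtype.ext_iff
  exact or_congr (or_congr (h _) (h _)) (h _)

theorem unip_injective : Function.Injective (data K).unip := by
  rw [injective_iff_map_eq_one]
  rintro ⟨v, s⟩ h
  have h' : siegel K v * root K s = 1 := congrArg Subtype.val h
  have h'' : Matrix.fromBlocks 1 !![v.toAdd.2.2, v.toAdd.2.1; v.toAdd.2.1, v.toAdd.1] 0 1 *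
      Matrix.fromBlocks !![1, s.toAdd; 0, 1] 0 0 !![1, 0; -s.toAdd, 1] =
      (1 : Matrix (Fin 2 ⊕ Fin 2) (Fin 2 ⊕ Fin 2) K) := congrArg Subtype.val h'
  rw [← Matrix.fromBlocks_one, Matrix.fromBlocks_multiply, Matrix.fromBlocks_inj] at h''
  obtain ⟨h1, h2, -, -⟩ := h''
  have hs : s.toAdd = 0 := by simpa using congrFun₂ h1 0 1
  have e1 := congrFun₂ h2 0 0
  have e2 := congrFun₂ h2 0 1
  have e3 := congrFun₂ h2 1 1
  simp [hs] at e1 e2 e3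
  exact SemidirectProduct.ext (Prod.ext e3 (Prod.ext e2 e1)) hs

variable [Fintype K] {F : Type} [Field F]

theorem index_ne_zero (hq : (Fintype.card K : F) = 0) :
    ((borel K).index : F) ≠ 0 ∧ ((data K).unip.range.index : F) ≠ 0 := by
  have h1 := (borel K).card_mul_index
  have h2 := (data K).unip.range.card_mul_index
  rw [Nat.card_congr (MonoidHom.ofInjective unip_injective).toEquiv.symm, SemidirectProduct.card,
    Nat.card_congr Multiplicative.toAdd, Nat.card_congr Multiplicative.toAdd, Nat.card_prod,
    Nat.card_prod] at h2
  rw [natCard_Sp4, ← h2] at h1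
  have hK : 1 < Fintype.card K := Fintype.one_lt_card
  have hpos : 0 < Fintype.card K ^ 4 := by positivity
  rw [Nat.card_eq_fintype_card] at h1
  have key : (data K).unip.range.index * (borel K).index =
      (Fintype.card K ^ 4 - 1) * (Fintype.card K ^ 2 - 1) :=
    Nat.eq_of_mul_eq_mul_left hpos (by linarith)
  have hF := congrArg (Nat.cast : ℕ → F) key
  rw [Nat.cast_mul, Nat.cast_mul, Nat.cast_sub (Nat.one_le_pow _ _ (by omega)),
    Nat.cast_sub (Nat.one_le_pow _ _ (by omega))] at hF
  push_cast at hF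
  rw [hq] at hF
  constructor <;> intro h0 <;> simp [h0] at hF

end SpBorel

/-- The codimension bound for symplectic groups in defining characteristic. -/
theorem codim_of_card_eq_zero {K : Type} [Field K] [Fintype K] {F M : Type} [Field F]
    [AddCommGroup M] [Module F M] [FiniteDimensional F M]
    (ρ : Representation F (symplecticGroup (Fin 2) K) M) (hq : (Fintype.card K : F) = 0)
    (h2 : Fintype.card K ≠ 2) : Codim ρ (3 * finrank F M) := by
  obtain ⟨p, hK⟩ := CharP.exists K
  obtain ⟨n, hp, hn⟩ := FiniteField.card K p
  have : Fact p.Prime := ⟨hp⟩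
  have hpF : (p : F) = 0 := by
    rw [hn, Nat.cast_pow] at hq
    exact pow_eq_zero_iff n.ne_zero |>.1 hq
  have : CharP F p := by
    rw [← CharP.ringChar_of_prime_eq_zero hp hpF]
    infer_instance
  obtain ⟨hi, hi'⟩ := SpBorel.index_ne_zero (K := K) hq
  refine Codim.of_res (SpBorel.borel K).subtype Subtype.val_injective
    (by rwa [Subgroup.range_subtype]) ?_
  refine BorelData.codim_of_generators p SpBorel.closure_data h2 ?_ SpBorel.unip_injective hi' _
  classical
  rw [Nat.card_prod, Nat.card_eq_fintype_card, Fintype.card_units, Nat.cast_mul,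
    Nat.cast_sub Fintype.card_pos, hq]
  simp

end SpBorel

section Final

open Matrix Module

theorem codim_symplecticGroup (K : Type) [Field K] [Fintype K] (F : Type) [Field F]
    (M : Type) [AddCommGroup M] [Module F M] [FiniteDimensional F M]
    (ρ : Representation F (symplecticGroup (Fin 2) K) M) : Codim ρ (3 * finrank F M) := by
  by_cases hG : (Nat.card (symplecticGroup (Fin 2) K) : F) = 0
  swap
  · exact codim_of_natCard_ne_zero ρ hG _
  have hK : 1 < Fintype.card K := Fintype.one_lt_card
  rw [natCard_Sp4, Nat.card_eq_fintype_card] at hG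
  push_cast [Nat.cast_sub (Nat.one_le_pow 4 _ (zero_lt_one.trans hK)),
    Nat.cast_sub (Nat.one_le_pow 2 _ (zero_lt_one.trans hK))] at hG
  have hfac : (Fintype.card K : F) = 0 ∨ ((Fintype.card K : F) = 1 ∨ (Fintype.card K : F) = -1) ∨
      (Fintype.card K : F) ^ 2 = -1 := by
    by_contra! h
    obtain ⟨h1, ⟨h2, h3⟩, h4⟩ := h
    have e : ((Fintype.card K : F) ^ 2 - -1) * ((Fintype.card K : F) - 1) ^ 2 *
        ((Fintype.card K : F) - -1) ^ 2 * (Fintype.card K : F) ^ 4 = 0 := by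
      rw [← hG]; ring
    have := mul_ne_zero (mul_ne_zero (mul_ne_zero (sub_ne_zero.2 h4)
      (pow_ne_zero 2 (sub_ne_zero.2 h2))) (pow_ne_zero 2 (sub_ne_zero.2 h3))) (pow_ne_zero 4 h1)
    exact this e
  by_cases hq0 : (Fintype.card K : F) = 0
  · by_cases hq2 : Fintype.card K = 2
    · exact codim_of_card_eq_two ρ (by rw [hq2] at hq0; exact_mod_cast hq0) hq2
    · exact codim_of_card_eq_zero ρ hq0 hq2
  by_cases h2 : (2 : F) = 0
  · refine codim_of_two_eq_zero ρ h2 ?_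
    have hneg : (-1 : F) = 1 := by linear_combination -h2
    rcases hfac.resolve_left hq0 with (h | h) | h
    · exact h
    · exact h.trans hneg
    · have : ((Fintype.card K : F) - 1) ^ 2 = 0 := by
        linear_combination h + (1 - (Fintype.card K : F)) * h2 + hneg
      exact sub_eq_zero.1 (pow_eq_zero_iff two_ne_zero |>.1 this)
  · rcases hfac.resolve_left hq0 with h | h
    · exact codim_of_card_sq_eq_one ρ h2 h
    · exact (codim_of_card_sq_eq_neg_one ρ h2 h).mono (by omega)

end Final

/-- Let `q` be a prime power and `G = Sp(4,q)` the symplectic group of `4×4` matrices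
over `𝔽_q` preserving the standard nondegenerate alternating form.  Then for every field
`F` and every finite-dimensional `FG`-module `M`, `dim H²(G,M) ≤ 3 · dim M`. -/
theorem stmt_15 (p e q : ℕ) (hp : p.Prime) (he : 0 < e) (hq : q = p ^ e)
    (K : Type) [Field K] [Fintype K] (hK : Fintype.card K = q)
    (F : Type) [Field F]
    (M : Type) [AddCommGroup M] [Module F M] [FiniteDimensional F M]
    (ρ : Representation F (Matrix.symplecticGroup (Fin 2) K) M) :
    Module.finrank F (groupCohomology (Rep.of ρ) 2) ≤ 3 * Module.finrank F M := by
  exact finrank_H2_le (codim_symplecticGroup K F M ρ)
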